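/- Let H be a Hopf algebra over a field k with bijective antipode. If H is pointed, or more generally if the coradical of H is countably dimensional over k, then l.silp(H) = l.spli(H). -/

import Mathlib

open TensorProduct

universe u

noncomputable section GorensteinCore

/-- `ProjDimLE R n M` : the left `R`-module `M` has a projective resolution of length `≤ n`. -/
def ProjDimLE (R : Type u) [Ring R] : ℕ → (M : Type u) → [AddCommGroup M] → [Module R M] → Prop
  | 0, M, _, _ => Module.Projective R M
  | (n+1), M, _, _ => Module.Projective R M ∨
      ∃ (P : ModuleCat.{u} R) (f : P →ₗ[R] M), Module.Projective R P ∧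
      Function.Surjective f ∧ ProjDimLE R n (LinearMap.ker f)

/-- The projective dimension of a module, as an element of `ℕ∞` (`⊤` = infinite). -/
def projDim (R : Type u) [Ring R] (M : Type u) [AddCommGroup M] [Module R M] : ℕ∞ :=
  sInf {n : ℕ∞ | ∃ m : ℕ, n = (m : ℕ∞) ∧ ProjDimLE R m M}

/-- A module is Gorenstein projective if it is a syzygy of a totally acyclic complex of
projective modules. -/
def IsGorensteinProjective (R : Type u) [Ring R] (M : Type u) [AddCommGroup M] [Module R M] :
    Prop :=
  ∃ (P : ℤ → ModuleCat.{u} R) (d : ∀ i : ℤ, P (i+1) →ₗ[R] P i),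
    (∀ i, Module.Projective R (P i)) ∧
    (∀ i, LinearMap.range (d (i+1)) = LinearMap.ker (d i)) ∧
    (∀ (Q : ModuleCat.{u} R), Module.Projective R Q →
      ∀ (i : ℤ) (f : P (i+1) →ₗ[R] Q), f.comp (d (i+1)) = 0 →
        ∃ g : P i →ₗ[R] Q, g.comp (d i) = f) ∧
    Nonempty (M ≃ₗ[R] LinearMap.ker (d 0))

/-- `GProjDimLE R n M` : `M` has a Gorenstein projective resolution of length `≤ n`. -/
def GProjDimLE (R : Type u) [Ring R] : ℕ → (M : Type u) → [AddCommGroup M] → [Module R M] → Prop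
  | 0, M, _, _ => IsGorensteinProjective R M
  | (n+1), M, _, _ => IsGorensteinProjective R M ∨
      ∃ (G : ModuleCat.{u} R) (f : G →ₗ[R] M), IsGorensteinProjective R G ∧
      Function.Surjective f ∧ GProjDimLE R n (LinearMap.ker f)

/-- The Gorenstein projective dimension of a module, as an element of `ℕ∞`. -/
def gProjDim (R : Type u) [Ring R] (M : Type u) [AddCommGroup M] [Module R M] : ℕ∞ :=
  sInf {n : ℕ∞ | ∃ m : ℕ, n = (m : ℕ∞) ∧ GProjDimLE R m M}

/-- The (left) Gorenstein global dimension of a ring `R`. -/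
def lGgldim (R : Type u) [Ring R] : ℕ∞ :=
  ⨆ M : ModuleCat.{u} R, gProjDim R M

/-- The (left) global dimension of a ring `R`. -/
def lgldim (R : Type u) [Ring R] : ℕ∞ :=
  ⨆ M : ModuleCat.{u} R, projDim R M

/-- `InjDimLE R n M` : the left `R`-module `M` has an injective resolution of length `≤ n`. -/
def InjDimLE (R : Type u) [Ring R] : ℕ → (M : Type u) → [AddCommGroup M] → [Module R M] → Prop
  | 0, M, _, _ => Module.Injective R M
  | (n+1), M, _, _ => Module.Injective R M ∨
      ∃ (I : ModuleCat.{u} R) (f : M →ₗ[R] I), Module.Injective R I ∧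
      Function.Injective f ∧ InjDimLE R n (I ⧸ LinearMap.range f)

/-- The injective dimension of a module, as an element of `ℕ∞`. -/
def injDim (R : Type u) [Ring R] (M : Type u) [AddCommGroup M] [Module R M] : ℕ∞ :=
  sInf {n : ℕ∞ | ∃ m : ℕ, n = (m : ℕ∞) ∧ InjDimLE R m M}

/-- `silp R` : the supremum of the injective dimensions of projective left `R`-modules. -/
def silp (R : Type u) [Ring R] : ℕ∞ :=
  ⨆ (M : ModuleCat.{u} R) (_ : Module.Projective R M), injDim R M

/-- `spli R` : the supremum of the projective dimensions of injective left `R`-modules. -/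
def spli (R : Type u) [Ring R] : ℕ∞ :=
  ⨆ (M : ModuleCat.{u} R) (_ : Module.Injective R M), projDim R M

end GorensteinCore
noncomputable section HopfCore

variable (k : Type u) [CommRing k] (H : Type u) [Ring H] [HopfAlgebra k H]

/-- The trivial left `H`-module structure on `k`, given by the counit. -/
def trivModule : Module H k :=
  Module.compHom k ((Bialgebra.counitAlgHom k H : H →ₐ[k] k) : H →+* k)

/-- The trivial left `H`-module `εk`, as an object of `ModuleCat H`. -/
def trivMod : ModuleCat.{u} H :=
  @ModuleCat.of H _ k _ (trivModule k H)

/-- The counit of `H`, as a ring homomorphism out of `Hᵐᵒᵖ`. -/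
def counitOp : Hᵐᵒᵖ →+* k :=
  RingHom.fromOpposite ((Bialgebra.counitAlgHom k H : H →ₐ[k] k) : H →+* k)
    (fun _ _ => mul_comm _ _)

/-- The trivial right `H`-module structure on `k` (as a left `Hᵐᵒᵖ`-module). -/
def trivModuleOp : Module Hᵐᵒᵖ k :=
  Module.compHom k (counitOp k H)

/-- The trivial right `H`-module `k_ε`, as an object of `ModuleCat Hᵐᵒᵖ`. -/
def trivModOp : ModuleCat.{u} Hᵐᵒᵖ :=
  @ModuleCat.of Hᵐᵒᵖ _ k _ (trivModuleOp k H)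

section TensorAction

variable (M N : Type u) [AddCommGroup M] [Module k M] [Module H M]
  [IsScalarTower k H M] [SMulCommClass k H M]
  [AddCommGroup N] [Module k N] [Module H N] [IsScalarTower k H N] [SMulCommClass k H N]

/-- The representation of `H` on a left `H`-module `M`, as an algebra morphism to
`End_k(M)`. -/
def hRep : H →ₐ[k] Module.End k M :=
  (Algebra.lsmul k k M : H →ₐ[k] Module.End k M)

/-- The representation of `H` on `M ⊗[k] N` given by the comultiplication of `H`:
`h • (m ⊗ n) = ∑ h₁ • m ⊗ h₂ • n`. -/
def tensorRep : H →ₐ[k] Module.End k (M ⊗[k] N) :=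
  ((Module.endTensorEndAlgHom (R := k) (S := k) (A := k) (M := M) (N := N)).comp
    (Algebra.TensorProduct.map (hRep k H M) (hRep k H N))).comp
    (Bialgebra.comulAlgHom k H)

/-- The diagonal left `H`-module structure on `M ⊗[k] N`:
`h • (m ⊗ n) = ∑ h₁ • m ⊗ h₂ • n`. -/
def tensorModule : Module H (M ⊗[k] N) :=
  Module.compHom (M ⊗[k] N)
    ((tensorRep k H M N).toRingHom : H →+* Module.End k (M ⊗[k] N))

/-- The tensor product `M ⊗[k] N` with its diagonal left `H`-module structure, as an
object of `ModuleCat H`. -/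
def tensorMod : ModuleCat.{u} H :=
  @ModuleCat.of H _ (M ⊗[k] N) _ (tensorModule k H M N)

end TensorAction

end HopfCore


section Coradical

variable (k : Type u) [CommRing k] (H : Type u) [AddCommGroup H] [Module k H] [Coalgebra k H]

/-- A `k`-subspace `C ⊆ H` is a subcoalgebra if `Δ(C) ⊆ C ⊗ C`. -/
def IsSubcoalgebra (C : Submodule k H) : Prop :=
  ∀ x ∈ C, Coalgebra.comul (R := k) x ∈
    LinearMap.range (TensorProduct.map C.subtype C.subtype)

/-- A subcoalgebra is simple if it is nonzero and has no nonzero proper subcoalgebras. -/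
def IsSimpleSubcoalgebra (C : Submodule k H) : Prop :=
  IsSubcoalgebra k H C ∧ C ≠ ⊥ ∧
    ∀ D : Submodule k H, D ≤ C → IsSubcoalgebra k H D → D = ⊥ ∨ D = C

/-- A coalgebra is pointed if every simple subcoalgebra is one-dimensional. -/
def IsPointedCoalgebra : Prop :=
  ∀ C : Submodule k H, IsSimpleSubcoalgebra k H C → Module.finrank k C = 1

/-- The coradical of a coalgebra: the sum of all simple subcoalgebras. -/
def coradical : Submodule k H :=
  sSup {C : Submodule k H | IsSimpleSubcoalgebra k H C}

end Coradical

namespace SilpSpli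

set_option linter.style.haveILetI false
set_option linter.unusedSectionVars false

section Homological

open CategoryTheory Abelian

variable {R : Type u} [Ring R]

/-- Projective dimension at most `n`, for an unbundled module. -/
def PD (R : Type u) [Ring R] (n : ℕ) (M : Type u) [AddCommGroup M] [Module R M] : Prop :=
  HasProjectiveDimensionLE (ModuleCat.of R M) n

/-- Injective dimension at most `n`, for an unbundled module. -/
def ID (R : Type u) [Ring R] (n : ℕ) (M : Type u) [AddCommGroup M] [Module R M] : Prop :=
  HasInjectiveDimensionLE (ModuleCat.of R M) n

/-- Vanishing of `Ext^i(X, Y)`. -/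
def ExtZ (R : Type u) [Ring R] (i : ℕ) (X Y : Type u) [AddCommGroup X] [Module R X]
    [AddCommGroup Y] [Module R Y] : Prop :=
  ∀ e : Ext (ModuleCat.of R X) (ModuleCat.of R Y) i, e = 0

variable {A B C X Y : Type u} [AddCommGroup A] [Module R A] [AddCommGroup B] [Module R B]
  [AddCommGroup C] [Module R C] [AddCommGroup X] [Module R X] [AddCommGroup Y] [Module R Y]

theorem ses {f : A →ₗ[R] B} {g : B →ₗ[R] C} (hf : Function.Injective f)
    (hfg : Function.Exact f g) (hg : Function.Surjective g) :
    (ModuleCat.shortComplexOfCompEqZero f g hfg.linearMap_comp_eq_zero).ShortExact :=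
  ModuleCat.shortComplex_shortExact _ hfg hf hg

theorem pd_zero_iff : PD R 0 A ↔ Module.Projective R A := by
  rw [PD, ← projective_iff_hasProjectiveDimensionLE_zero]
  exact (IsProjective.iff_projective A).symm

theorem id_zero_iff : ID R 0 A ↔ Module.Injective R A := by
  rw [ID, HasInjectiveDimensionLE, zero_add, ← injective_iff_hasInjectiveDimensionLT_one]
  exact (Module.injective_iff_injective_object R A).symm

theorem PD.mono {m n : ℕ} (h : m ≤ n) (hA : PD R m A) : PD R n A :=
  have : HasProjectiveDimensionLT (ModuleCat.of R A) (m + 1) := hA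
  hasProjectiveDimensionLT_of_ge _ (m + 1) (n + 1) (by lia)

theorem ID.mono {m n : ℕ} (h : m ≤ n) (hA : ID R m A) : ID R n A :=
  have : HasInjectiveDimensionLT (ModuleCat.of R A) (m + 1) := hA
  hasInjectiveDimensionLT_of_ge _ (m + 1) (n + 1) (by lia)

theorem PD.of_projective (h : Module.Projective R A) (n : ℕ) : PD R n A :=
  (pd_zero_iff.2 h).mono n.zero_le

theorem ID.of_injective (h : Module.Injective R A) (n : ℕ) : ID R n A :=
  (id_zero_iff.2 h).mono n.zero_le

theorem PD.of_retract {n : ℕ} (i : A →ₗ[R] B) (r : B →ₗ[R] A) (h : ∀ x, r (i x) = x)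
    (hB : PD R n B) : PD R n A :=
  have : HasProjectiveDimensionLT (ModuleCat.of R B) (n + 1) := hB
  Retract.hasProjectiveDimensionLT (X := ModuleCat.of R A) (Y := ModuleCat.of R B)
    { i := ModuleCat.ofHom i, r := ModuleCat.ofHom r, retract := by ext x; exact h x } (n + 1)

theorem PD.of_equiv {n : ℕ} (e : B ≃ₗ[R] A) (hB : PD R n B) : PD R n A :=
  hB.of_retract e.symm.toLinearMap e.toLinearMap (by simp)

section

variable {f : A →ₗ[R] B} {g : B →ₗ[R] C} (hf : Function.Injective f)
    (hfg : Function.Exact f g) (hg : Function.Surjective g)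
include hf hfg hg

theorem PD.quot {n : ℕ} (hA : PD R n A) (hB : PD R (n + 1) B) : PD R (n + 1) C :=
  (ses hf hfg hg).hasProjectiveDimensionLT_X₃ (n + 1) hA hB

theorem PD.sub {n : ℕ} (hB : PD R n B) (hC : PD R (n + 1) C) : PD R n A :=
  (ses hf hfg hg).hasProjectiveDimensionLT_X₁ (n + 1) hB hC

theorem ID.quot {n : ℕ} (hB : ID R n B) (hA : ID R (n + 1) A) : ID R n C :=
  (ses hf hfg hg).hasInjectiveDimensionLT_X₃ (n + 1) hB hA

theorem ID.sub {n : ℕ} (hC : ID R n C) (hB : ID R (n + 1) B) : ID R (n + 1) A :=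
  (ses hf hfg hg).hasInjectiveDimensionLT_X₁ (n + 1) hC hB

theorem ExtZ.extend (h : ExtZ R 1 C Y) (φ : A →ₗ[R] Y) : ∃ ψ : B →ₗ[R] Y, ψ ∘ₗ f = φ := by
  obtain ⟨x₂, hx⟩ := Ext.contravariant_sequence_exact₁ (ses hf hfg hg)
    (Y := ModuleCat.of R Y) (Ext.mk₀ (ModuleCat.ofHom φ)) (n₁ := 1) rfl (h _)
  obtain ⟨x₂, rfl⟩ := (Ext.mk₀_bijective _ _).2 x₂
  rw [Ext.mk₀_comp_mk₀] at hx
  have := (Ext.mk₀_bijective _ _).1 hx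
  refine ⟨x₂.hom, ?_⟩
  have h2 := congrArg ModuleCat.Hom.hom this
  exact h2

theorem extZ_shift (hB : Module.Injective R B) (n : ℕ) :
    ExtZ R (n + 2) X A ↔ ExtZ R (n + 1) X C := by
  have : Injective (ModuleCat.of R B) := Module.injective_object_of_injective_module R B
  constructor
  · intro h e
    obtain ⟨x, hx⟩ := Ext.covariant_sequence_exact₃ _ (ses hf hfg hg) e (n₁ := n + 2) rfl (h _)
    rw [← hx, Ext.eq_zero_of_injective (I := ModuleCat.of R B) x, Ext.zero_comp]
  · intro h e
    obtain ⟨x, hx⟩ := Ext.covariant_sequence_exact₁ _ (ses hf hfg hg) e (n₀ := n + 1)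
      (Ext.eq_zero_of_injective (I := ModuleCat.of R B) _) rfl
    rw [← hx, h x, Ext.zero_comp]

theorem extZ_one_iff (hB : Module.Injective R B) :
    ExtZ R 1 X A ↔ ∀ φ : X →ₗ[R] C, ∃ ψ : X →ₗ[R] B, g ∘ₗ ψ = φ := by
  have : Injective (ModuleCat.of R B) := Module.injective_object_of_injective_module R B
  constructor
  · intro h φ
    obtain ⟨x, hx⟩ := Ext.covariant_sequence_exact₃ (ModuleCat.of R X) (ses hf hfg hg)
      (Ext.mk₀ (ModuleCat.ofHom φ)) (n₁ := 1) rfl (h _)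
    obtain ⟨x, rfl⟩ := (Ext.mk₀_bijective _ _).2 x
    rw [Ext.mk₀_comp_mk₀] at hx
    exact ⟨x.hom, congrArg ModuleCat.Hom.hom ((Ext.mk₀_bijective _ _).1 hx)⟩
  · intro h e
    obtain ⟨x, hx⟩ := Ext.covariant_sequence_exact₁ _ (ses hf hfg hg) e (n₀ := 0)
      (Ext.eq_zero_of_injective (I := ModuleCat.of R B) _) rfl
    obtain ⟨x, rfl⟩ := (Ext.mk₀_bijective _ _).2 x
    obtain ⟨ψ, hψ⟩ := h x.hom
    have : x = ModuleCat.ofHom ψ ≫ ModuleCat.ofHom g := by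
      ext y; exact (LinearMap.congr_fun hψ y).symm
    rw [← hx, this, ← Ext.mk₀_comp_mk₀, Ext.comp_assoc_of_second_deg_zero]
    have h3 := (ses hf hfg hg).comp_extClass
    dsimp [ModuleCat.shortComplexOfCompEqZero] at h3
    erw [h3, Ext.comp_zero]

end

theorem PD.extZ {n i : ℕ} (h : PD R n X) (hi : n < i) : ExtZ R i X Y := by
  have : HasProjectiveDimensionLT (ModuleCat.of R X) (n + 1) := h
  exact fun e => e.eq_zero_of_hasProjectiveDimensionLT (n + 1) hi

theorem ID.extZ {n i : ℕ} (h : ID R n Y) (hi : n < i) : ExtZ R i X Y := by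
  have : HasInjectiveDimensionLT (ModuleCat.of R Y) (n + 1) := h
  exact fun e => e.eq_zero_of_hasInjectiveDimensionLT (n + 1) hi

theorem pd_of_extZ {n : ℕ}
    (h : ∀ (Y : Type u) [AddCommGroup Y] [Module R Y], ExtZ R (n + 1) X Y) : PD R n X := by
  have : EnoughInjectives (ModuleCat.{u} R) := ModuleCat.enoughInjectives.{u, u} R
  exact hasProjectiveDimensionLT_of_enoughInjectives _ _
    fun Y => ⟨fun a b => (h Y a).trans (h Y b).symm⟩

theorem exact_mkQ_range {f : A →ₗ[R] B} : Function.Exact f (LinearMap.range f).mkQ :=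
  LinearMap.exact_iff.2 (by simp)

theorem exists_embed_injective (R : Type u) [Ring R] (M : Type u) [AddCommGroup M] [Module R M] :
    ∃ (E : ModuleCat.{u} R) (f : M →ₗ[R] E), Module.Injective R E ∧ Function.Injective f := by
  have : EnoughInjectives (ModuleCat.{u} R) := ModuleCat.enoughInjectives.{u, u} R
  obtain ⟨p⟩ := EnoughInjectives.presentation (ModuleCat.of R M)
  refine ⟨p.J, p.f.hom, ?_, (ModuleCat.mono_iff_injective p.f).1 p.mono⟩
  exact Module.injective_module_of_injective_object R p.J (inj := p.injective)

theorem exists_free_cover (R : Type u) [Ring R] (M : Type u) [AddCommGroup M] [Module R M] :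
    ∃ f : (M →₀ R) →ₗ[R] M, Function.Surjective f :=
  ⟨Finsupp.linearCombination R id, Finsupp.linearCombination_id_surjective R M⟩

theorem projDimLE_iff (n : ℕ) : ∀ (M : Type u) [AddCommGroup M] [Module R M],
    ProjDimLE R n M ↔ PD R n M := by
  induction n with
  | zero => intro M _ _; exact pd_zero_iff.symm
  | succ n ih =>
    intro M _ _
    constructor
    · rintro (h | ⟨P, f, hP, hf, h⟩)
      · exact .of_projective h _
      · exact PD.quot (LinearMap.ker f).injective_subtype f.exact_subtype_ker_map hf
          ((ih _).1 h) (.of_projective hP _)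
    · intro h
      obtain ⟨f, hf⟩ := exists_free_cover R M
      refine Or.inr ⟨ModuleCat.of R (M →₀ R), f, inferInstanceAs (Module.Projective R (M →₀ R)),
        hf, (ih _).2 ?_⟩
      exact PD.sub (LinearMap.ker f).injective_subtype f.exact_subtype_ker_map hf
          (.of_projective (inferInstanceAs (Module.Projective R (M →₀ R))) _) h

theorem injDimLE_iff (n : ℕ) : ∀ (M : Type u) [AddCommGroup M] [Module R M],
    InjDimLE R n M ↔ ID R n M := by
  induction n with
  | zero => intro M _ _; exact id_zero_iff.symm
  | succ n ih =>
    intro M _ _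
    constructor
    · rintro (h | ⟨P, f, hP, hf, h⟩)
      · exact .of_injective h _
      · exact ID.sub hf exact_mkQ_range (Submodule.mkQ_surjective _)
          ((ih _).1 h) (.of_injective hP _)
    · intro h
      obtain ⟨E, f, hE, hf⟩ := exists_embed_injective R M
      exact Or.inr ⟨E, f, hE, hf, (ih _).2
        (ID.quot hf exact_mkQ_range (Submodule.mkQ_surjective _) (.of_injective hE _) h)⟩

theorem sInf_le_coe_iff {P : ℕ → Prop} (hP : ∀ m n, m ≤ n → P m → P n) (n : ℕ) :
    sInf {a : ℕ∞ | ∃ m : ℕ, a = (m : ℕ∞) ∧ P m} ≤ n ↔ P n := by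
  constructor
  · intro h
    have hne : {a : ℕ∞ | ∃ m : ℕ, a = (m : ℕ∞) ∧ P m}.Nonempty := by
      by_contra hc
      rw [Set.not_nonempty_iff_eq_empty] at hc
      rw [hc, sInf_empty] at h
      exact absurd h (by simp)
    obtain ⟨m, hm, hPm⟩ := csInf_mem hne
    rw [hm] at h
    exact hP m n (by exact_mod_cast h) hPm
  · intro h
    exact sInf_le ⟨n, rfl, h⟩

theorem silp_le_iff (n : ℕ) : silp R ≤ n ↔
    ∀ (M : Type u) [AddCommGroup M] [Module R M], Module.Projective R M → ID R n M := by
  simp only [silp, iSup_le_iff, injDim]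
  have key : ∀ M : ModuleCat.{u} R,
      sInf {a : ℕ∞ | ∃ m : ℕ, a = (m : ℕ∞) ∧ InjDimLE R m M} ≤ n ↔ ID R n M := fun M => by
    rw [sInf_le_coe_iff (P := fun m => InjDimLE R m M)
      (fun m n h hm => (injDimLE_iff n M).2 (((injDimLE_iff m M).1 hm).mono h)), injDimLE_iff]
  constructor
  · intro h M _ _ hM; exact (key (ModuleCat.of R M)).1 (h (ModuleCat.of R M) hM)
  · intro h M hM; exact (key M).2 (h M hM)

theorem spli_le_iff (n : ℕ) : spli R ≤ n ↔
    ∀ (M : Type u) [AddCommGroup M] [Module R M], Module.Injective R M → PD R n M := by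
  simp only [spli, iSup_le_iff, projDim]
  have key : ∀ M : ModuleCat.{u} R,
      sInf {a : ℕ∞ | ∃ m : ℕ, a = (m : ℕ∞) ∧ ProjDimLE R m M} ≤ n ↔ PD R n M := fun M => by
    rw [sInf_le_coe_iff (P := fun m => ProjDimLE R m M)
      (fun m n h hm => (projDimLE_iff n M).2 (((projDimLE_iff m M).1 hm).mono h)), projDimLE_iff]
  constructor
  · intro h M _ _ hM; exact (key (ModuleCat.of R M)).1 (h (ModuleCat.of R M) hM)
  · intro h M hM; exact (key M).2 (h M hM)

theorem eq_of_forall_nat_le {a b : ℕ∞} (h : ∀ n : ℕ, a ≤ n ↔ b ≤ n) : a = b := by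
  refine le_antisymm ?_ ?_
  · induction b with
    | top => exact le_top
    | coe b => exact (h b).2 le_rfl
  · induction a with
    | top => exact le_top
    | coe a => exact (h a).1 le_rfl

/-- If all projectives have injective dimension at most `n`, then a module of finite projective
dimension has projective dimension at most `n`. -/
theorem PD.le_of_silp {n : ℕ}
    (h : ∀ (M : Type u) [AddCommGroup M] [Module R M], Module.Projective R M → ID R n M)
    {m : ℕ} (hX : PD R (n + m) X) : PD R n X := by
  induction m with
  | zero => exact hX
  | succ m ih =>
    refine ih (pd_of_extZ fun Y _ _ e => ?_)
    obtain ⟨f, hf⟩ := exists_free_cover R Y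
    have hs := ses (R := R) (A := LinearMap.ker f) (B := Y →₀ R) (C := Y)
      (LinearMap.ker f).injective_subtype f.exact_subtype_ker_map hf
    obtain ⟨x, hx⟩ := Ext.covariant_sequence_exact₃ (ModuleCat.of R X) hs e
      (n₁ := n + m + 1 + 1) rfl (hX.extZ (by lia) _)
    rw [← hx, (h (Y →₀ R) inferInstance).extZ (by lia) x, Ext.zero_comp]

/-- Dimension shifting in the second variable down to `Ext^1`. -/
theorem exists_shift_extZ_one (n : ℕ) : ∀ (Y : Type u) [AddCommGroup Y] [Module R Y],
    ∃ Y' : ModuleCat.{u} R, ∀ (X : Type u) [AddCommGroup X] [Module R X],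
      ExtZ R (n + 1) X Y ↔ ExtZ R 1 X Y' := by
  induction n with
  | zero => intro Y _ _; exact ⟨ModuleCat.of R Y, fun X _ _ => Iff.rfl⟩
  | succ n ih =>
    intro Y _ _
    obtain ⟨E, f, hE, hf⟩ := exists_embed_injective R Y
    obtain ⟨Y', hY'⟩ := ih (E ⧸ LinearMap.range f)
    exact ⟨Y', fun X _ _ =>
      (extZ_shift hf exact_mkQ_range (Submodule.mkQ_surjective _) hE n).trans (hY' X)⟩

end Homological

section Filtration

variable {R : Type u} [Ring R]
variable {A B C Y E Z : Type u} [AddCommGroup A] [Module R A] [AddCommGroup B] [Module R B]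
  [AddCommGroup C] [Module R C] [AddCommGroup Y] [Module R Y] [AddCommGroup E] [Module R E]
  [AddCommGroup Z] [Module R Z]

theorem exists_factor {f : A →ₗ[R] B} (hf : Function.Surjective f) (g : A →ₗ[R] C)
    (h : ∀ x, f x = 0 → g x = 0) : ∃ g' : B →ₗ[R] C, ∀ x, g' (f x) = g x := by
  refine ⟨(LinearMap.ker f).liftQ g (fun x hx => h x hx) ∘ₗ
    (f.quotKerEquivOfSurjective hf).symm.toLinearMap, fun x => ?_⟩
  have : (f.quotKerEquivOfSurjective hf).symm (f x) = (LinearMap.ker f).mkQ x := by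
    rw [LinearEquiv.symm_apply_eq]; rfl
  simp only [LinearMap.comp_apply, LinearEquiv.coe_coe, this]
  exact Submodule.liftQ_apply _ _ _

theorem exists_extend_lift {f : A →ₗ[R] B} {p : B →ₗ[R] C} (hf : Function.Injective f)
    (hfp : Function.Exact f p) (hp : Function.Surjective p)
    {i : Y →ₗ[R] E} {g : E →ₗ[R] Z} (hi : Function.Injective i)
    (hig : Function.Exact i g) (hg : Function.Surjective g) (hE : Module.Injective R E)
    (hC : ExtZ R 1 C Y) (ψ : A →ₗ[R] E) (φ : B →ₗ[R] Z) (h : ∀ x, g (ψ x) = φ (f x)) :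
    ∃ ψ' : B →ₗ[R] E, (∀ x, ψ' (f x) = ψ x) ∧ ∀ x, g (ψ' x) = φ x := by
  obtain ⟨ψ0, hψ0⟩ := hE.out f hf ψ
  obtain ⟨χ, hχ⟩ := exists_factor hp (φ - g ∘ₗ ψ0) (fun x hx => by
    obtain ⟨a, rfl⟩ := (hfp x).1 hx
    simp [hψ0, h])
  obtain ⟨χ', hχ'⟩ := (extZ_one_iff hi hig hg hE).1 hC χ
  refine ⟨ψ0 + χ' ∘ₗ p, fun x => ?_, fun x => ?_⟩
  · have : p (f x) = 0 := (hfp _).2 ⟨x, rfl⟩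
    simp [this, hψ0]
  · have : g (χ' (p x)) = χ (p x) := LinearMap.congr_fun hχ' (p x)
    simp [this, hχ]

/-- The quotient `L' / L` realised inside `G / L`. -/
abbrev subQuot {G : Type u} [AddCommGroup G] [Module R G] (L L' : Submodule R G) :
    Submodule R (G ⧸ L) := L'.map L.mkQ

section subQuot

variable {G : Type u} [AddCommGroup G] [Module R G] {L L' : Submodule R G} (h : L ≤ L')

/-- The projection `L' → L' / L`. -/
def subQuotMap (L L' : Submodule R G) : L' →ₗ[R] subQuot L L' :=
  L.mkQ.restrict fun _ hx => Submodule.mem_map_of_mem hx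

theorem subQuotMap_surjective : Function.Surjective (subQuotMap L L') := by
  rintro ⟨_, x, hx, rfl⟩; exact ⟨⟨x, hx⟩, rfl⟩

theorem subQuotMap_exact : Function.Exact (Submodule.inclusion h) (subQuotMap L L') := by
  intro x
  constructor
  · intro hx
    have : L.mkQ x = 0 := congrArg Subtype.val hx
    have hxL : (x : G) ∈ L := by simpa using this
    exact ⟨⟨x, hxL⟩, rfl⟩
  · rintro ⟨y, rfl⟩
    apply Subtype.ext
    change L.mkQ y = 0
    simp

end subQuot

theorem extZ_one_filtration {κ : Type*} [LinearOrder κ] [WellFoundedLT κ]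
    {G : Type u} [AddCommGroup G] [Module R G] (Ls : Set κ → Submodule R G)
    (hmono : ∀ s t, s ⊆ t → Ls s ≤ Ls t)
    (hcont : ∀ c : Set (Set κ), IsChain (· ⊆ ·) c → c.Nonempty →
      ∀ x ∈ Ls (⋃₀ c), ∃ s ∈ c, x ∈ Ls s)
    (h0 : ExtZ R 1 (Ls ∅) Y)
    (hstep : ∀ x, ExtZ R 1 (subQuot (Ls (Set.Iio x)) (Ls (Set.Iic x))) Y) :
    ExtZ R 1 (Ls Set.univ) Y := by
  obtain ⟨E, i, hE, hi⟩ := exists_embed_injective R Y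
  have hig := exact_mkQ_range (f := i)
  have hg := Submodule.mkQ_surjective (LinearMap.range i)
  set g := (LinearMap.range i).mkQ
  rw [extZ_one_iff hi hig hg hE]
  intro φ
  let S : Set (Set κ × (G →ₗ.[R] E)) := {p | IsLowerSet p.1 ∧ p.2.domain = Ls p.1 ∧
    ∀ (y : p.2.domain) (hy : (y : G) ∈ Ls Set.univ), g (p.2 y) = φ ⟨y, hy⟩}
  obtain ⟨ψ, hψ⟩ := (extZ_one_iff hi hig hg hE).1 h0
    (φ ∘ₗ Submodule.inclusion (hmono _ _ (Set.subset_univ _)))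
  have hbase : ((∅ : Set κ), (⟨Ls ∅, ψ⟩ : G →ₗ.[R] E)) ∈ S :=
    ⟨isLowerSet_empty, rfl, fun y hy => LinearMap.congr_fun hψ y⟩
  obtain ⟨m, -, hm⟩ := zorn_le_nonempty₀ S (by
    intro c hcS hc p0 hp0
    have hdir : DirectedOn (· ≤ ·) (Prod.snd '' c) := by
      rintro _ ⟨p, hp, rfl⟩ _ ⟨q, hq, rfl⟩
      rcases hc.total hp hq with h | h
      · exact ⟨q.2, ⟨q, hq, rfl⟩, h.2, le_rfl⟩
      · exact ⟨p.2, ⟨p, hp, rfl⟩, le_rfl, h.2⟩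
    have hdom : ∀ p ∈ c, p.2.domain ≤ (LinearPMap.sSup (Prod.snd '' c) hdir).domain :=
      fun p hp => (LinearPMap.le_sSup hdir (Set.mem_image_of_mem Prod.snd hp)).1
    have hmem : ∀ y ∈ (LinearPMap.sSup (Prod.snd '' c) hdir).domain,
        ∃ p ∈ c, y ∈ p.2.domain := by
      intro y hy
      rw [LinearPMap.domain_sSup, Submodule.mem_sSup_of_directed] at hy
      · obtain ⟨_, ⟨_, ⟨p, hp, rfl⟩, rfl⟩, hy⟩ := hy
        exact ⟨p, hp, hy⟩
      · exact ⟨_, _, ⟨p0, hp0, rfl⟩, rfl⟩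
      · rintro _ ⟨a, ha, rfl⟩ _ ⟨b, hb, rfl⟩
        obtain ⟨d, hd, h1, h2⟩ := hdir a ha b hb
        exact ⟨_, ⟨d, hd, rfl⟩, h1.1, h2.1⟩
    refine ⟨(⋃₀ (Prod.fst '' c), LinearPMap.sSup _ hdir), ⟨?_, ?_, ?_⟩, ?_⟩
    · refine isLowerSet_sUnion ?_
      rintro _ ⟨p, hp, rfl⟩; exact (hcS hp).1
    · refine le_antisymm (fun y hy => ?_) (fun y hy => ?_)
      · obtain ⟨p, hp, hyp⟩ := hmem y hy
        rw [(hcS hp).2.1] at hyp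
        exact hmono _ _ (Set.subset_sUnion_of_mem (Set.mem_image_of_mem Prod.fst hp)) hyp
      · obtain ⟨_, ⟨p, hp, rfl⟩, hyp⟩ := hcont (Prod.fst '' c) (by
          rintro _ ⟨p, hp, rfl⟩ _ ⟨q, hq, rfl⟩ -
          rcases hc.total hp hq with h | h
          exacts [Or.inl h.1, Or.inr h.1]) ⟨_, p0, hp0, rfl⟩ y hy
        rw [← (hcS hp).2.1] at hyp
        exact hdom p hp hyp
    · intro y hy
      obtain ⟨p, hp, hyp⟩ := hmem y y.2
      have := LinearPMap.sSup_apply hdir (l := p.2) ⟨p, hp, rfl⟩ ⟨y, hyp⟩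
      have h2 := (hcS hp).2.2 ⟨y, hyp⟩ hy
      rw [← h2, ← this]
    · intro p hp
      exact ⟨Set.subset_sUnion_of_mem (Set.mem_image_of_mem Prod.fst hp), LinearPMap.le_sSup hdir (Set.mem_image_of_mem Prod.snd hp)⟩)
    _ hbase
  obtain ⟨⟨s, ⟨D, ψ⟩⟩, ⟨hs, hD, hψ⟩, hmax⟩ : ∃ m, Maximal (· ∈ S) m := ⟨m, hm⟩
  obtain rfl : D = Ls s := hD
  have key : s = Set.univ := by
    by_contra hne
    have hne' : (sᶜ).Nonempty := Set.nonempty_compl.2 hne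
    obtain ⟨x, hx, hxmin⟩ := WellFounded.has_min (wellFounded_lt (α := κ)) sᶜ hne'
    have hsx : s = Set.Iio x := by
      ext y
      constructor
      · intro hy
        by_contra hxy
        exact hx (hs (not_lt.1 hxy) hy)
      · intro hy
        by_contra hys
        exact hxmin y hys hy
    have hle : Ls (Set.Iio x) ≤ Ls (Set.Iic x) := hmono _ _ Set.Iio_subset_Iic_self
    subst hsx
    obtain ⟨ψ', h1, h2⟩ := exists_extend_lift (Submodule.inclusion_injective hle)
      (subQuotMap_exact hle) subQuotMap_surjective hi hig hg hE (hstep x) ψ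
      (φ ∘ₗ Submodule.inclusion (hmono _ _ (Set.subset_univ _))) (fun y => hψ y _)
    have hmem : ((Set.Iic x : Set κ), (⟨Ls (Set.Iic x), ψ'⟩ : G →ₗ.[R] E)) ∈ S :=
      ⟨isLowerSet_Iic x, rfl, fun y hy => h2 y⟩
    have := hmax hmem ⟨Set.Iio_subset_Iic_self, hle, fun a b hab => by
      have : b = Submodule.inclusion hle a := Subtype.ext hab.symm
      subst this
      exact (h1 a).symm⟩
    exact lt_irrefl x (this.1 (le_refl x))
  subst key
  exact ⟨ψ, LinearMap.ext fun y => hψ y y.2⟩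

/-- A continuous well-ordered filtration with all pieces of projective dimension at most `n`. -/
theorem pd_filtration {κ : Type*} [LinearOrder κ] [WellFoundedLT κ] (n : ℕ)
    {G : Type u} [AddCommGroup G] [Module R G] (Ls : Set κ → Submodule R G)
    (hmono : ∀ s t, s ⊆ t → Ls s ≤ Ls t)
    (hcont : ∀ c : Set (Set κ), IsChain (· ⊆ ·) c → c.Nonempty →
      ∀ x ∈ Ls (⋃₀ c), ∃ s ∈ c, x ∈ Ls s)
    (h0 : PD R n (Ls ∅))
    (hstep : ∀ x, PD R n (subQuot (Ls (Set.Iio x)) (Ls (Set.Iic x)))) :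
    PD R n (Ls Set.univ) := by
  refine pd_of_extZ fun Y _ _ => ?_
  obtain ⟨Y', hY'⟩ := exists_shift_extZ_one (R := R) n Y
  refine (hY' _).2 (extZ_one_filtration Ls hmono hcont ((hY' _).1 (h0.extZ n.lt_succ_self))
    fun x => (hY' _).1 ((hstep x).extZ n.lt_succ_self))

end Filtration

open Coalgebra HopfAlgebra

noncomputable section Sweedler

variable {k : Type u} [Field k] {B : Type u} [Ring B] [HopfAlgebra k B]
variable {W W' : Type*} [AddCommMonoid W] [AddCommMonoid W']

/-- Sweedler summation `∑ f a₁ a₂`. -/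
def sw (k : Type u) [Field k] {B : Type u} [Ring B] [HopfAlgebra k B] {W : Type*}
    [AddCommMonoid W] (f : B → B → W) (a : B) : W :=
  ∑ i ∈ (ℛ k a).index, f ((ℛ k a).left i) ((ℛ k a).right i)

theorem sw_congr {f g : B → B → W} (a : B) (h : ∀ x y, f x y = g x y) : sw k f a = sw k g a :=
  Finset.sum_congr rfl fun _ _ => h _ _

theorem map_sw {F : Type*} [FunLike F W W'] [AddMonoidHomClass F W W'] (φ : F)
    (f : B → B → W) (a : B) : φ (sw k f a) = sw k (fun x y => φ (f x y)) a :=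
  map_sum φ _ _

theorem smul_sw {T : Type*} [Monoid T] [DistribMulAction T W] (c : T) (f : B → B → W) (a : B) :
    c • sw k f a = sw k (fun x y => c • f x y) a :=
  Finset.smul_sum

variable [Module k W]

theorem sw_bilin (β : B →ₗ[k] B →ₗ[k] W) (a : B) :
    sw k (fun x y => β x y) a = lift β (comul a) := by
  conv_rhs => rw [← (ℛ k a).eq]
  simp [sw, map_sum]

theorem sw_coassoc (Φ : B →ₗ[k] B →ₗ[k] B →ₗ[k] W) (a : B) :
    sw k (fun x y => sw k (fun x₁ x₂ => Φ x₁ x₂ y) x) a =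
      sw k (fun x y => sw k (fun y₁ y₂ => Φ x y₁ y₂) y) a := by
  have h := sum_tmul_tmul_eq (ℛ k a) (fun i => ℛ k ((ℛ k a).left i))
    (fun i => ℛ k ((ℛ k a).right i))
  have h2 := congrArg (lift ((TensorProduct.uncurry (.id k) B B W) ∘ₗ Φ)) h
  simp only [map_sum, lift.tmul] at h2
  exact h2

theorem sw_counit_left (g : B →ₗ[k] W) (a : B) :
    sw k (fun x y => counit (R := k) x • g y) a = g a := by
  have := congrArg g (sum_counit_smul (ℛ k a))
  simpa [sw] using this

theorem sw_counit_right (g : B →ₗ[k] W) (a : B) :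
    sw k (fun x y => counit (R := k) y • g x) a = g a := by
  have h := sum_tmul_counit_eq (ℛ k a)
  have := congrArg (lift ((LinearMap.lsmul k W).flip ∘ₗ g)) h
  simp only [map_sum, lift.tmul] at this
  simpa only [sw, LinearMap.comp_apply, LinearMap.flip_apply, LinearMap.lsmul_apply, one_smul]
    using this

theorem sw_mul (β : B →ₗ[k] B →ₗ[k] W) (a b : B) :
    sw k (fun x y => β x y) (a * b) =
      sw k (fun a₁ a₂ => sw k (fun b₁ b₂ => β (a₁ * b₁) (a₂ * b₂)) b) a := by
  rw [sw_bilin, Bialgebra.comul_mul]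
  conv_lhs => rw [← (ℛ k a).eq, ← (ℛ k b).eq]
  simp [sw, Finset.sum_mul_sum, map_sum]

theorem sw_antipode_mul (a : B) :
    sw k (fun x y => antipode k x * y) a = counit (R := k) a • (1 : B) :=
  sum_antipode_mul_eq_smul _

theorem sw_mul_antipode (a : B) :
    sw k (fun x y => x * antipode k y) a = counit (R := k) a • (1 : B) :=
  sum_mul_antipode_eq_smul _

end Sweedler

noncomputable section Diagonal

variable {k : Type u} [Field k] {B : Type u} [Ring B] [HopfAlgebra k B]

/-- `M ⊗ N` carrying the diagonal action. -/
def Diag (k : Type u) [Field k] (M N : Type u) [AddCommGroup M] [Module k M]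
    [AddCommGroup N] [Module k N] : Type u := M ⊗[k] N

variable {M N : Type u} [AddCommGroup M] [Module k M] [AddCommGroup N] [Module k N]

instance : AddCommGroup (Diag k M N) := inferInstanceAs (AddCommGroup (M ⊗[k] N))

instance Diag.moduleHopf [Module B M] [IsScalarTower k B M] [Module B N] [IsScalarTower k B N] :
    Module B (Diag k M N) := tensorModule k B M N

instance Diag.moduleBase : Module k (Diag k M N) := inferInstanceAs (Module k (M ⊗[k] N))

/-- Pure tensors in `Diag k M N`. -/
def dmk (k : Type u) [Field k] {M N : Type u} [AddCommGroup M] [Module k M]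
    [AddCommGroup N] [Module k N] : M →ₗ[k] N →ₗ[k] Diag k M N :=
  TensorProduct.mk k M N

theorem Diag.induction {p : Diag k M N → Prop} (x : Diag k M N)
    (h : ∀ m n, p (dmk k m n)) (h2 : ∀ x y, p x → p y → p (x + y)) : p x := by
  induction x using TensorProduct.induction_on with
  | zero => have := h 0 0; rwa [map_zero] at this
  | tmul m n => exact h m n
  | add x y hx hy => exact h2 x y hx hy

/-- The linear map on `Diag k M N` attached to a bilinear map. -/
def Diag.lift {W : Type*} [AddCommGroup W] [Module k W] (β : M →ₗ[k] N →ₗ[k] W) :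
    Diag k M N →ₗ[k] W := TensorProduct.lift β

@[simp] theorem Diag.lift_dmk {W : Type*} [AddCommGroup W] [Module k W]
    (β : M →ₗ[k] N →ₗ[k] W) (m : M) (n : N) : Diag.lift β (dmk k m n) = β m n := rfl

theorem Diag.ext {W : Type*} [AddCommGroup W] {f g : Diag k M N → W}
    (hf : ∀ x y, f (x + y) = f x + f y) (hg : ∀ x y, g (x + y) = g x + g y)
    (h : ∀ m n, f (dmk k m n) = g (dmk k m n)) (x : Diag k M N) : f x = g x :=
  Diag.induction (p := fun x => f x = g x) x h fun x y hx hy => by rw [hf, hg, hx, hy]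

variable [Module B M] [IsScalarTower k B M] [Module B N] [IsScalarTower k B N]

theorem smul_dmk (b : B) (m : M) (n : N) :
    b • dmk k m n = sw k (fun x y => dmk k (x • m) (y • n)) b := by
  change tensorRep k B M N b (m ⊗ₜ n) = _
  unfold tensorRep
  simp only [AlgHom.comp_apply, Bialgebra.comulAlgHom_apply]
  rw [← (ℛ k b).eq]
  simp only [map_sum, LinearMap.sum_apply]
  rfl

instance : IsScalarTower k B (Diag k M N) where
  smul_assoc c b x := by
    refine Diag.ext (f := fun x => (c • b) • x) (g := fun x => c • b • x) (fun _ _ => smul_add _ _ _)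
      (fun _ _ => by simp only [smul_add]) (fun m n => ?_) x
    change tensorRep k B M N (c • b) (m ⊗ₜ n) = c • tensorRep k B M N b (m ⊗ₜ n)
    rw [map_smul]; rfl

/-- The `B`-linear map on `Diag k M N` attached to a balanced bilinear map. -/
def Diag.liftH {W : Type u} [AddCommGroup W] [Module k W] [Module B W] (β : M →ₗ[k] N →ₗ[k] W)
    (h : ∀ (b : B) m n, sw k (fun x y => β (x • m) (y • n)) b = b • β m n) :
    Diag k M N →ₗ[B] W where
  toFun := Diag.lift β
  map_add' := map_add _
  map_smul' b x := by
    refine Diag.ext (f := fun x => Diag.lift β (b • x)) (g := fun x => b • Diag.lift β x)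
      (fun _ _ => by rw [smul_add, map_add]) (fun _ _ => by rw [map_add, smul_add])
      (fun m n => ?_) x
    rw [smul_dmk, map_sw, Diag.lift_dmk, ← h]
    rfl

@[simp] theorem Diag.liftH_dmk {W : Type u} [AddCommGroup W] [Module k W] [Module B W]
    (β : M →ₗ[k] N →ₗ[k] W)
    (h : ∀ (b : B) m n, sw k (fun x y => β (x • m) (y • n)) b = b • β m n) (m : M) (n : N) :
    Diag.liftH β h (dmk k m n) = β m n := rfl

/-- Functoriality of the diagonal tensor product. -/
def Diag.map {M' N' : Type u} [AddCommGroup M'] [Module k M'] [AddCommGroup N'] [Module k N']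
    [Module B M'] [IsScalarTower k B M'] [Module B N'] [IsScalarTower k B N']
    (f : M →ₗ[B] M') (g : N →ₗ[B] N') : Diag k M N →ₗ[B] Diag k M' N' :=
  Diag.liftH ((dmk k).compl₁₂ (f.restrictScalars k) (g.restrictScalars k)) fun b m n => by
    simp [smul_dmk]

@[simp] theorem Diag.map_dmk {M' N' : Type u} [AddCommGroup M'] [Module k M'] [AddCommGroup N']
    [Module k N'] [Module B M'] [IsScalarTower k B M'] [Module B N'] [IsScalarTower k B N']
    (f : M →ₗ[B] M') (g : N →ₗ[B] N') (m : M) (n : N) :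
    Diag.map f g (dmk k m n) = dmk k (f m) (g n) := rfl

theorem Diag.map_surjective {M' N' : Type u} [AddCommGroup M'] [Module k M'] [AddCommGroup N']
    [Module k N'] [Module B M'] [IsScalarTower k B M'] [Module B N'] [IsScalarTower k B N']
    {f : M →ₗ[B] M'} {g : N →ₗ[B] N'} (hf : Function.Surjective f) (hg : Function.Surjective g) :
    Function.Surjective (Diag.map (k := k) f g) :=
  TensorProduct.map_surjective (g := f.restrictScalars k) (g' := g.restrictScalars k) hf hg

theorem Diag.map_injective {M' N' : Type u} [AddCommGroup M'] [Module k M'] [AddCommGroup N']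
    [Module k N'] [Module B M'] [IsScalarTower k B M'] [Module B N'] [IsScalarTower k B N']
    {f : M →ₗ[B] M'} {g : N →ₗ[B] N'} (hf : Function.Injective f) (hg : Function.Injective g) :
    Function.Injective (Diag.map (k := k) f g) :=
  TensorProduct.map_injective_of_flat_flat (f.restrictScalars k) (g.restrictScalars k) hf hg

theorem Diag.map_exact_left {M' M'' : Type u} [AddCommGroup M'] [Module k M'] [AddCommGroup M'']
    [Module k M''] [Module B M'] [IsScalarTower k B M'] [Module B M''] [IsScalarTower k B M'']
    {f : M →ₗ[B] M'} {g : M' →ₗ[B] M''} (h : Function.Exact f g) (hg : Function.Surjective g) :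
    Function.Exact (Diag.map (k := k) f (.id : N →ₗ[B] N)) (Diag.map g .id) :=
  rTensor_exact N (f := f.restrictScalars k) (g := g.restrictScalars k) h hg

theorem Diag.map_exact_right {N' N'' : Type u} [AddCommGroup N'] [Module k N'] [AddCommGroup N'']
    [Module k N''] [Module B N'] [IsScalarTower k B N'] [Module B N''] [IsScalarTower k B N'']
    {f : N →ₗ[B] N'} {g : N' →ₗ[B] N''} (h : Function.Exact f g) (hg : Function.Surjective g) :
    Function.Exact (Diag.map (k := k) (.id : M →ₗ[B] M) f) (Diag.map .id g) :=
  lTensor_exact M (f := f.restrictScalars k) (g := g.restrictScalars k) h hg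

end Diagonal

noncomputable section FreeLift

variable {k : Type u} [Field k] {B : Type u} [Ring B] [Algebra k B]
variable {V Z : Type u} [AddCommGroup V] [Module k V] [AddCommGroup Z] [Module k Z] [Module B Z]
  [IsScalarTower k B Z]

/-- The universal property of the free module `B ⊗ V`. -/
def freeLift (f : V →ₗ[k] Z) : B ⊗[k] V →ₗ[B] Z :=
  AlgebraTensorModule.lift
    { toFun := fun b => (LinearMap.toSpanSingleton B (V →ₗ[k] Z) f b)
      map_add' := fun _ _ => map_add _ _ _
      map_smul' := fun _ _ => map_smul _ _ _ }

@[simp] theorem freeLift_tmul (f : V →ₗ[k] Z) (b : B) (v : V) :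
    freeLift f (b ⊗ₜ v) = b • f v := rfl

theorem free_tensor : Module.Free B (B ⊗[k] V) :=
  Module.Free.of_basis (Algebra.TensorProduct.basis B (Module.Basis.ofVectorSpace k V))

theorem exists_section_tensor (h : Module.Projective B Z) :
    ∃ s : Z →ₗ[B] B ⊗[k] Z, ∀ z, freeLift (B := B) (LinearMap.id (R := k) (M := Z)) (s z) = z := by
  obtain ⟨s, hs⟩ := Module.projective_lifting_property
    (freeLift (B := B) (LinearMap.id (R := k) (M := Z))) (LinearMap.id (R := B) (M := Z))
    (fun z => ⟨1 ⊗ₜ z, by simp⟩)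
  exact ⟨s, fun z => LinearMap.congr_fun hs z⟩

end FreeLift

noncomputable section DiagPD

variable {k : Type u} [Field k] {B : Type u} [Ring B] [HopfAlgebra k B]
variable {V I : Type u} [AddCommGroup V] [Module k V] [AddCommGroup I] [Module k I] [Module B I]
  [IsScalarTower k B I]

/-- The map `B ⊗ (V ⊗ I) → (B ⊗ V) ⊗ I` extending `v ⊗ x ↦ (1 ⊗ v) ⊗ x`. -/
def twist : B ⊗[k] (V ⊗[k] I) →ₗ[B] Diag k (B ⊗[k] V) I :=
  freeLift (TensorProduct.lift ((dmk k (M := B ⊗[k] V) (N := I)) ∘ₗ TensorProduct.mk k B V 1))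

theorem twist_tmul (b : B) (v : V) (x : I) :
    twist (b ⊗ₜ[k] (v ⊗ₜ[k] x)) = b • dmk k ((1 : B) ⊗ₜ[k] v) x := rfl

/-- The trilinear form of the untwisting map. -/
def untwistAux (v : V) : B →ₗ[k] B →ₗ[k] I →ₗ[k] B ⊗[k] (V ⊗[k] I) :=
  LinearMap.mk₂ k (fun a b => (TensorProduct.mk k B (V ⊗[k] I) a) ∘ₗ (TensorProduct.mk k V I v) ∘ₗ
      (Algebra.lsmul k k I (antipode k b)))
    (fun _ _ _ => by ext; simp) (fun _ _ _ => by ext; simp [smul_tmul'])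
    (fun _ _ _ => by ext; simp [tmul_add]) (fun _ _ _ => by ext; simp)

@[simp] theorem untwistAux_apply (v : V) (a b : B) (x : I) :
    untwistAux v a b x = a ⊗ₜ[k] (v ⊗ₜ[k] (antipode k b • x)) := rfl

/-- The inverse of `twist`. -/
def untwist : Diag k (B ⊗[k] V) I →ₗ[k] B ⊗[k] (V ⊗[k] I) :=
  Diag.lift (TensorProduct.lift (LinearMap.mk₂ k
    (fun (b : B) (v : V) => TensorProduct.lift (untwistAux v) (comul b))
    (fun _ _ _ => by simp) (fun _ _ _ => by simp)
    (fun b v v' => by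
      rw [← sw_bilin, ← sw_bilin, ← sw_bilin]
      ext x; simp [sw, add_tmul, tmul_add, Finset.sum_add_distrib])
    (fun c b v => by
      rw [← sw_bilin, ← sw_bilin]
      ext x; simp [sw, Finset.smul_sum, ← smul_tmul'])))

theorem untwist_dmk (b : B) (v : V) (x : I) :
    untwist (dmk k (b ⊗ₜ[k] v) x) =
      sw k (fun a a' => a ⊗ₜ[k] (v ⊗ₜ[k] (antipode k a' • x))) b := by
  change (TensorProduct.lift (untwistAux v) (comul b)) x = _
  rw [← sw_bilin]
  simp [sw]

theorem smul_sw_eq {Z : Type*} [AddCommGroup Z] [Module B Z] (f : B → B → B) (b : B) (z : Z) :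
    sw k f b • z = sw k (fun x y => f x y • z) b := by
  simp [sw, Finset.sum_smul]

theorem twist_untwist (x : Diag k (B ⊗[k] V) I) : twist (untwist x) = x := by
  refine Diag.ext (f := fun x => twist (untwist x)) (g := id) (fun _ _ => by simp)
    (fun _ _ => rfl) (fun m x => ?_) x
  induction m using TensorProduct.induction_on with
  | zero => simp
  | add m m' h h' => simp only [map_add, LinearMap.add_apply, h, h', id]
  | tmul b v =>
    rw [untwist_dmk, map_sw]
    simp only [twist_tmul, smul_dmk, smul_tmul', smul_eq_mul, mul_one]
    have := sw_coassoc (LinearMap.mk₂ k (fun a b => (dmk k (a ⊗ₜ[k] v) : I →ₗ[k] _) ∘ₗ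
        (Algebra.lsmul k k I).toLinearMap.flip x ∘ₗ (LinearMap.mul k B b) ∘ₗ antipode k)
      (fun _ _ _ => by ext; simp [add_tmul]) (fun _ _ _ => by ext; simp [← smul_tmul'])
      (fun _ _ _ => by ext; simp) (fun _ _ _ => by ext; simp)) b
    simp only [LinearMap.mk₂_apply, LinearMap.comp_apply, LinearMap.flip_apply,
      LinearMap.mul_apply', AlgHom.toLinearMap_apply, Algebra.lsmul_coe] at this
    simp only [← smul_assoc, smul_eq_mul]
    rw [this]
    have e : ∀ a a' : B, sw k (fun y₁ y₂ => dmk k (a ⊗ₜ[k] v) ((y₁ * antipode k y₂) • x)) a' =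
        counit (R := k) a' • ((dmk k).flip x ∘ₗ (TensorProduct.mk k B V).flip v) a := by
      intro a a'
      rw [← map_sw (dmk k (a ⊗ₜ[k] v)), ← smul_sw_eq, sw_mul_antipode]
      simp
    simp only [e]
    rw [sw_counit_right]
    rfl

theorem untwist_twist (x : B ⊗[k] (V ⊗[k] I)) : untwist (twist x) = x := by
  induction x using TensorProduct.induction_on with
  | zero => simp
  | add m m' h h' => simp only [map_add, h, h']
  | tmul b w =>
    induction w using TensorProduct.induction_on with
    | zero => simp
    | add m m' h h' => simp only [tmul_add, map_add, h, h']
    | tmul v x =>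
      rw [twist_tmul, smul_dmk, map_sw]
      simp only [smul_tmul', smul_eq_mul, mul_one, untwist_dmk, ← smul_assoc]
      have := sw_coassoc (LinearMap.mk₂ k (fun a b => (TensorProduct.mk k B (V ⊗[k] I) a) ∘ₗ
          (TensorProduct.mk k V I v) ∘ₗ
          (Algebra.lsmul k k I).toLinearMap.flip x ∘ₗ (LinearMap.mul k B (antipode k b)))
        (fun _ _ _ => by ext; simp) (fun _ _ _ => by ext; simp [smul_tmul'])
        (fun _ _ _ => by ext; simp [tmul_add]) (fun _ _ _ => by ext; simp)) b
      simp only [LinearMap.mk₂_apply, LinearMap.comp_apply, LinearMap.flip_apply,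
        LinearMap.mul_apply', AlgHom.toLinearMap_apply, Algebra.lsmul_coe] at this
      refine Eq.trans this ?_
      have e : ∀ a a' : B, sw k (fun y₁ y₂ => (TensorProduct.mk k B (V ⊗[k] I) a)
          ((TensorProduct.mk k V I v) ((antipode k y₁ * y₂) • x))) a' =
          counit (R := k) a' • ((TensorProduct.mk k B (V ⊗[k] I)).flip (v ⊗ₜ x)) a := by
        intro a a'
        rw [← map_sw (TensorProduct.mk k B (V ⊗[k] I) a), ← map_sw (TensorProduct.mk k V I v),
          ← smul_sw_eq, sw_antipode_mul]
        simp
      simp only [e]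
      rw [sw_counit_right]
      rfl

/-- `(B ⊗ V) ⊗ I` with the diagonal action is free. -/
def twistEquiv : B ⊗[k] (V ⊗[k] I) ≃ₗ[B] Diag k (B ⊗[k] V) I :=
  { twist with
    invFun := untwist
    left_inv := untwist_twist
    right_inv := twist_untwist }

variable {Λ : Type u} [AddCommGroup Λ] [Module k Λ] [Module B Λ] [IsScalarTower k B Λ]

theorem diag_projective (h : Module.Projective B Λ) : Module.Projective B (Diag k Λ I) := by
  obtain ⟨s, hs⟩ := exists_section_tensor (k := k) h
  have h1 : Module.Free B (B ⊗[k] (Λ ⊗[k] I)) := free_tensor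
  have h2 : Module.Projective B (Diag k (B ⊗[k] Λ) I) := Module.Projective.of_equiv twistEquiv
  refine Module.Projective.of_split (Diag.map s .id)
    (Diag.map (freeLift (B := B) (LinearMap.id (R := k) (M := Λ))) .id) (LinearMap.ext fun x => ?_)
  refine Diag.ext (f := fun x => (Diag.map (freeLift (B := B) (LinearMap.id (R := k) (M := Λ))) .id)
    (Diag.map s .id x)) (g := id) (fun _ _ => by simp) (fun _ _ => rfl) (fun m x => ?_) x
  simp [hs]

theorem PD.diag (n : ℕ) : ∀ {Λ : Type u} [AddCommGroup Λ] [Module k Λ] [Module B Λ]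
    [IsScalarTower k B Λ], PD B n Λ → PD B n (Diag k Λ I) := by
  induction n with
  | zero =>
    intro Λ _ _ _ _ h
    exact pd_zero_iff.2 (diag_projective (pd_zero_iff.1 h))
  | succ n ih =>
    intro Λ _ _ _ _ h
    obtain ⟨f, hf⟩ := exists_free_cover B Λ
    have hK : PD B n (LinearMap.ker f) := PD.sub (LinearMap.ker f).injective_subtype
      f.exact_subtype_ker_map hf (.of_projective inferInstance _) h
    exact PD.quot (Diag.map_injective (LinearMap.ker f).injective_subtype Function.injective_id)
      (Diag.map_exact_left f.exact_subtype_ker_map hf)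
      (Diag.map_surjective hf Function.surjective_id) (ih hK)
      (.of_projective (diag_projective inferInstance) _)

end DiagPD

noncomputable section Ret

variable {k : Type u} [Field k] {H : Type u} [Ring H] [HopfAlgebra k H]

theorem exists_trivial_injective (k : Type u) [Field k] (H : Type u) [Ring H] [HopfAlgebra k H] :
    ∃ (J : Type u) (_ : AddCommGroup J) (_ : Module k J) (_ : Module H J)
      (_ : IsScalarTower k H J) (lam : J), Module.Injective H J ∧ lam ≠ 0 ∧
      ∀ h : H, h • lam = counit (R := k) h • lam := by
  letI := trivModule k H
  obtain ⟨E, f, hE, hf⟩ := exists_embed_injective H k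
  letI : Module k E := Module.compHom E (algebraMap k H)
  have e : ∀ (h : H) (c : k), h • c = counit (R := k) h * c := fun _ _ => rfl
  refine ⟨E, inferInstance, inferInstance, inferInstance,
    IsScalarTower.of_algebraMap_smul fun r x => rfl, f 1, hE, ?_, fun h => ?_⟩
  · exact fun h => one_ne_zero (hf (h.trans (map_zero f).symm))
  · change h • f 1 = algebraMap k H (counit (R := k) h) • f 1
    rw [← map_smul, ← map_smul, e, e]
    simp

variable {J : Type u} [AddCommGroup J] [Module k J] [Module H J] [IsScalarTower k H J]
variable (lam : J) (hlam : ∀ h : H, h • lam = counit (R := k) h • lam)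
variable {Z : Type u} [AddCommGroup Z] [Module k Z] [Module H Z] [IsScalarTower k H Z]

/-- The `H`-linear map `z ↦ lam ⊗ z` for an invariant element `lam`. -/
def lamMap (Z : Type u) [AddCommGroup Z] [Module k Z] [Module H Z] [IsScalarTower k H Z] :
    Z →ₗ[H] Diag k J Z where
  toFun z := dmk k lam z
  map_add' := map_add _
  map_smul' b z := by
    rw [RingHom.id_apply, smul_dmk]
    simp only [hlam, map_smul, LinearMap.smul_apply]
    exact (sw_counit_left (dmk k lam ∘ₗ (Algebra.lsmul k k Z).toLinearMap.flip z) b).symm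

@[simp] theorem lamMap_apply (z : Z) : lamMap lam hlam Z z = dmk k lam z := rfl

theorem lamMap_injective (h0 : lam ≠ 0) : Function.Injective (lamMap lam hlam Z) := by
  obtain ⟨φ, hφ⟩ := Module.Projective.exists_dual_ne_zero k h0
  intro a b hab
  have := congrArg (Diag.lift ((LinearMap.lsmul k Z) ∘ₗ φ)) hab
  simpa [hφ] using this

/-- `z ↦ lam ⊗ z` has an `H`-linear retraction. -/
def Ret (Z : Type u) [AddCommGroup Z] [Module k Z] [Module H Z] [IsScalarTower k H Z] : Prop :=
  ∃ s : Diag k J Z →ₗ[H] Z, ∀ z, s (dmk k lam z) = z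

include hlam in
theorem Ret.cosyzygy (h0 : lam ≠ 0) {E C : Type u} [AddCommGroup E] [Module k E] [Module H E]
    [IsScalarTower k H E] [AddCommGroup C] [Module k C] [Module H C] [IsScalarTower k H C]
    {f : Z →ₗ[H] E} {g : E →ₗ[H] C} (hf : Function.Injective f) (hfg : Function.Exact f g)
    (hg : Function.Surjective g) (hE : Module.Injective H E) (h : Ret (k := k) (H := H) lam Z) :
    Ret (k := k) (H := H) lam C := by
  obtain ⟨s, hs⟩ := h
  let Jf : Diag k J Z →ₗ[H] Diag k J E := Diag.map .id f
  let Jg : Diag k J E →ₗ[H] Diag k J C := Diag.map .id g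
  have hJf : Function.Injective Jf := Diag.map_injective Function.injective_id hf
  have hex : Function.Exact Jf Jg := Diag.map_exact_right hfg hg
  have hJg : Function.Surjective Jg := Diag.map_surjective Function.surjective_id hg
  let a : Diag k J Z × E →ₗ[H] Diag k J E := Jf.coprod (lamMap lam hlam E)
  let b : Diag k J Z × E →ₗ[H] E := (f ∘ₗ s).coprod .id
  have hab : ∀ x, a x = 0 → b x = 0 := by
    rintro ⟨w, e⟩ hx
    have hx : Jf w + dmk k lam e = 0 := hx
    have h1 : dmk k lam (g e) = 0 := by
      have := congrArg Jg hx
      rw [map_add, hex.apply_apply_eq_zero, zero_add, map_zero] at this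
      exact this
    have h2 : g e = 0 := lamMap_injective lam hlam h0 (by simpa using h1)
    obtain ⟨z, rfl⟩ := (hfg e).1 h2
    have h3 : w + dmk k lam z = 0 := hJf (by rw [map_add, map_zero]; exact hx)
    have h4 := congrArg (fun v => f (s v)) h3
    simp only [map_add, hs, map_zero] at h4
    exact h4
  obtain ⟨t, ht⟩ : ∃ t : Diag k J E →ₗ[H] E, ∀ x, t (a x) = b x := by
    obtain ⟨t', ht'⟩ := exists_factor (f := a.rangeRestrict) a.surjective_rangeRestrict b
      (fun x hx => hab x (congrArg Subtype.val hx))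
    obtain ⟨t, ht⟩ := hE.out (LinearMap.range a).subtype (LinearMap.range a).injective_subtype t'
    exact ⟨t, fun x => (ht (a.rangeRestrict x)).trans (ht' x)⟩
  obtain ⟨s', hs'⟩ := exists_factor hJg (g ∘ₗ t) (fun x hx => by
    obtain ⟨w, rfl⟩ := (hex x).1 hx
    have := ht (w, 0)
    simp only [a, b, LinearMap.coprod_apply, map_zero, add_zero] at this
    rw [LinearMap.comp_apply, this]
    exact hfg.apply_apply_eq_zero _)
  refine ⟨s', fun z => ?_⟩
  obtain ⟨e, rfl⟩ := hg z
  have := ht (0, e)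
  simp only [a, b, LinearMap.coprod_apply, map_zero, zero_add, lamMap_apply] at this
  have h5 := hs' (dmk k lam e)
  rw [LinearMap.comp_apply, this] at h5
  exact h5

include hlam in
theorem Ret.injDim (h0 : lam ≠ 0) (n : ℕ) : ∀ (Z : Type u) [AddCommGroup Z] [Module k Z]
    [Module H Z] [IsScalarTower k H Z], Ret (k := k) (H := H) lam Z →
    (∀ (X : Type u) [AddCommGroup X] [Module k X] [Module H X] [IsScalarTower k H X],
      ExtZ H (n + 1) (Diag k J X) Z) → ID H n Z := by
  induction n with
  | zero =>
    intro Z _ _ _ _ ⟨s, hs⟩ hZ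
    refine id_zero_iff.2 ⟨fun X Y _ _ _ _ f hf g => ?_⟩
    letI : Module k X := Module.compHom X (algebraMap k H)
    haveI : IsScalarTower k H X := IsScalarTower.of_algebraMap_smul fun r x => rfl
    letI : Module k Y := Module.compHom Y (algebraMap k H)
    haveI : IsScalarTower k H Y := IsScalarTower.of_algebraMap_smul fun r x => rfl
    let Q := Y ⧸ LinearMap.range f
    letI : Module k Q := Module.compHom Q (algebraMap k H)
    haveI : IsScalarTower k H Q := IsScalarTower.of_algebraMap_smul fun r x => rfl
    obtain ⟨ψ, hψ⟩ := ExtZ.extend (f := Diag.map (k := k) (.id : J →ₗ[H] J) f)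
      (g := Diag.map (k := k) (.id : J →ₗ[H] J) (LinearMap.range f).mkQ)
      (Diag.map_injective Function.injective_id hf)
      (Diag.map_exact_right exact_mkQ_range (Submodule.mkQ_surjective _))
      (Diag.map_surjective Function.surjective_id (Submodule.mkQ_surjective _)) (hZ Q)
      (s ∘ₗ Diag.map .id g)
    refine ⟨ψ ∘ₗ lamMap lam hlam Y, fun x => ?_⟩
    have := LinearMap.congr_fun hψ (dmk k lam x)
    simpa [hs] using this
  | succ n ih =>
    intro Z _ _ _ _ hs hZ
    obtain ⟨E, f, hE, hf⟩ := exists_embed_injective H Z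
    letI : Module k E := Module.compHom E (algebraMap k H)
    haveI : IsScalarTower k H E := IsScalarTower.of_algebraMap_smul fun r x => rfl
    let Q := E ⧸ LinearMap.range f
    letI : Module k Q := Module.compHom Q (algebraMap k H)
    haveI : IsScalarTower k H Q := IsScalarTower.of_algebraMap_smul fun r x => rfl
    have hg := Submodule.mkQ_surjective (LinearMap.range f)
    have hQ : ID H n Q := ih Q (hs.cosyzygy lam hlam h0 hf exact_mkQ_range hg hE)
      fun X _ _ _ _ => (extZ_shift hf exact_mkQ_range hg hE n).1 (hZ X)
    exact ID.sub hf exact_mkQ_range hg hQ (.of_injective hE _)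

theorem Ret.of_retract {W : Type u} [AddCommGroup W] [Module k W] [Module H W]
    [IsScalarTower k H W] (i : Z →ₗ[H] W) (r : W →ₗ[H] Z) (h : ∀ x, r (i x) = x)
    (hW : Ret (k := k) (H := H) lam W) : Ret (k := k) (H := H) lam Z := by
  obtain ⟨s, hs⟩ := hW
  exact ⟨r ∘ₗ s ∘ₗ Diag.map .id i, fun z => by simp [hs, h]⟩

/-- The bilinear map `(j, h) ↦ ∑ φ(T h₁ • j) h₂`. -/
def cotwist (T : H →ₗ[k] H) (φ : J →ₗ[k] k) : J →ₗ[k] H →ₗ[k] H :=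
  LinearMap.mk₂ k (fun j h => sw k (fun x y => φ (T x • j) • y) h)
    (fun _ _ _ => by simp [sw, add_smul, Finset.sum_add_distrib])
    (fun c _ _ => by simp [sw, smul_smul, Finset.smul_sum, smul_comm _ c])
    (fun j h h' => by
      have e := sw_bilin (LinearMap.mk₂ k (fun x y => φ (T x • j) • y)
        (fun _ _ _ => by simp [add_smul]) (fun _ _ _ => by simp [smul_smul])
        (fun _ _ _ => by simp) (fun c _ _ => by simp [smul_comm _ c]) : H →ₗ[k] H →ₗ[k] H)
      simp only [LinearMap.mk₂_apply] at e
      rw [e, e, e, map_add, map_add])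
    (fun c j h => by
      have e := sw_bilin (LinearMap.mk₂ k (fun x y => φ (T x • j) • y)
        (fun _ _ _ => by simp [add_smul]) (fun _ _ _ => by simp [smul_smul])
        (fun _ _ _ => by simp) (fun c _ _ => by simp [smul_comm _ c]) : H →ₗ[k] H →ₗ[k] H)
      simp only [LinearMap.mk₂_apply] at e
      rw [e, e, map_smul, map_smul])

theorem cotwist_apply (T : H →ₗ[k] H) (φ : J →ₗ[k] k) (j : J) (h : H) :
    cotwist T φ j h = sw k (fun x y => φ (T x • j) • y) h := rfl

section Inverse

variable (T : H →ₗ[k] H) (hT : ∀ h : H, T (antipode k h) = h) (hT' : ∀ h, antipode k (T h) = h)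
include hT hT'

theorem inv_antipode_mul (a b : H) : T (a * b) = T b * T a := by
  conv_lhs => rw [← hT' a, ← hT' b, ← antipode_mul_antidistrib, hT]

theorem inv_antipode_one : T 1 = 1 := by
  conv_lhs => rw [← antipode_one (R := k) (A := H), hT]

theorem inv_antipode_algebraMap (c : k) : T (c • 1) = c • 1 := by
  rw [map_smul, inv_antipode_one T hT hT']

theorem sw_inv_antipode_mul (a : H) : sw k (fun x y => T y * x) a = counit (R := k) a • (1 : H) := by
  rw [← hT (sw _ _ a), map_sw]
  simp only [antipode_mul_antidistrib, hT', sw_antipode_mul]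
  exact inv_antipode_algebraMap T hT hT' _

theorem cotwist_smul (φ : J →ₗ[k] k) (b h : H) (j : J) :
    sw k (fun x y => cotwist T φ (x • j) (y * h)) b = b * cotwist T φ j h := by
  let β : J → H →ₗ[k] H →ₗ[k] H := fun j => LinearMap.mk₂ k (fun x y => φ (T x • j) • y)
        (fun _ _ _ => by simp [add_smul]) (fun _ _ _ => by simp [smul_smul])
        (fun _ _ _ => by simp) (fun c _ _ => by simp [smul_comm _ c])
  let Γ : H →ₗ[k] H →ₗ[k] H := LinearMap.mk₂ k
    (fun u y => sw k (fun p q => φ (T p • u • j) • (y * q)) h)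
    (fun _ _ _ => by simp [sw, add_smul, Finset.sum_add_distrib])
    (fun c _ _ => by simp [sw, smul_smul, Finset.smul_sum, smul_comm _ c])
    (fun _ _ _ => by simp [sw, add_mul, Finset.sum_add_distrib])
    (fun c _ _ => by simp [sw, Finset.smul_sum, smul_comm _ c])
  let Φ : H →ₗ[k] H →ₗ[k] H →ₗ[k] H := LinearMap.mk₂ k (fun x₁ x₂ => Γ (T x₂ * x₁))
    (fun _ _ _ => by simp [mul_add]) (fun _ _ _ => by simp)
    (fun _ _ _ => by simp [add_mul]) (fun _ _ _ => by simp)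
  have h1 : ∀ x y, cotwist T φ (x • j) (y * h) = sw k (fun y₁ y₂ => Φ x y₁ y₂) y := by
    intro x y
    have := sw_mul (β (x • j)) y h
    simp only [β, LinearMap.mk₂_apply] at this
    rw [cotwist_apply, this]
    refine sw_congr _ fun y₁ y₂ => ?_
    simp only [Φ, Γ, LinearMap.mk₂_apply]
    refine sw_congr _ fun p q => ?_
    rw [inv_antipode_mul T hT hT', smul_smul, smul_smul, mul_assoc]
  simp only [h1]
  rw [← sw_coassoc]
  have h2 : ∀ x y, sw k (fun x₁ x₂ => Φ x₁ x₂ y) x = counit (R := k) x • Γ 1 y := by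
    intro x y
    have := map_sw (k := k) (Γ.flip y) (fun x₁ x₂ => T x₂ * x₁) x
    rw [sw_inv_antipode_mul T hT hT', map_smul] at this
    exact this.symm
  simp only [h2]
  rw [sw_counit_left]
  simp [Γ, cotwist_apply, sw, Finset.mul_sum]

include hlam in
theorem Ret.of_free (h0 : lam ≠ 0) (V : Type u) [AddCommGroup V] [Module k V] :
    Ret (k := k) (H := H) lam (H ⊗[k] V) := by
  obtain ⟨φ, hφ⟩ := Module.Projective.exists_dual_eq_one k h0
  refine ⟨Diag.liftH (LinearMap.rTensorHom V ∘ₗ cotwist T φ) fun b m n => ?_, fun z => ?_⟩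
  · induction n using TensorProduct.induction_on with
    | zero => simp [sw]
    | add x y hx hy =>
      rw [map_add, smul_add, ← hx, ← hy]
      simp [sw, Finset.sum_add_distrib]
    | tmul h v =>
      have := congrArg (fun x => x ⊗ₜ[k] v) (cotwist_smul T hT hT' φ b h m)
      have e := map_sw (k := k) ((TensorProduct.mk k H V).flip v)
        (fun x y => cotwist T φ (x • m) (y * h)) b
      exact e.symm.trans this
  · have : cotwist T φ lam = LinearMap.id := by
      ext h
      have hc : ∀ a : H, T a • lam = counit (R := k) a • lam := fun a => by
        rw [hlam, ← counit_antipode (R := k) (T a), hT']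
      simp only [cotwist_apply, hc, map_smul, hφ, smul_eq_mul, mul_one]
      exact sw_counit_left (LinearMap.id) h
    simp [this]

end Inverse

theorem exists_inv_antipode (hS : Function.Bijective (antipode k (A := H))) :
    ∃ T : H →ₗ[k] H, (∀ h, T (antipode k h) = h) ∧ ∀ h, antipode k (T h) = h := by
  let e := LinearEquiv.ofBijective (antipode k (A := H)) hS
  exact ⟨e.symm.toLinearMap, fun h => e.symm_apply_apply h, fun h => e.apply_symm_apply h⟩

theorem silp_le_of_spli_le (hS : Function.Bijective (antipode k (A := H))) (n : ℕ)
    (h : ∀ (M : Type u) [AddCommGroup M] [Module H M], Module.Injective H M → PD H n M)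
    (P : Type u) [AddCommGroup P] [Module H P] (hP : Module.Projective H P) : ID H n P := by
  obtain ⟨J, _, _, _, _, lam, hJ, h0, hlam⟩ := exists_trivial_injective k H
  obtain ⟨T, hT, hT'⟩ := exists_inv_antipode hS
  letI : Module k P := Module.compHom P (algebraMap k H)
  haveI : IsScalarTower k H P := IsScalarTower.of_algebraMap_smul fun r x => rfl
  obtain ⟨s, hs⟩ := exists_section_tensor (k := k) hP
  have hR : Ret (k := k) (H := H) lam P := .of_retract lam s _ hs (.of_free lam hlam T hT hT' h0 P)
  exact hR.injDim lam hlam h0 n P fun X _ _ _ _ => (PD.diag n (h J hJ)).extZ n.lt_succ_self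

end Ret

/-- The equational criterion of flatness for `H` as a right `B`-module via `ι`. -/
def EqFlatR {B H : Type u} [Ring B] [Ring H] (ι : B →+* H) : Prop :=
  ∀ (r q : ℕ) (a : Fin r → Fin q → B) (h : Fin r → H), (∀ y, ∑ s, h s * ι (a s y) = 0) →
    ∃ (t : ℕ) (b : Fin t → Fin r → B) (w : Fin t → H), (∀ s, h s = ∑ j, w j * ι (b j s)) ∧
      ∀ j y, ∑ s, b j s * a s y = 0

theorem EqFlatR.finset {B H : Type u} [Ring B] [Ring H] {ι : B →+* H} (hι : EqFlatR ι) {Y : Type*}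
    (F : Finset Y) {r : ℕ} (a : Fin r → Y → B) (h : Fin r → H)
    (hy : ∀ y ∈ F, ∑ s, h s * ι (a s y) = 0) :
    ∃ (t : ℕ) (b : Fin t → Fin r → B) (w : Fin t → H), (∀ s, h s = ∑ j, w j * ι (b j s)) ∧
      ∀ j, ∀ y ∈ F, ∑ s, b j s * a s y = 0 := by
  obtain ⟨t, b, w, h1, h2⟩ := hι r F.card (fun s i => a s (F.equivFin.symm i)) h
    fun i => hy _ (F.equivFin.symm i).2
  exact ⟨t, b, w, h1, fun j y hy => by simpa using h2 j (F.equivFin ⟨y, hy⟩)⟩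

noncomputable section Induction

variable {k : Type u} [Field k] {H : Type u} [Ring H] [Algebra k H] {B : Type u} [Ring B]
  [Algebra k B] (ι : B →ₐ[k] H)
variable (X : Type u) [AddCommGroup X] [Module k X] [Module B X] [IsScalarTower k B X]
variable {X' : Type u} [AddCommGroup X'] [Module k X'] [Module B X'] [IsScalarTower k B X']

/-- The relations defining the induced module. -/
def indRel : Submodule H (H ⊗[k] X) :=
  Submodule.span H {z | ∃ (a : B) (x : X), z = ι a ⊗ₜ[k] x - 1 ⊗ₜ[k] (a • x)}

/-- The induced module `H ⊗_B X`. -/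
abbrev Ind : Type u := (H ⊗[k] X) ⧸ indRel ι X

variable {X}

/-- The unit `X → Ind X`. -/
def indMk : X →ₗ[k] Ind ι X :=
  ((indRel ι X).mkQ.restrictScalars k) ∘ₗ TensorProduct.mk k H X 1

theorem indMk_smul (a : B) (x : X) : indMk ι (a • x) = ι a • indMk ι x := by
  symm
  change (indRel ι X).mkQ (ι a • ((1 : H) ⊗ₜ[k] x)) = (indRel ι X).mkQ ((1 : H) ⊗ₜ[k] (a • x))
  rw [← sub_eq_zero, ← map_sub, Submodule.mkQ_apply, Submodule.Quotient.mk_eq_zero]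
  exact Submodule.subset_span ⟨a, x, by rw [smul_tmul', smul_eq_mul, mul_one]⟩

theorem Ind.mk_tmul (h : H) (x : X) :
    (indRel ι X).mkQ (h ⊗ₜ[k] x) = h • indMk ι x := by
  change _ = (indRel ι X).mkQ (h • ((1 : H) ⊗ₜ[k] x))
  rw [smul_tmul', smul_eq_mul, mul_one]

theorem Ind.exists_sum (z : Ind ι X) : ∃ (r : ℕ) (h : Fin r → H) (x : Fin r → X),
    z = ∑ s, h s • indMk ι (x s) := by
  obtain ⟨z, rfl⟩ := Submodule.mkQ_surjective _ z
  obtain ⟨r, h, x, rfl⟩ := TensorProduct.exists_sum_tmul_eq z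
  exact ⟨r, h, x, by simp only [map_sum, Ind.mk_tmul]⟩

theorem Ind.hom_ext {Y : Type*} [AddCommGroup Y] [Module H Y] {f g : Ind ι X →ₗ[H] Y}
    (h : ∀ x, f (indMk ι x) = g (indMk ι x)) : f = g := by
  refine LinearMap.ext fun z => ?_
  obtain ⟨r, c, x, rfl⟩ := Ind.exists_sum ι z
  simp only [map_sum, map_smul, h]

theorem Ind.exists_lift {Y : Type u} [AddCommGroup Y] [Module H Y] (f : X → Y)
    (hadd : ∀ x y, f (x + y) = f x + f y) (hsmul : ∀ (a : B) x, f (a • x) = ι a • f x) :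
    ∃ F : Ind ι X →ₗ[H] Y, ∀ x, F (indMk ι x) = f x := by
  let _ : Module k Y := Module.compHom Y (algebraMap k H)
  have : IsScalarTower k H Y := IsScalarTower.of_algebraMap_smul fun r x => rfl
  let f' : X →ₗ[k] Y :=
    { toFun := f
      map_add' := hadd
      map_smul' := fun c x => by
        rw [RingHom.id_apply, ← algebraMap_smul B c x, hsmul, AlgHom.commutes, algebraMap_smul] }
  refine ⟨(indRel ι X).liftQ (freeLift f') (Submodule.span_le.2 ?_), fun x => ?_⟩
  · rintro _ ⟨a, x, rfl⟩
    change freeLift f' _ = 0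
    rw [map_sub, freeLift_tmul, freeLift_tmul, one_smul, sub_eq_zero]
    exact (hsmul a x).symm
  · change freeLift f' ((1 : H) ⊗ₜ[k] x) = _
    rw [freeLift_tmul, one_smul]
    rfl

theorem Ind.exists_map (g : X →ₗ[B] X') :
    ∃ F : Ind ι X →ₗ[H] Ind ι X', ∀ x, F (indMk ι x) = indMk ι (g x) :=
  Ind.exists_lift ι (fun x => indMk ι (g x)) (fun _ _ => by simp) fun a x => by
    rw [map_smul, indMk_smul]

theorem Ind.exists_toFree {Y : Type u} (j : X →ₗ[B] Y →₀ B) :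
    ∃ F : Ind ι X →ₗ[H] (Y →₀ H),
      ∀ x, F (indMk ι x) = (j x).mapRange ι (map_zero ι) :=
  Ind.exists_lift ι (fun x => (j x).mapRange ι (map_zero ι))
    (fun x y => by ext; simp) (fun a x => by ext; simp)

theorem Ind.toFree_injective (hι : EqFlatR (ι : B →+* H)) {Y : Type u} {j : X →ₗ[B] Y →₀ B}
    (hj : Function.Injective j) {F : Ind ι X →ₗ[H] (Y →₀ H)}
    (hF : ∀ x, F (indMk ι x) = (j x).mapRange ι (map_zero ι)) : Function.Injective F := by
  classical
  rw [injective_iff_map_eq_zero]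
  intro z hz
  obtain ⟨r, h, x, rfl⟩ := Ind.exists_sum ι z
  have hz' : ∀ y, ∑ s, h s * ι (j (x s) y) = 0 := fun y => by
    have := DFunLike.congr_fun hz y
    simpa [hF, Finsupp.finsetSum_apply] using this
  obtain ⟨t, b, w, h1, h2⟩ := hι.finset (Finset.univ.biUnion fun s => (j (x s)).support)
    (fun s y => j (x s) y) h (fun y _ => hz' y)
  have h3 : ∀ i, ∑ s, b i s • x s = 0 := fun i => by
    refine hj ?_
    ext y
    simp only [map_sum, map_smul, Finsupp.finsetSum_apply, map_zero, Finsupp.coe_zero,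
      Pi.zero_apply, Finsupp.smul_apply, smul_eq_mul]
    by_cases hy : y ∈ Finset.univ.biUnion fun s => (j (x s)).support
    · exact h2 i y hy
    · refine Finset.sum_eq_zero fun s _ => ?_
      have : j (x s) y = 0 := by
        by_contra h
        exact hy (Finset.mem_biUnion.2 ⟨s, Finset.mem_univ _, Finsupp.mem_support_iff.2 h⟩)
      rw [this, mul_zero]
  calc ∑ s, h s • indMk ι (x s) = ∑ s, ∑ i, w i • indMk ι (b i s • x s) := by
        refine Finset.sum_congr rfl fun s _ => ?_
        rw [h1, Finset.sum_smul]
        refine Finset.sum_congr rfl fun i _ => ?_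
        rw [indMk_smul, smul_smul]
        rfl
    _ = ∑ i, w i • indMk ι (∑ s, b i s • x s) := by
        rw [Finset.sum_comm]
        simp only [map_sum, Finset.smul_sum]
    _ = 0 := by simp [h3]

theorem Ind.projective (hX : Module.Projective B X) : Module.Projective H (Ind ι X) := by
  obtain ⟨s, hs⟩ := Module.projective_lifting_property
    (Finsupp.linearCombination B (id : X → X)) (LinearMap.id (R := B) (M := X))
    (Finsupp.linearCombination_id_surjective B X)
  obtain ⟨F, hF⟩ := Ind.exists_toFree ι s
  refine Module.Projective.of_split F (Finsupp.linearCombination H (indMk ι : X → Ind ι X))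
    (Ind.hom_ext ι fun x => ?_)
  have key : ∀ v : X →₀ B, Finsupp.linearCombination H (indMk ι : X → Ind ι X)
      (v.mapRange ι (map_zero ι)) = indMk ι (Finsupp.linearCombination B (id : X → X) v) := by
    intro v
    induction v using Finsupp.induction_linear with
    | zero => simp
    | add f g hf hg => rw [Finsupp.mapRange_add (map_add ι), map_add, map_add, map_add, hf, hg]
    | single a b => simp [indMk_smul]
  rw [LinearMap.comp_apply, hF, key, LinearMap.id_apply]
  exact congrArg _ (LinearMap.congr_fun hs x)

theorem Ind.pd (hι : EqFlatR (ι : B →+* H)) (m : ℕ) : ∀ (X : Type u) [AddCommGroup X] [Module k X]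
    [Module B X] [IsScalarTower k B X], PD B m X → PD H m (Ind ι X) := by
  induction m with
  | zero => exact fun X _ _ _ _ h => pd_zero_iff.2 (Ind.projective ι (pd_zero_iff.1 h))
  | succ m ih =>
    intro X _ _ _ _ hX
    obtain ⟨f, hf⟩ := exists_free_cover B X
    have hK : PD B m (LinearMap.ker f) := PD.sub (LinearMap.ker f).injective_subtype f.exact_subtype_ker_map hf
      (.of_projective inferInstance _) hX
    obtain ⟨i, hi⟩ := Ind.exists_map ι (X := LinearMap.ker f) (X' := X →₀ B)
      (LinearMap.ker f).subtype
    obtain ⟨p, hp⟩ := Ind.exists_map ι (X := X →₀ B) (X' := X) f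
    have hinj : Function.Injective i := by
      obtain ⟨F, hF⟩ := Ind.exists_toFree ι (LinearMap.id (R := B) (M := X →₀ B))
      have := Ind.toFree_injective ι hι (LinearMap.ker f).injective_subtype (F := F ∘ₗ i)
        (fun x => by rw [LinearMap.comp_apply, hi, hF]; rfl)
      rw [LinearMap.coe_comp] at this
      exact this.of_comp
    have hsurj : Function.Surjective p := by
      rw [← LinearMap.range_eq_top, eq_top_iff]
      rintro z -
      obtain ⟨r, h, x, rfl⟩ := Ind.exists_sum ι z
      refine Submodule.sum_mem _ fun s _ => Submodule.smul_mem _ _ ?_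
      obtain ⟨v, hv⟩ := hf (x s)
      exact ⟨indMk ι v, by rw [hp, hv]⟩
    have hex : Function.Exact i p := by
      intro z
      constructor
      · intro hz
        let Q := Ind ι (X →₀ B) ⧸ LinearMap.range i
        let _ : Module B Q := Module.compHom Q (ι : B →+* H)
        have hQ : ∀ (a : B) (q : Q), a • q = ι a • q := fun _ _ => rfl
        let φ : (X →₀ B) →ₗ[B] Q :=
          { toFun := fun v => (LinearMap.range i).mkQ (indMk ι v)
            map_add' := fun _ _ => by simp
            map_smul' := fun a v => by rw [indMk_smul, map_smul, RingHom.id_apply, hQ] }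
        obtain ⟨φ', hφ'⟩ := exists_factor hf φ (fun v hv => by
          refine (Submodule.Quotient.mk_eq_zero _).2 ⟨indMk ι ⟨v, hv⟩, ?_⟩
          rw [hi]; rfl)
        obtain ⟨ψ, hψ⟩ := Ind.exists_lift ι φ' (map_add φ') (fun a x => by rw [map_smul, hQ])
        have : ψ ∘ₗ p = (LinearMap.range i).mkQ := Ind.hom_ext ι fun v => by
          rw [LinearMap.comp_apply, hp, hψ, hφ']; rfl
        have h2 := LinearMap.congr_fun this z
        rw [LinearMap.comp_apply, hz, map_zero] at h2
        exact (Submodule.Quotient.mk_eq_zero _).1 h2.symm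
      · rintro ⟨w, rfl⟩
        have : p ∘ₗ i = 0 := Ind.hom_ext ι fun x => by
          rw [LinearMap.comp_apply, hi, hp]
          have : f ((LinearMap.ker f).subtype x) = 0 := x.2
          rw [this, map_zero]; rfl
        exact LinearMap.congr_fun this w
    exact PD.quot hinj hex hsurj (ih _ hK) (.of_projective (Ind.projective ι inferInstance) _)

theorem injective_restrict (hι : EqFlatR (ι : B →+* H)) {I : Type u} [AddCommGroup I] [Module H I]
    [Module B I] (hact : ∀ (a : B) (x : I), a • x = ι a • x) (hI : Module.Injective H I) :
    Module.Injective B I := by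
  refine Module.Baer.injective fun 𝔞 g => ?_
  obtain ⟨F, hF⟩ := Ind.exists_toFree ι (Finsupp.lsingle PUnit.unit ∘ₗ 𝔞.subtype :
    𝔞 →ₗ[B] (PUnit.{u+1} →₀ B))
  have hFi := Ind.toFree_injective ι hι
    ((Finsupp.single_injective _).comp 𝔞.injective_subtype) hF
  obtain ⟨G, hG⟩ := Ind.exists_lift ι g (map_add g) (fun a x => by rw [map_smul, hact])
  obtain ⟨E, hE⟩ := hI.out F hFi G
  refine ⟨{ toFun := fun b => E (Finsupp.single PUnit.unit (ι b))
            map_add' := fun a b => by rw [map_add, Finsupp.single_add, map_add]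
            map_smul' := fun a b => by
              rw [smul_eq_mul, map_mul, RingHom.id_apply, hact, ← map_smul, Finsupp.smul_single,
                smul_eq_mul] }, fun x hx => ?_⟩
  have := hE (indMk ι ⟨x, hx⟩)
  rw [hF, hG] at this
  simpa using this

end Induction

noncomputable section ColMap

variable {B : Type u} [Ring B] {M M' : Type u} [AddCommGroup M] [Module B M] [AddCommGroup M']
  [Module B M']

/-- The vector `b · m` with entries `b i • m`. -/
def colSmul (b : ℕ →₀ B) : M →+ (ℕ →₀ M) where
  toFun m := b.mapRange (fun a => a • m) (zero_smul B m)
  map_zero' := by ext; simp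
  map_add' m m' := by ext; simp

@[simp] theorem colSmul_apply (b : ℕ →₀ B) (m : M) (i : ℕ) : colSmul b m i = b i • m := rfl

/-- The action on column vectors over `M` of the column-finite matrix with columns `c`. -/
def colMap (c : ℕ → ℕ →₀ B) (M : Type u) [AddCommGroup M] [Module B M] : (ℕ →₀ M) →+ (ℕ →₀ M) :=
  Finsupp.liftAddHom fun y => colSmul (c y)

@[simp] theorem colMap_single (c : ℕ → ℕ →₀ B) (y : ℕ) (m : M) :
    colMap c M (Finsupp.single y m) = colSmul (c y) m := by
  simp [colMap]

theorem colMap_apply (c : ℕ → ℕ →₀ B) (x : ℕ →₀ M) (i : ℕ) :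
    colMap c M x i = x.sum fun y m => c y i • m := by
  simp [colMap, Finsupp.sum_apply]

theorem colMap_mapRange (c : ℕ → ℕ →₀ B) (φ : M →+ M') (hφ : ∀ (b : B) m, φ (b • m) = b • φ m)
    (x : ℕ →₀ M) : colMap c M' (x.mapRange φ (map_zero φ)) =
      (colMap c M x).mapRange φ (map_zero φ) := by
  induction x using Finsupp.induction_linear with
  | zero => simp
  | add f g hf hg =>
    rw [Finsupp.mapRange_add (map_add φ), map_add, map_add, Finsupp.mapRange_add (map_add φ), hf, hg]
  | single y m =>
    rw [Finsupp.mapRange_single, colMap_single, colMap_single]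
    ext i
    simp [hφ]

theorem colMap_colSmul (c : ℕ → ℕ →₀ B) (b : ℕ →₀ B) (m : M) :
    colMap c M (colSmul b m) = colSmul (colMap c B b) m :=
  colMap_mapRange (M := B) c ((AddMonoidHom.flip (smulAddHom B M)) m)
    (fun a b => by simp [mul_smul]) b

/-- Multiplicativity of `colMap`. -/
theorem colMap_comp {c c' e : ℕ → ℕ →₀ B} (h : ∀ w, colMap c B (e w) = c' w) (x : ℕ →₀ M) :
    colMap c M (colMap e M x) = colMap c' M x := by
  induction x using Finsupp.induction_linear with
  | zero => simp
  | add f g hf hg => rw [map_add, map_add, map_add, hf, hg]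
  | single y m => rw [colMap_single, colMap_single, colMap_colSmul, h]

theorem colMap_comp_eq_zero {c e : ℕ → ℕ →₀ B} (h : ∀ w, colMap c B (e w) = 0) (x : ℕ →₀ M) :
    colMap c M (colMap e M x) = 0 := by
  rw [colMap_comp (c' := fun _ => 0) h]
  ext i
  simp [colMap_apply]

/-- A right-exact-resolution-like sequence of column-finite matrices over `B`. -/
def ExactData (d : ℕ → ℕ → ℕ →₀ B) : Prop :=
  (∀ i w, colMap (d i) B (d (i + 1) w) = 0) ∧
    ∀ i x, colMap (d i) B x = 0 → ∃ z, colMap (d (i + 1)) B z = x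

/-- Vanishing of the homology of `C ⊗ M` in degrees `≥ n`, for exact sequences `C` of countable
free right modules. -/
def TV (B : Type u) [Ring B] (n : ℕ) (M : Type u) [AddCommGroup M] [Module B M] : Prop :=
  ∀ d : ℕ → ℕ → ℕ →₀ B, ExactData d → ∀ i, n ≤ i → ∀ x : ℕ →₀ M, colMap (d i) M x = 0 →
    ∃ z, colMap (d (i + 1)) M z = x

/-- The equational criterion of flatness for a left module. -/
def EqFlat (B : Type u) [Ring B] (M : Type u) [AddCommGroup M] [Module B M] : Prop :=
  ∀ (c : ℕ → ℕ →₀ B) (x : ℕ →₀ M), colMap c M x = 0 →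
    ∃ c' : ℕ → ℕ →₀ B, (∀ w, colMap c B (c' w) = 0) ∧ ∃ z, colMap c' M z = x

theorem EqFlat.exact (h : EqFlat B M) {c d : ℕ → ℕ →₀ B}
    (hcd : ∀ x, colMap c B x = 0 → ∃ z, colMap d B z = x) (x : ℕ →₀ M) (hx : colMap c M x = 0) :
    ∃ z, colMap d M z = x := by
  obtain ⟨c', h1, z, rfl⟩ := h c x hx
  choose e he using fun w => hcd _ (h1 w)
  exact ⟨colMap e M z, colMap_comp he z⟩

theorem EqFlat.free (Y : Type u) : EqFlat B (Y →₀ B) := by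
  classical
  intro c x hx
  let F : Finset Y := x.support.biUnion fun s => (x s).support
  let e := F.equivFin
  let c' : ℕ → ℕ →₀ B := fun j => if h : j < F.card then
    x.mapRange (fun v => v (e.symm ⟨j, h⟩).1) rfl else 0
  refine ⟨c', fun w => ?_, ∑ j : Fin F.card, Finsupp.single (j : ℕ) (Finsupp.single (e.symm j).1 1),
    ?_⟩
  · by_cases h : w < F.card
    · simp only [c', dif_pos h]
      have := colMap_mapRange (M' := B) c
        (Finsupp.applyAddHom (M := B) (e.symm ⟨w, h⟩).1) (fun b m => by simp) x
      rw [hx, Finsupp.mapRange_zero] at this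
      exact this
    · simp [c', dif_neg h]
  · ext s y
    simp only [map_sum, colMap_single, Finsupp.finsetSum_apply, colSmul_apply]
    have h1 : ∀ j : Fin F.card, (c' j s • Finsupp.single (e.symm j).1 (1 : B)) y =
        if (e.symm j).1 = y then x s y else 0 := by
      intro j
      have : c' j s = x s (e.symm j).1 := by simp [c']
      rw [this, Finsupp.smul_single, smul_eq_mul, mul_one, Finsupp.single_apply]
      split_ifs with h
      · rw [h]
      · rfl
    simp only [h1]
    by_cases hy : y ∈ F
    · rw [Finset.sum_eq_single (e ⟨y, hy⟩)]
      · simp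
      · intro j _ hj
        rw [if_neg]
        rintro rfl
        exact hj (by simp)
      · simp
    · rw [Finset.sum_eq_zero]
      · by_contra h
        have h2 : x s y ≠ 0 := fun h' => h h'.symm
        refine hy (Finset.mem_biUnion.2 ⟨s, ?_, Finsupp.mem_support_iff.2 h2⟩)
        rw [Finsupp.mem_support_iff]
        rintro h3
        simp [h3] at h2
      · intro j _
        rw [if_neg]
        rintro rfl
        exact hy (e.symm j).2

theorem TV.syzygy {n : ℕ} (h : TV B (n + 1) M) {Y : Type u} (p : (Y →₀ B) →ₗ[B] M)
    (hp : Function.Surjective p) : TV B n (LinearMap.ker p) := by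
  classical
  intro d hd i hi x hx
  let ι : LinearMap.ker p →+ (Y →₀ B) := (LinearMap.ker p).subtype.toAddMonoidHom
  have hι : Function.Injective ι := (LinearMap.ker p).injective_subtype
  have e1 := fun i x => colMap_mapRange (d i) ι (fun b m => rfl) x
  have e2 := fun i x => colMap_mapRange (d i) p.toAddMonoidHom (fun b m => p.map_smul b m) x
  obtain ⟨q, hq⟩ := (EqFlat.free Y).exact (hd.2 i) (x.mapRange ι (map_zero ι))
    (by rw [e1, hx, Finsupp.mapRange_zero])
  obtain ⟨m, hm⟩ := h d hd (i + 1) (by lia) (q.mapRange p.toAddMonoidHom (map_zero _)) (by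
    rw [e2, hq]; ext s; simp [ι])
  obtain ⟨q', rfl⟩ := Finsupp.mapRange_surjective p.toAddMonoidHom (map_zero _) hp m
  rw [e2] at hm
  let r : ℕ →₀ (Y →₀ B) := q - colMap (d (i + 2)) _ q'
  have hr : ∀ s, r s ∈ LinearMap.ker p := fun s => by
    have := DFunLike.congr_fun hm s
    simp only [Finsupp.mapRange_apply, LinearMap.toAddMonoidHom_coe] at this
    rw [LinearMap.mem_ker, Finsupp.sub_apply, map_sub, sub_eq_zero, ← this]
  let g : (Y →₀ B) → LinearMap.ker p := fun v => if hv : v ∈ LinearMap.ker p then ⟨v, hv⟩ else 0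
  let z : ℕ →₀ LinearMap.ker p := r.mapRange g (by simp [g])
  have hz : z.mapRange ι (map_zero ι) = r := by
    ext1 s
    simp only [z, Finsupp.mapRange_apply, g, dif_pos (hr s)]
    rfl
  refine ⟨z, Finsupp.mapRange_injective ι (map_zero ι) hι ?_⟩
  rw [← e1, hz, map_sub, colMap_comp_eq_zero (hd.1 (i + 1)), sub_zero, hq]

end ColMap

section HomVanish

variable {R : Type u} [Ring R] {P : Type u} [AddCommGroup P] [Module R P]

theorem exists_factor_of_exact (hP : Module.Projective R P) (D : ℕ → P →ₗ[R] P)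
    (hD : ∀ i x, D i (D (i + 1) x) = 0) (hex : ∀ i x, D i x = 0 → ∃ z, D (i + 1) z = x) (n : ℕ) :
    ∀ (Q : Type u) [AddCommGroup Q] [Module R Q], ID R n Q → ∀ i, n ≤ i → ∀ f : P →ₗ[R] Q,
      (∀ x, f (D (i + 1) x) = 0) → ∃ g : P →ₗ[R] Q, ∀ x, g (D i x) = f x := by
  induction n with
  | zero =>
    intro Q _ _ hQ i _ f hf
    obtain ⟨g, hg⟩ := exists_factor (D i).surjective_rangeRestrict f (fun x hx => by
      obtain ⟨z, rfl⟩ := hex i x (congrArg Subtype.val hx)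
      exact hf z)
    obtain ⟨g', hg'⟩ := (id_zero_iff.1 hQ).out (LinearMap.range (D i)).subtype
      (LinearMap.range (D i)).injective_subtype g
    exact ⟨g', fun x => (hg' ((D i).rangeRestrict x)).trans (hg x)⟩
  | succ n ih =>
    intro Q _ _ hQ i hi f hf
    obtain ⟨E, j, hE, hj⟩ := exists_embed_injective R Q
    obtain ⟨i, rfl⟩ : ∃ i', i = i' + 1 := ⟨i - 1, by lia⟩
    let π := (LinearMap.range j).mkQ
    have hπ : Function.Surjective π := Submodule.mkQ_surjective _
    have hC : ID R n (E ⧸ LinearMap.range j) :=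
      ID.quot hj exact_mkQ_range hπ (.of_injective hE _) hQ
    obtain ⟨g1, hg1⟩ := exists_factor (D (i + 1)).surjective_rangeRestrict (j ∘ₗ f) (fun x hx => by
      obtain ⟨z, rfl⟩ := hex (i + 1) x (congrArg Subtype.val hx)
      simp [hf])
    obtain ⟨g1', hg1'⟩ := hE.out (LinearMap.range (D (i + 1))).subtype
      (LinearMap.range (D (i + 1))).injective_subtype g1
    have h1 : ∀ x, g1' (D (i + 1) x) = j (f x) := fun x =>
      (hg1' ((D (i + 1)).rangeRestrict x)).trans (hg1 x)
    have hz : ∀ q, π (j q) = 0 := fun q => (Submodule.Quotient.mk_eq_zero _).2 ⟨q, rfl⟩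
    obtain ⟨g2, hg2⟩ := ih _ hC i (by lia) (π ∘ₗ g1') (fun x => by
      rw [LinearMap.comp_apply, h1, hz])
    obtain ⟨g3, hg3⟩ := Module.projective_lifting_property π g2 hπ
    let u : P →ₗ[R] E := g1' - g3 ∘ₗ D i
    have hu : ∀ x, u x ∈ LinearMap.range j := fun x => by
      refine (Submodule.Quotient.mk_eq_zero _).1 ?_
      change π (u x) = 0
      have := LinearMap.congr_fun hg3 (D i x)
      simp only [LinearMap.comp_apply] at this
      rw [LinearMap.sub_apply, map_sub, LinearMap.comp_apply, this, hg2]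
      simp
    let e := LinearEquiv.ofInjective j hj
    refine ⟨e.symm.toLinearMap ∘ₗ u.codRestrict _ hu, fun x => hj ?_⟩
    have : ∀ y, j (e.symm y) = y := fun y => congrArg Subtype.val (e.apply_symm_apply y)
    rw [LinearMap.comp_apply, LinearEquiv.coe_coe, this]
    simp [u, h1, hD]

end HomVanish

noncomputable section Twisted

variable {B H : Type u} [Ring B] [Ring H]

/-- `H` as a left `B`-module via `ι`, and as a left `H`-module via right multiplication and an
anti-automorphism. -/
def Tw (ι : B →+* H) (τ : H ≃+* Hᵐᵒᵖ) : Type u := H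

variable (ι : B →+* H) (τ : H ≃+* Hᵐᵒᵖ)

instance : AddCommGroup (Tw ι τ) := inferInstanceAs (AddCommGroup H)

instance : Module H (Tw ι τ) := Module.compHom H (τ : H →+* Hᵐᵒᵖ)

instance : Module B (Tw ι τ) := Module.compHom H ι

/-- The identity map from `H` to `Tw`. -/
def toTw : H ≃+ Tw ι τ := AddEquiv.refl H

theorem smul_toTw (a h : H) : a • toTw ι τ h = toTw ι τ (h * (τ a).unop) := rfl

theorem base_smul_toTw (b : B) (h : H) : b • toTw ι τ h = toTw ι τ (ι b * h) := rfl

theorem Tw.smul_comm (a : H) (b : B) (x : Tw ι τ) : a • b • x = b • a • x := by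
  obtain ⟨h, rfl⟩ := (toTw ι τ).surjective x
  rw [base_smul_toTw, smul_toTw, smul_toTw, base_smul_toTw, mul_assoc]

theorem Tw.projective : Module.Projective H (Tw ι τ) := by
  refine Module.Projective.of_equiv (R := H) (M := H)
    { toFun := fun h => toTw ι τ (τ h).unop
      invFun := fun x => τ.symm (MulOpposite.op ((toTw ι τ).symm x))
      map_add' := fun a b => by simp
      map_smul' := fun a b => by
        rw [RingHom.id_apply, smul_toTw, smul_eq_mul, map_mul, MulOpposite.unop_mul]
      left_inv := fun h => by simp
      right_inv := fun h => by simp }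

/-- `colMap` as an `H`-linear endomorphism. -/
def colMapTw (c : ℕ → ℕ →₀ B) : (ℕ →₀ Tw ι τ) →ₗ[H] (ℕ →₀ Tw ι τ) :=
  { colMap c (Tw ι τ) with
    map_smul' := fun a x =>
      colMap_mapRange c (DistribSMul.toAddMonoidHom (Tw ι τ) a)
        (fun b m => Tw.smul_comm ι τ a b m) x }

theorem colMapTw_apply (c : ℕ → ℕ →₀ B) (x : ℕ →₀ Tw ι τ) :
    colMapTw ι τ c x = colMap c (Tw ι τ) x := rfl

variable {J : Type u} [AddCommGroup J] [Module H J] [Module B J]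

variable {ι τ}

/-- The map on column vectors over `J` given by the row vector of an `H`-linear form. -/
def rowJ (J : Type u) [AddCommGroup J] [Module H J] (φ : (ℕ →₀ Tw ι τ) →ₗ[H] Tw ι τ) :
    (ℕ →₀ J) →+ J :=
  Finsupp.liftAddHom fun s =>
    DistribSMul.toAddMonoidHom J ((toTw ι τ).symm (φ (Finsupp.single s (toTw ι τ 1))))

theorem rowJ_single (φ : (ℕ →₀ Tw ι τ) →ₗ[H] Tw ι τ) (s : ℕ) (x : J) :
    rowJ J φ (Finsupp.single s x) =
      (toTw ι τ).symm (φ (Finsupp.single s (toTw ι τ 1))) • x := by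
  simp [rowJ]

theorem Tw.map_single (φ : (ℕ →₀ Tw ι τ) →ₗ[H] Tw ι τ) (s : ℕ) (h : H) :
    φ (Finsupp.single s (toTw ι τ h)) =
      toTw ι τ ((toTw ι τ).symm (φ (Finsupp.single s (toTw ι τ 1))) * h) := by
  have : toTw ι τ h = τ.symm (MulOpposite.op h) • toTw ι τ 1 := by
    rw [smul_toTw]; simp
  rw [this, ← Finsupp.smul_single, map_smul]
  obtain ⟨y, hy⟩ := (toTw ι τ).surjective (φ (Finsupp.single s (toTw ι τ 1)))
  rw [← hy, smul_toTw]
  simp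

theorem rowJ_colSmul (hact : ∀ (b : B) (x : J), b • x = ι b • x)
    (φ : (ℕ →₀ Tw ι τ) →ₗ[H] Tw ι τ) (b : ℕ →₀ B) (x : J) :
    rowJ J φ (colSmul b x) = (toTw ι τ).symm (φ (colSmul b (toTw ι τ 1))) • x := by
  induction b using Finsupp.induction_linear with
  | zero =>
    have h1 : colSmul (0 : ℕ →₀ B) x = 0 := by ext; simp
    have h2 : colSmul (0 : ℕ →₀ B) (toTw ι τ 1) = 0 := by ext; simp
    rw [h1, h2]; simp
  | add f g hf hg =>
    have h1 : colSmul (f + g) x = colSmul f x + colSmul g x := by ext; simp [add_smul]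
    have h2 : colSmul (f + g) (toTw ι τ 1) = colSmul f (toTw ι τ 1) + colSmul g (toTw ι τ 1) := by
      ext; simp [add_smul]
    rw [h1, h2, map_add, map_add, map_add, add_smul, hf, hg]
  | single s b =>
    have h1 : colSmul (Finsupp.single s b) x = Finsupp.single s (b • x) :=
      Finsupp.mapRange_single (hf := zero_smul B x)
    have h2 : colSmul (Finsupp.single s b) (toTw ι τ 1) = Finsupp.single s (toTw ι τ (ι b)) := by
      refine (Finsupp.mapRange_single (hf := zero_smul B (toTw ι τ 1))).trans ?_
      rw [base_smul_toTw, mul_one]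
    rw [h1, h2, rowJ_single, Tw.map_single φ s (ι b), AddEquiv.symm_apply_apply, mul_smul, hact]

theorem rowJ_comp (hact : ∀ (b : B) (x : J), b • x = ι b • x) {c : ℕ → ℕ →₀ B}
    {φ v : (ℕ →₀ Tw ι τ) →ₗ[H] Tw ι τ} (h : ∀ x, v (colMapTw ι τ c x) = φ x) (x : ℕ →₀ J) :
    rowJ J v (colMap c J x) = rowJ J φ x := by
  induction x using Finsupp.induction_linear with
  | zero => simp
  | add f g hf hg => rw [map_add, map_add, map_add, hf, hg]
  | single s x =>
    rw [colMap_single, rowJ_colSmul hact, rowJ_single, ← h, colMapTw_apply, colMap_single]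

/-- The row vector `r` as an `H`-linear form. -/
def rowTw (ι : B →+* H) (τ : H ≃+* Hᵐᵒᵖ) (r : ℕ →₀ H) : (ℕ →₀ Tw ι τ) →ₗ[H] Tw ι τ :=
  Finsupp.lsum ℕ fun s =>
    { toFun := fun x => toTw ι τ (r s * (toTw ι τ).symm x)
      map_add' := fun _ _ => by simp [mul_add]
      map_smul' := fun a x => by
        obtain ⟨h, rfl⟩ := (toTw ι τ).surjective x
        rw [smul_toTw, RingHom.id_apply, smul_toTw]
        simp [mul_assoc] }

theorem rowTw_single (r : ℕ →₀ H) (s : ℕ) (h : H) :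
    rowTw ι τ r (Finsupp.single s (toTw ι τ h)) = toTw ι τ (r s * h) := by
  simp [rowTw]

theorem rowJ_rowTw (r : ℕ →₀ H) (x : ℕ →₀ J) :
    rowJ J (rowTw ι τ r) x = x.sum fun s y => r s • y := by
  simp [rowJ, rowTw_single, Finsupp.liftAddHom_apply]; rfl

/-- Modules whose restriction comes from an injective `H`-module satisfy `TV`. -/
theorem tv_of_injective (hact : ∀ (b : B) (x : J), b • x = ι b • x) (hJ : Module.Injective H J)
    (hflat : EqFlat B (Tw ι τ)) {n : ℕ} (h1 : ID H n (Tw ι τ)) (h2 : ID H n (ℕ →₀ Tw ι τ)) :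
    TV B n J := by
  intro d hd i hi x hx
  by_contra hcon
  have hproj := Tw.projective ι τ
  have key : ∀ N : ℕ, ∃ r : ℕ →₀ H,
      (∀ w < N, rowTw ι τ r (colSmul (d (i + 1) w) (toTw ι τ 1)) = 0) ∧
        rowJ J (rowTw ι τ r) x ≠ 0 := by
    intro N
    by_contra hN
    push Not at hN
    let Ψ : (ℕ →₀ H) →ₗ[H] (Fin N → H) :=
      { toFun := fun r w => (d (i + 1) w).sum fun s b => r s * ι b
        map_add' := fun r r' => by ext w; simp [add_mul]
        map_smul' := fun a r => by ext w; simp [mul_assoc, Finsupp.mul_sum] }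
    let θ : (ℕ →₀ H) →ₗ[H] J :=
      { toFun := fun r => x.sum fun s y => r s • y
        map_add' := fun r r' => by simp [add_smul]
        map_smul' := fun a r => by simp [mul_smul, Finsupp.smul_sum] }
    have hΨ : ∀ (r : ℕ →₀ H) (c : ℕ →₀ B), rowTw ι τ r (colSmul c (toTw ι τ 1)) =
        toTw ι τ (c.sum fun s b => r s * ι b) := by
      intro r c
      have : colSmul c (toTw ι τ 1) = c.sum fun s b => Finsupp.single s (toTw ι τ (ι b)) := by
        refine Finsupp.ext fun s => ?_
        rw [Finsupp.sum_apply, colSmul_apply, base_smul_toTw, mul_one, Finsupp.sum,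
          Finset.sum_eq_single s]
        · simp
        · intro b _ hb; simp [hb]
        · intro hs; simp [Finsupp.notMem_support_iff.1 hs]
      rw [this, Finsupp.sum, map_sum, Finsupp.sum, map_sum]
      simp [rowTw_single]
    obtain ⟨G, hG⟩ := exists_factor Ψ.surjective_rangeRestrict θ (fun r hr => by
      have := hN r (fun w hw => by
        rw [hΨ]
        have := congrFun (congrArg Subtype.val hr) ⟨w, hw⟩
        change ((d (i + 1) w).sum fun s b => r s * ι b) = 0 at this
        rw [this, map_zero])
      rwa [rowJ_rowTw] at this)
    obtain ⟨G', hG'⟩ := hJ.out (LinearMap.range Ψ).subtype (LinearMap.range Ψ).injective_subtype G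
    have hG2 : ∀ r, G' (Ψ r) = θ r := fun r => (hG' (Ψ.rangeRestrict r)).trans (hG r)
    refine hcon ⟨∑ w : Fin N, Finsupp.single (w : ℕ) (G' (Pi.single w 1)), ?_⟩
    ext s
    have e1 := hG2 (Finsupp.single s 1)
    have e2 : θ (Finsupp.single s 1) = x s := by
      change (x.sum fun t y => (Finsupp.single s (1 : H)) t • y) = x s
      rw [Finsupp.sum, Finset.sum_eq_single s]
      · simp
      · intro b _ hb; simp [hb.symm]
      · intro hs; simp [Finsupp.notMem_support_iff.1 hs]
    have e3 : Ψ (Finsupp.single s 1) = ∑ w : Fin N, ι (d (i + 1) w s) • Pi.single w (1 : H) := by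
      ext w
      change ((d (i + 1) w).sum fun t b => (Finsupp.single s (1 : H)) t * ι b) = _
      rw [Finsupp.sum, Finset.sum_eq_single s]
      · simp [Finset.sum_apply, Pi.single_apply]
      · intro b _ hb; simp [hb.symm]
      · intro hs; simp [Finsupp.notMem_support_iff.1 hs]
    rw [e2, e3, map_sum] at e1
    rw [← e1]
    simp [Finsupp.finsetSum_apply, hact]
  have hproj2 : Module.Projective H (ℕ →₀ Tw ι τ) := by
    classical
    exact .of_equiv (finsuppLequivDFinsupp (ι := ℕ) (M := Tw ι τ) H).symm
  choose r hr1 hr2 using key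
  let D : ℕ → (ℕ →₀ Tw ι τ) →ₗ[H] (ℕ →₀ Tw ι τ) := fun i => colMapTw ι τ (d i)
  have hD : ∀ i x, D i (D (i + 1) x) = 0 := fun i x => colMap_comp_eq_zero (hd.1 i) x
  have hex : ∀ i x, D i x = 0 → ∃ z, D (i + 1) z = x := fun i x => hflat.exact (hd.2 i) x
  have hfin : ∀ u, {m | rowTw ι τ (r m) (D (i + 1) u) ≠ 0}.Finite := by
    intro u
    induction u using Finsupp.induction_linear with
    | zero => simp
    | add f g hf hg =>
      refine (hf.union hg).subset fun m hm => ?_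
      by_contra hc
      simp only [Set.mem_union, Set.mem_ofPred_eq, not_or, not_not] at hc
      exact hm (by rw [map_add, map_add, hc.1, hc.2, add_zero])
    | single y v =>
      refine (Set.finite_Iic y).subset fun m hm => ?_
      by_contra hc
      refine hm ?_
      obtain ⟨h, rfl⟩ := (toTw ι τ).surjective v
      have : toTw ι τ h = τ.symm (MulOpposite.op h) • toTw ι τ 1 := by
        rw [smul_toTw]; simp
      rw [this, ← Finsupp.smul_single, map_smul, map_smul]
      have h3 : D (i + 1) (Finsupp.single y (toTw ι τ 1)) =
          colSmul (d (i + 1) y) (toTw ι τ 1) := colMap_single _ _ _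
      rw [h3, hr1 m y (by simpa using hc), smul_zero]
  let F : (ℕ →₀ Tw ι τ) →ₗ[H] (ℕ →₀ Tw ι τ) :=
    { toFun := fun u => Finsupp.ofSupportFinite (fun m => rowTw ι τ (r m) (D (i + 1) u)) (hfin u)
      map_add' := fun u v => by ext m; simp [Finsupp.ofSupportFinite]; rfl
      map_smul' := fun a u => by ext m; simp [Finsupp.ofSupportFinite]; rfl }
  have hF : ∀ u m, F u m = rowTw ι τ (r m) (D (i + 1) u) := fun _ _ => rfl
  obtain ⟨g, hg⟩ := exists_factor_of_exact hproj2 D hD hex n _ h2 (i + 1) (by lia) F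
    (fun u => by ext m; rw [hF, hD, map_zero]; rfl)
  have hv : ∀ m, ∃ v : (ℕ →₀ Tw ι τ) →ₗ[H] Tw ι τ,
      ∀ u, v (D i u) = (rowTw ι τ (r m) - Finsupp.lapply m ∘ₗ g) u := fun m =>
    exists_factor_of_exact hproj2 D hD hex n _ h1 i hi _ fun u => by
      rw [LinearMap.sub_apply, LinearMap.comp_apply, hg, ← hF, Finsupp.lapply_apply, sub_self]
  choose v hv using hv
  obtain ⟨m, hm⟩ : ∃ m, ∀ s ∈ x.support, g (Finsupp.single s (toTw ι τ 1)) m = 0 := by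
    classical
    obtain ⟨m, hm⟩ := Infinite.exists_notMem_finset
      (x.support.biUnion fun s => (g (Finsupp.single s (toTw ι τ 1))).support)
    refine ⟨m, fun s hs => ?_⟩
    by_contra hc
    exact hm (Finset.mem_biUnion.2 ⟨s, hs, Finsupp.mem_support_iff.2 hc⟩)
  refine hr2 m ?_
  have e1 := rowJ_comp hact (hv m) x
  rw [hx, map_zero] at e1
  have e2 : rowJ J (rowTw ι τ (r m) - Finsupp.lapply m ∘ₗ g) x = rowJ J (rowTw ι τ (r m)) x := by
    simp only [rowJ, Finsupp.liftAddHom_apply]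
    refine Finsupp.sum_congr fun s hs => ?_
    simp only [LinearMap.sub_apply, LinearMap.comp_apply, Finsupp.lapply_apply, hm s hs, sub_zero]
  rw [← e2, ← e1]

end Twisted

noncomputable section CountableDim

/-- The subspace `W` is spanned by a countable set. -/
def CountSpan (k : Type u) [Field k] {V : Type u} [AddCommGroup V] [Module k V]
    (W : Submodule k V) : Prop := ∃ s : Set V, s.Countable ∧ Submodule.span k s = W

variable {k : Type u} [Field k] {V V' : Type u} [AddCommGroup V] [Module k V] [AddCommGroup V']
  [Module k V']

theorem CountSpan.mono {W W' : Submodule k V} (h : CountSpan k W) (hle : W' ≤ W) :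
    CountSpan k W' := by
  obtain ⟨s, hs, rfl⟩ := h
  have h1 : Module.rank k W' ≤ Cardinal.aleph0 :=
    (Submodule.rank_mono hle).trans ((rank_span_le s).trans (Cardinal.le_aleph0_iff_set_countable.2 hs))
  let b := Module.Basis.ofVectorSpace k W'
  have hc : Countable (Module.Basis.ofVectorSpaceIndex k W') := by
    rw [← Cardinal.mk_le_aleph0_iff, b.mk_eq_rank'']
    exact h1
  refine ⟨Set.range fun i => (b i : V), Set.countable_range _, ?_⟩
  have : Set.range (fun i => (b i : V)) = W'.subtype '' Set.range b := by
    rw [← Set.range_comp]; rfl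
  rw [this, Submodule.span_image, b.span_eq, Submodule.map_top, Submodule.range_subtype]

theorem CountSpan.seq {W : Submodule k V} (h : CountSpan k W) :
    ∃ w : ℕ → V, Submodule.span k (Set.range w) = W := by
  obtain ⟨s, hs, rfl⟩ := h
  obtain ⟨w, hw⟩ := (hs.insert (0 : V)).exists_eq_range ⟨0, by simp⟩
  exact ⟨w, by rw [← hw, Submodule.span_insert_zero]⟩

theorem CountSpan.map {W : Submodule k V} (h : CountSpan k W) (f : V →ₗ[k] V') :
    CountSpan k (W.map f) := by
  obtain ⟨s, hs, rfl⟩ := h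
  exact ⟨f '' s, hs.image f, by rw [Submodule.span_image]⟩

variable {B : Type u} [Ring B] [Algebra k B]

theorem countSpan_supported (hB : CountSpan k (⊤ : Submodule k B)) {Y : Type u} {s : Set Y}
    (hs : s.Countable) :
    CountSpan k ((Finsupp.supported B B s).restrictScalars k) := by
  classical
  obtain ⟨t, ht, htop⟩ := hB
  refine CountSpan.mono ⟨Set.image2 (fun y b => Finsupp.single y b) s t, hs.image2 ht _, rfl⟩ ?_
  intro x hx
  have hx' : ↑x.support ⊆ s := (Finsupp.mem_supported B x).1 hx
  rw [← x.sum_single]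
  refine Submodule.sum_mem _ fun y hy => ?_
  have : x y ∈ Submodule.span k t := by rw [htop]; trivial
  have h2 := Submodule.mem_map_of_mem (f := (Finsupp.lsingle y : B →ₗ[k] Y →₀ B)) this
  rw [Submodule.map_span] at h2
  refine Submodule.span_mono ?_ h2
  rintro _ ⟨b, hb, rfl⟩
  exact ⟨y, hx' hy, b, hb, rfl⟩

theorem countSpan_nat (hB : CountSpan k (⊤ : Submodule k B)) :
    CountSpan k (⊤ : Submodule k (ℕ →₀ B)) := by
  classical
  obtain ⟨t, ht, htop⟩ := hB
  refine CountSpan.mono ⟨Set.image2 (fun y b => Finsupp.single y b) Set.univ t,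
    Set.countable_univ.image2 ht _, rfl⟩ ?_
  intro x _
  rw [← x.sum_single]
  refine Submodule.sum_mem _ fun y hy => ?_
  have : x y ∈ Submodule.span k t := by rw [htop]; trivial
  have h2 := Submodule.mem_map_of_mem (f := (Finsupp.lsingle y : B →ₗ[k] ℕ →₀ B)) this
  rw [Submodule.map_span] at h2
  refine Submodule.span_mono ?_ h2
  rintro _ ⟨b, hb, rfl⟩
  exact ⟨y, trivial, b, hb, rfl⟩

/-- The kernel of a column-finite matrix is the image of another one. -/
theorem exists_kernel_matrix (hB : CountSpan k (⊤ : Submodule k B)) (c : ℕ → ℕ →₀ B) :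
    ∃ c' : ℕ → ℕ →₀ B, (∀ w, colMap c B (c' w) = 0) ∧
      ∀ x, colMap c B x = 0 → ∃ z, colMap c' B z = x := by
  have hk : ∀ (c : ℕ → ℕ →₀ B) (a : k) (x : ℕ →₀ B), colMap c B (a • x) = a • colMap c B x := by
    intro c a x
    have := colMap_mapRange (M := B) (M' := B) c (DistribSMul.toAddMonoidHom B a)
      (fun b m => by simp) x
    exact (congrArg _ (by ext; rfl)).trans (this.trans (by ext; rfl))
  let W : Submodule k (ℕ →₀ B) :=
    { carrier := {x | colMap c B x = 0}
      add_mem' := fun {x y} hx hy => by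
        rw [Set.mem_ofPred_eq] at hx hy ⊢; rw [map_add, hx, hy, add_zero]
      zero_mem' := map_zero _
      smul_mem' := fun a x hx => by
        rw [Set.mem_ofPred_eq] at hx ⊢; rw [hk, hx, smul_zero] }
  obtain ⟨w, hw⟩ := ((countSpan_nat hB).mono (le_top (a := W))).seq
  have hmem : ∀ i, w i ∈ W := fun i => hw ▸ Submodule.subset_span ⟨i, rfl⟩
  refine ⟨w, hmem, fun x hx => ?_⟩
  have hxW : x ∈ W := hx
  clear hx
  rw [← hw] at hxW
  induction hxW using Submodule.span_induction with
  | mem x h =>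
    obtain ⟨i, rfl⟩ := h
    refine ⟨Finsupp.single i 1, ?_⟩
    rw [colMap_single]; ext; simp
  | zero => exact ⟨0, map_zero _⟩
  | add x y hx hy h1 h2 =>
    obtain ⟨z, rfl⟩ := h1
    obtain ⟨z', rfl⟩ := h2
    exact ⟨z + z', map_add _ _ _⟩
  | smul a x hx h1 =>
    obtain ⟨z, rfl⟩ := h1
    exact ⟨a • z, hk _ _ _⟩

theorem TV.eqFlat (hB : CountSpan k (⊤ : Submodule k B)) {M : Type u} [AddCommGroup M] [Module B M]
    (h : TV B 0 M) : EqFlat B M := by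
  intro c x hx
  choose e he he' using fun c : ℕ → ℕ →₀ B => exists_kernel_matrix hB c
  let d : ℕ → ℕ → ℕ →₀ B := fun n => Nat.rec c (fun _ c => e c) n
  obtain ⟨z, hz⟩ := h d ⟨fun i w => he (d i) w, fun i x hx => he' (d i) x hx⟩ 0 le_rfl x hx
  exact ⟨e c, he c, z, hz⟩

end CountableDim

noncomputable section Telescope

variable {B : Type u} [Ring B]

theorem PD.dfinsupp {κ : Type} [DecidableEq κ] (n : ℕ) : ∀ (F : κ → Type u) [∀ i, AddCommGroup (F i)]
    [∀ i, Module B (F i)], (∀ i, PD B n (F i)) → PD B n (Π₀ i, F i) := by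
  induction n with
  | zero =>
    intro F _ _ h
    rw [pd_zero_iff]
    have := fun i => pd_zero_iff.1 (h i)
    exact inferInstanceAs (Module.Projective B (DirectSum κ F))
  | succ n ih =>
    intro F _ _ h
    choose p hp using fun i => exists_free_cover B (F i)
    have hK : ∀ i, PD B n (LinearMap.ker (p i)) := fun i =>
      PD.sub (LinearMap.ker (p i)).injective_subtype (p i).exact_subtype_ker_map (hp i)
        (PD.of_projective inferInstance n) (h i)
    have h1 := ih (fun i => LinearMap.ker (p i)) hK
    have h2 := (ih (fun i => F i →₀ B) (fun i => PD.of_projective inferInstance n)).mono n.le_succ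
    refine PD.quot (f := DFinsupp.mapRange.linearMap fun i => (LinearMap.ker (p i)).subtype)
      (g := DFinsupp.mapRange.linearMap p) ?_ ?_ ?_ h1 h2
    · exact (DFinsupp.mapRange_injective _ (fun i => rfl)).2 fun i =>
        (LinearMap.ker (p i)).injective_subtype
    · intro x
      constructor
      · intro hx
        have hx' : ∀ i, p i (x i) = 0 := fun i => DFunLike.congr_fun hx i
        classical
        let s : ∀ i, (F i →₀ B) → LinearMap.ker (p i) := fun i v =>
          if hv : v ∈ LinearMap.ker (p i) then ⟨v, hv⟩ else 0
        refine ⟨x.mapRange s (fun i => by simp [s]), ?_⟩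
        ext1 i
        simp [s, dif_pos (hx' i)]
      · rintro ⟨y, rfl⟩
        ext1 i
        simp
    · exact (DFinsupp.mapRange_surjective _ (fun i => map_zero _)).2 hp

variable {F : ℕ → Type u} [∀ i, AddCommGroup (F i)] [∀ i, Module B (F i)]

/-- Elements of a directed sequence which become zero eventually. -/
inductive Dies (f : ∀ i, F i →ₗ[B] F (i + 1)) : ∀ i, F i → Prop
  | zero (i : ℕ) : Dies f i 0
  | step (i : ℕ) (x : F i) (h : Dies f (i + 1) (f i x)) : Dies f i x

variable {f : ∀ i, F i →ₗ[B] F (i + 1)}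

theorem Dies.next {i : ℕ} {x : F i} (h : Dies f i x) : Dies f (i + 1) (f i x) := by
  cases h with
  | zero => rw [map_zero]; exact .zero _
  | step _ _ h => exact h

theorem Dies.add {i : ℕ} {x y : F i} (hx : Dies f i x) (hy : Dies f i y) : Dies f i (x + y) := by
  induction hx with
  | zero => rwa [zero_add]
  | step i x h ih => exact .step _ _ (by rw [map_add]; exact ih hy.next)

theorem Dies.smul {i : ℕ} {x : F i} (b : B) (hx : Dies f i x) : Dies f i (b • x) := by
  induction hx with
  | zero => rw [smul_zero]; exact .zero _
  | step i x h ih => exact .step _ _ (by rw [map_smul]; exact ih)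

/-- The image of a directed sequence of modules of projective dimension `≤ n`. -/
theorem pd_telescope {M : Type u} [AddCommGroup M] [Module B M] (p : ∀ i, F i →ₗ[B] M)
    (hpf : ∀ i x, p (i + 1) (f i x) = p i x) (hd : ∀ i x, p i x = 0 → Dies f i x) {n : ℕ}
    (hF : ∀ i, PD B n (F i)) (Λ : Submodule B M) (hΛ : Λ = ⨆ i, LinearMap.range (p i)) :
    PD B (n + 1) Λ := by
  have hD := PD.dfinsupp n F hF
  let σ : (Π₀ i, F i) →ₗ[B] (Π₀ i, F i) :=
    DFinsupp.lsum ℕ fun i => DFinsupp.lsingle (i + 1) ∘ₗ f i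
  have hσ : ∀ i x, σ (DFinsupp.single i x) = DFinsupp.single (i + 1) (f i x) := fun i x => by
    simp [σ]
  have hσ0 : ∀ x, σ x 0 = 0 := fun x => by
    induction x using DFinsupp.induction with
    | h0 => simp
    | ha i b x _ _ h => rw [map_add, DFinsupp.add_apply, h, hσ, add_zero]; rfl
  have hσs : ∀ x j, σ x (j + 1) = f j (x j) := fun x j => by
    induction x using DFinsupp.induction with
    | h0 => simp
    | ha i b x _ _ h =>
      rw [map_add, DFinsupp.add_apply, h, hσ, DFinsupp.add_apply, map_add]
      congr 1
      by_cases hij : i = j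
      · subst hij; simp
      · rw [DFinsupp.single_eq_of_ne (by lia), DFinsupp.single_eq_of_ne (by lia), map_zero]
  let P : (Π₀ i, F i) →ₗ[B] M := DFinsupp.lsum ℕ p
  have hP : ∀ i x, P (DFinsupp.single i x) = p i x := fun i x => by simp [P]
  have hrange : LinearMap.range P = Λ := by
    rw [hΛ]
    refine le_antisymm ?_ (iSup_le fun i => ?_)
    · rintro _ ⟨x, rfl⟩
      induction x using DFinsupp.induction with
      | h0 => simp
      | ha i b x _ _ h =>
        rw [map_add, hP]
        exact add_mem (Submodule.mem_iSup_of_mem i ⟨b, rfl⟩) h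
    · rintro _ ⟨x, rfl⟩
      exact ⟨DFinsupp.single i x, hP i x⟩
  let g : (Π₀ i, F i) →ₗ[B] (Π₀ i, F i) := LinearMap.id - σ
  have hPg : ∀ x, P (g x) = 0 := fun x => by
    induction x using DFinsupp.induction with
    | h0 => simp
    | ha i b x _ _ h =>
      rw [map_add, map_add, h, add_zero]
      simp only [g, LinearMap.sub_apply, LinearMap.id_apply, map_sub, hσ, hP, hpf, sub_self]
  subst hrange
  refine PD.quot (f := g) (g := P.rangeRestrict) ?_ ?_ P.surjective_rangeRestrict hD
    (hD.mono n.le_succ)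
  · rw [injective_iff_map_eq_zero]
    intro x hx
    have hx' : ∀ j, x j = σ x j := fun j => by
      have := DFunLike.congr_fun hx j
      rwa [LinearMap.sub_apply, LinearMap.id_apply, DFinsupp.sub_apply, DFinsupp.zero_apply,
        sub_eq_zero] at this
    ext1 j
    induction j with
    | zero => rw [hx', hσ0]; rfl
    | succ j ih => rw [hx', hσs, ih]; exact map_zero _
  · have hstep : ∀ i v, (LinearMap.range g).mkQ (DFinsupp.single i v) =
        (LinearMap.range g).mkQ (DFinsupp.single (i + 1) (f i v)) := fun i v => by
      rw [← sub_eq_zero, ← map_sub, ← hσ]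
      exact (Submodule.Quotient.mk_eq_zero _).2 ⟨DFinsupp.single i v, rfl⟩
    have hdie : ∀ i v, Dies f i v → (LinearMap.range g).mkQ (DFinsupp.single i v) = 0 := by
      intro i v h
      induction h with
      | zero => simp
      | step i x _ ih => rw [hstep, ih]
    have hrep : ∀ x : Π₀ i, F i, ∃ N, ∀ j, N ≤ j → ∃ v : F j, (LinearMap.range g).mkQ x =
        (LinearMap.range g).mkQ (DFinsupp.single j v) := fun x => by
      induction x using DFinsupp.induction with
      | h0 => exact ⟨0, fun j _ => ⟨0, by simp⟩⟩
      | ha i b x _ _ h =>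
        obtain ⟨N, hN⟩ := h
        refine ⟨max i N, fun j hj => ?_⟩
        obtain ⟨v, hv⟩ := hN j (le_trans (le_max_right _ _) hj)
        have h2 : ∀ j, i ≤ j → ∃ w : F j, (LinearMap.range g).mkQ (DFinsupp.single i b) =
            (LinearMap.range g).mkQ (DFinsupp.single j w) := fun j hj => by
          induction j, hj using Nat.le_induction with
          | base => exact ⟨b, rfl⟩
          | succ j hij ih =>
            obtain ⟨w, hw⟩ := ih
            exact ⟨f j w, hw.trans (hstep j w)⟩
        obtain ⟨w, hw⟩ := h2 j (le_trans (le_max_left _ _) hj)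
        exact ⟨w + v, by rw [map_add, hv, hw, ← map_add, DFinsupp.single_add]⟩
    intro x
    constructor
    · intro hx
      obtain ⟨N, hN⟩ := hrep x
      obtain ⟨v, hv⟩ := hN N le_rfl
      have hx0 : P x = 0 := congrArg Subtype.val hx
      have h1 : x - DFinsupp.single N v ∈ LinearMap.range g := by
        rw [← Submodule.Quotient.mk_eq_zero, ← Submodule.mkQ_apply, map_sub, hv, sub_self]
      obtain ⟨y, hy⟩ := h1
      have h2 : P (DFinsupp.single N v) = 0 := by
        have := hPg y
        rw [hy, map_sub, hx0, zero_sub, neg_eq_zero] at this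
        exact this
      rw [hP] at h2
      rw [hdie _ _ (hd _ _ h2)] at hv
      exact (Submodule.Quotient.mk_eq_zero _).1 hv
    · rintro ⟨y, rfl⟩
      exact Subtype.ext (hPg y)

end Telescope

noncomputable section Small

variable {k : Type u} [Field k] {B : Type u} [Ring B] {M : Type u} [AddCommGroup M] [Module B M]

/-- A relation in a flat module can be trivialized. -/
theorem EqFlat.kill (h : EqFlat B M) (p : (ℕ →₀ B) →ₗ[B] M) (r : ℕ →₀ B) (hr : p r = 0) :
    ∃ (p' : (ℕ →₀ B) →ₗ[B] M) (φ : (ℕ →₀ B) →ₗ[B] (ℕ →₀ B)), (∀ x, p' (φ x) = p x) ∧ φ r = 0 := by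
  classical
  let c : ℕ → ℕ →₀ B := fun s => Finsupp.single 0 (r s)
  let x : ℕ →₀ M := Finsupp.onFinset r.support
    (fun s => if r s = 0 then 0 else p (Finsupp.single s 1)) (fun s hs => by
      rw [Finsupp.mem_support_iff]; intro h0; simp [h0] at hs)
  have hxs : ∀ s, x s = if r s = 0 then 0 else p (Finsupp.single s 1) := fun s => rfl
  have hp : ∀ v : ℕ →₀ B, p v = v.sum fun s b => b • p (Finsupp.single s 1) := fun v => by
    conv_lhs => rw [← v.sum_single]
    rw [Finsupp.sum, map_sum]
    refine Finset.sum_congr rfl fun s _ => ?_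
    dsimp only
    rw [← map_smul, Finsupp.smul_single, smul_eq_mul, mul_one]
  have hcx : colMap c M x = 0 := by
    ext i
    rw [colMap_apply, Finsupp.zero_apply]
    by_cases hi : i = 0
    · subst hi
      rw [Finsupp.sum_of_support_subset (s := r.support) _ Finsupp.support_onFinset_subset _
        (fun _ _ => smul_zero _)]
      refine Eq.trans (Finset.sum_congr rfl fun s hs => ?_) ((hp r).symm.trans hr)
      simp [c, Finsupp.mem_support_iff.1 hs]
    · refine Finset.sum_eq_zero fun s _ => ?_
      simp [c, Ne.symm hi]
  obtain ⟨c', hc', z, hz⟩ := h c x hcx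
  let e : ℕ ⊕ ℕ ≃ ℕ := Equiv.natSumNatEquivNat
  let φ : (ℕ →₀ B) →ₗ[B] (ℕ →₀ B) := Finsupp.linearCombination B fun s =>
    if r s = 0 then Finsupp.single (e (.inr s)) 1 else
      ∑ w ∈ z.support, c' w s • Finsupp.single (e (.inl w)) (1 : B)
  let p' : (ℕ →₀ B) →ₗ[B] M := Finsupp.linearCombination B fun t =>
    Sum.elim z (fun s => p (Finsupp.single s 1)) (e.symm t)
  refine ⟨p', φ, fun v => ?_, ?_⟩
  · have : p' ∘ₗ φ = p := by
      refine Finsupp.lhom_ext' fun s => LinearMap.ext_ring ?_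
      simp only [LinearMap.comp_apply, Finsupp.lsingle_apply, φ, Finsupp.linearCombination_single,
        one_smul]
      split_ifs with h0
      · simp [p']
      · rw [map_sum]
        have h1 : x s = p (Finsupp.single s 1) := by rw [hxs, if_neg h0]
        rw [← h1, ← hz, colMap_apply]
        refine Finset.sum_congr rfl fun w _ => ?_
        simp [p']
    exact LinearMap.congr_fun this v
  · have h1 : ∀ w, ∑ s ∈ r.support, r s * c' w s = 0 := fun w => by
      have := DFunLike.congr_fun (hc' w) 0
      rw [colMap_apply, Finsupp.zero_apply] at this
      simp only [c, Finsupp.single_eq_same, smul_eq_mul] at this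
      rw [← this, Finsupp.sum]
      refine Finset.sum_congr_of_eq_on_inter ?_ ?_ fun _ _ _ => rfl
      · intro s _ hs; simp [Finsupp.notMem_support_iff.1 hs]
      · intro s _ hs; simp [Finsupp.notMem_support_iff.1 hs]
    have h2 : φ r = ∑ s ∈ r.support, r s • ∑ w ∈ z.support,
        c' w s • Finsupp.single (e (.inl w)) (1 : B) := by
      simp only [φ, Finsupp.linearCombination_apply, Finsupp.sum]
      refine Finset.sum_congr rfl fun s hs => ?_
      rw [if_neg (Finsupp.mem_support_iff.1 hs)]
    rw [h2]
    simp only [Finset.smul_sum, smul_smul]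
    rw [Finset.sum_comm]
    refine Finset.sum_eq_zero fun w _ => ?_
    rw [← Finset.sum_smul, h1, zero_smul]

theorem PD.map_subtype {n : ℕ} {L : Submodule B M} {Λ : Submodule B L} (h : PD B n Λ) :
    PD B n (Λ.map L.subtype) :=
  PD.of_equiv (A := Λ.map L.subtype) (B := Λ)
    (Submodule.equivMapOfInjective L.subtype L.injective_subtype Λ) h

variable [Algebra k B] (hB : CountSpan k (⊤ : Submodule k B))
include hB

theorem EqFlat.exists_small (h : EqFlat B M) (C : Set M) (hC : C.Countable) :
    ∃ Λ : Submodule B M, C ⊆ Λ ∧ PD B 1 Λ ∧ ∃ Z : Set M, Z.Countable ∧ Submodule.span B Z = Λ := by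
  classical
  have hker : ∀ p : (ℕ →₀ B) →ₗ[B] M, ∃ ρ : ℕ → ℕ →₀ B,
      Submodule.span k (Set.range ρ) = (LinearMap.ker p).restrictScalars k := fun p =>
    ((countSpan_nat hB).mono le_top).seq
  choose ρ hρ using hker
  have hρ0 : ∀ (p : (ℕ →₀ B) →ₗ[B] M) i, p (ρ p i) = 0 := fun p i => by
    have : ρ p i ∈ Submodule.span k (Set.range (ρ p)) := Submodule.subset_span ⟨i, rfl⟩
    rw [hρ] at this
    exact this
  choose p' φ hφ hφr using h.kill
  let St := {S : ((ℕ →₀ B) →ₗ[B] M) × (ℕ → ℕ → (ℕ →₀ B)) // ∀ a b, S.1 (S.2 a b) = 0}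
  let fs : ℕ → St → ((ℕ →₀ B) →ₗ[B] (ℕ →₀ B)) := fun j S => φ S.1.1 _ (S.2 j.unpair.1 j.unpair.2)
  let step : ℕ → St → St := fun j S =>
    ⟨(p' S.1.1 _ (S.2 j.unpair.1 j.unpair.2),
      fun a b => if a = j + 1 then ρ (p' S.1.1 _ (S.2 j.unpair.1 j.unpair.2)) b
        else fs j S (S.1.2 a b)), fun a b => by
      dsimp only
      split_ifs
      · exact hρ0 _ _
      · rw [hφ, S.2]⟩
  obtain ⟨w, hw⟩ := (hC.insert (0 : M)).exists_eq_range ⟨0, by simp⟩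
  let p0 : (ℕ →₀ B) →ₗ[B] M := Finsupp.linearCombination B w
  let S : ℕ → St := fun j => Nat.rec ⟨(p0, fun _ b => ρ p0 b), fun _ _ => hρ0 _ _⟩ step j
  have hS : ∀ j, S (j + 1) = step j (S j) := fun j => rfl
  let p : ℕ → (ℕ →₀ B) →ₗ[B] M := fun j => (S j).1.1
  let f : ℕ → (ℕ →₀ B) →ₗ[B] (ℕ →₀ B) := fun j => fs j (S j)
  have hf0 : ∀ j, f j ((S j).1.2 j.unpair.1 j.unpair.2) = 0 := fun j => hφr _ _ _
  have hfq : ∀ j a b, a ≤ j → (S (j + 1)).1.2 a b = f j ((S j).1.2 a b) := fun j a b hab =>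
    if_neg (by lia)
  have hqj : ∀ j b, (S j).1.2 j b = ρ (p j) b := fun j b => by
    cases j with
    | zero => rfl
    | succ j => exact if_pos rfl
  have hdq : ∀ t j a b, a ≤ j → j + t = Nat.pair a b →
      Dies (F := fun _ => ℕ →₀ B) f j ((S j).1.2 a b) := by
    intro t
    induction t with
    | zero =>
      intro j a b haj hj
      refine .step _ _ ?_
      have := hf0 j
      rw [← add_zero j, hj, Nat.unpair_pair, ← hj, add_zero] at this
      rw [this]
      exact .zero _
    | succ t ih =>
      intro j a b haj hj
      refine .step _ _ ?_
      rw [← hfq j a b haj]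
      exact ih (j + 1) a b (by lia) (by lia)
  have hd : ∀ j x, p j x = 0 → Dies (F := fun _ => ℕ →₀ B) f j x := by
    intro j x hx
    have hx' : x ∈ (LinearMap.ker (p j)).restrictScalars k := hx
    rw [← hρ] at hx'
    clear hx
    induction hx' using Submodule.span_induction with
    | mem x h =>
      obtain ⟨b, rfl⟩ := h
      rw [← hqj]
      obtain ⟨t, ht⟩ := Nat.exists_eq_add_of_le (Nat.left_le_pair j b)
      exact hdq t j j b le_rfl ht.symm
    | zero => exact .zero _
    | add x y _ _ h1 h2 => exact h1.add h2
    | smul a x _ h1 => rw [← algebraMap_smul B a x]; exact h1.smul _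
  refine ⟨⨆ i, LinearMap.range (p i), ?_, pd_telescope (F := fun _ => ℕ →₀ B) (f := f) p
    (fun i x => hφ _ _ _ x) hd (fun i => PD.of_projective inferInstance 0) _ rfl, ?_⟩
  · intro x hx
    have : x ∈ Set.range w := hw ▸ Set.mem_insert_of_mem _ hx
    obtain ⟨i, rfl⟩ := this
    refine Submodule.mem_iSup_of_mem 0 ⟨Finsupp.single i 1, ?_⟩
    exact (Finsupp.linearCombination_single B _ _).trans (one_smul _ _)
  · refine ⟨⋃ i, Set.range fun j => p i (Finsupp.single j 1),
      Set.countable_iUnion fun i => Set.countable_range _, ?_⟩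
    rw [Submodule.span_iUnion]
    refine iSup_congr fun i => ?_
    have : p i = Finsupp.linearCombination B (fun j => p i (Finsupp.single j 1)) :=
      Finsupp.lhom_ext' fun s => LinearMap.ext_ring (by simp)
    conv_rhs => rw [this]
    exact (Finsupp.range_linearCombination B).symm

theorem TV.exists_small (m : ℕ) : ∀ (M : Type u) [AddCommGroup M] [Module B M], TV B m M →
    ∀ C : Set M, C.Countable → ∃ Λ : Submodule B M, C ⊆ Λ ∧ PD B (2 * m + 1) Λ ∧
      ∃ Z : Set M, Z.Countable ∧ Submodule.span B Z = Λ := by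
  classical
  induction m with
  | zero => intro M _ _ h C hC; exact (h.eqFlat hB).exists_small hB C hC
  | succ m ih =>
    intro M _ _ h C hC
    let p : (M →₀ B) →ₗ[B] M := Finsupp.linearCombination B id
    have hp : Function.Surjective p := fun x => ⟨Finsupp.single x 1, by simp [p]⟩
    let L := LinearMap.ker p
    have hL : TV B m L := h.syzygy p hp
    have key : ∀ Y : Set M, Y.Countable → ∃ (Λ : Submodule B (M →₀ B)) (Y' : Set M), Y'.Countable ∧
        Y ⊆ Y' ∧ L ⊓ Finsupp.supported B B Y ≤ Λ ∧ Λ ≤ L ⊓ Finsupp.supported B B Y' ∧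
        PD B (2 * m + 1) Λ := by
      intro Y hY
      obtain ⟨s, hs, hspan⟩ := (countSpan_supported hB hY).mono
        (W' := (L ⊓ Finsupp.supported B B Y).restrictScalars k) (fun x hx => hx.2)
      obtain ⟨Λ, h1, h2, Z, hZ, h3⟩ := ih L hL (L.subtype ⁻¹' s)
        (hs.preimage L.injective_subtype)
      refine ⟨Λ.map L.subtype, Y ∪ ⋃ z ∈ Z, (z.1.support : Set M),
        hY.union (hZ.biUnion fun z _ => z.1.support.countable_toSet), Set.subset_union_left,
        ?_, ?_, ?_⟩
      · have hle : Submodule.span k s ≤ (Λ.map L.subtype).restrictScalars k := by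
          rw [Submodule.span_le]
          intro x hx
          have hx' : x ∈ (L ⊓ Finsupp.supported B B Y).restrictScalars k :=
            hspan ▸ Submodule.subset_span hx
          exact ⟨⟨x, hx'.1⟩, h1 hx, rfl⟩
        rw [hspan] at hle
        exact hle
      · rw [← h3, Submodule.map_span, Submodule.span_le]
        rintro _ ⟨z, hz, rfl⟩
        refine ⟨z.2, (Finsupp.mem_supported _ _).2 ?_⟩
        exact (Set.subset_biUnion_of_mem (u := fun z : L => (z.1.support : Set M)) hz).trans
          Set.subset_union_right
      · exact h2.map_subtype
    choose! Λ Y' hY' hYY' h1 h2 h3 using key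
    let Y : ℕ → Set M := fun j => Nat.rec C (fun _ Y => Y' Y) j
    have hYc : ∀ j, (Y j).Countable := fun j => by
      induction j with
      | zero => exact hC
      | succ j ih => exact hY' _ ih
    have hle : ∀ j, Λ (Y j) ≤ Λ (Y (j + 1)) := fun j =>
      (h2 _ (hYc j)).trans (h1 _ (hYc (j + 1)))
    have hYm : Monotone Y := monotone_nat_of_le_succ fun j => hYY' _ (hYc j)
    let U : Set M := ⋃ j, Y j
    have hLU : L ⊓ Finsupp.supported B B U = ⨆ j, Λ (Y j) := by
      refine le_antisymm ?_ (iSup_le fun j => (h2 _ (hYc j)).trans ?_)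
      · rintro x ⟨hx, hxU⟩
        have hxs : (x.support : Set M) ⊆ ⋃ j, Y j := (Finsupp.mem_supported _ _).1 hxU
        obtain ⟨j, hj⟩ := hYm.directed_le.exists_mem_subset_of_finset_subset_biUnion hxs
        exact Submodule.mem_iSup_of_mem j (h1 _ (hYc j) ⟨hx, (Finsupp.mem_supported _ _).2 hj⟩)
      · exact inf_le_inf_left _ (Finsupp.supported_mono (Set.subset_iUnion Y (j + 1)))
    have hpdL : PD B (2 * m + 1 + 1) (L ⊓ Finsupp.supported B B U : Submodule B (M →₀ B)) := by
      refine pd_telescope (F := fun j => Λ (Y j)) (f := fun j => Submodule.inclusion (hle j))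
        (fun j => (Λ (Y j)).subtype) (fun i x => rfl) ?_ (fun j => h3 _ (hYc j)) _ ?_
      · intro i x hx
        have : x = 0 := Subtype.ext hx
        rw [this]; exact .zero _
      · simp only [Submodule.range_subtype]; exact hLU
    have hproj : Module.Projective B (Finsupp.supported B B U) :=
      .of_equiv (Finsupp.supportedEquivFinsupp U).symm
    refine ⟨(Finsupp.supported B B U).map p, ?_, ?_, U, Set.countable_iUnion hYc, ?_⟩
    · intro x hx
      exact ⟨Finsupp.single x 1, Finsupp.single_mem_supported B 1 (Set.mem_iUnion.2 ⟨0, hx⟩),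
        by simp [p]⟩
    · refine PD.quot (f := Submodule.inclusion (inf_le_right : L ⊓ Finsupp.supported B B U ≤ _))
        (g := p.submoduleMap (Finsupp.supported B B U)) (Submodule.inclusion_injective _) ?_
        (p.submoduleMap_surjective _) hpdL (PD.of_projective (A := Finsupp.supported B B U) hproj _)
      intro x
      constructor
      · intro hx
        exact ⟨⟨x, congrArg Subtype.val hx, x.2⟩, rfl⟩
      · rintro ⟨y, rfl⟩
        exact Subtype.ext y.2.1
    · rw [Finsupp.supported_eq_span_single, Submodule.map_span, ← Set.image_comp]
      congr 1
      ext x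
      simp [p]

end Small

noncomputable section Conclude

variable {k : Type u} [Field k] {B : Type u} [Ring B] [HopfAlgebra k B]

theorem pd_injective_of_tv (hB : CountSpan k (⊤ : Submodule k B)) {n : ℕ}
    {J : Type u} [AddCommGroup J] [Module k J] [Module B J] [IsScalarTower k B J] (hJ : TV B n J)
    (lam : J) (h0 : lam ≠ 0)
    (hlam : ∀ b : B, b • lam = Coalgebra.counit (R := k) b • lam)
    {I : Type u} [AddCommGroup I] [Module k I] [Module B I] [IsScalarTower k B I]
    (hI : Module.Injective B I) : PD B (2 * n + 1) I := by
  obtain ⟨Λ, h1, h2, -⟩ := hJ.exists_small hB n J {lam} (Set.countable_singleton _)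
  have hmem : lam ∈ Λ := h1 rfl
  let l : Λ := ⟨lam, hmem⟩
  have hl : ∀ b : B, b • l = Coalgebra.counit (R := k) b • l := fun b => Subtype.ext (hlam b)
  have hl0 : l ≠ 0 := fun h => h0 (congrArg Subtype.val h)
  obtain ⟨r, hr⟩ := hI.out (lamMap l hl I) (lamMap_injective l hl hl0) LinearMap.id
  exact PD.of_retract (lamMap l hl I) r hr (PD.diag _ h2)

end Conclude

noncomputable section Slices

variable {k : Type u} [Field k] {A V : Type*} [AddCommGroup A] [Module k A] [AddCommGroup V]
  [Module k V]

theorem tensor_eq_zero_of_right_slices (w : A ⊗[k] V)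
    (h : ∀ f : Module.Dual k V, TensorProduct.rid k A (LinearMap.lTensor A f w) = 0) : w = 0 := by
  classical
  let b := Module.Basis.ofVectorSpace k V
  apply (TensorProduct.equivFinsuppOfBasisRight (M := A) b).injective
  rw [map_zero]
  ext i
  have h2 := h (b.coord i)
  have h3 : ∀ w : A ⊗[k] V, TensorProduct.equivFinsuppOfBasisRight (M := A) b w i =
      TensorProduct.rid k A (LinearMap.lTensor A (b.coord i) w) := by
    intro w
    induction w with
    | zero => simp
    | add x y hx hy => simp only [map_add, Finsupp.add_apply, hx, hy]
    | tmul x y => simp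
  rw [h3, h2]
  rfl

theorem tensor_eq_zero_of_left_slices (w : A ⊗[k] V)
    (h : ∀ f : Module.Dual k A, TensorProduct.lid k V (LinearMap.rTensor V f w) = 0) : w = 0 := by
  classical
  let b := Module.Basis.ofVectorSpace k A
  apply (TensorProduct.equivFinsuppOfBasisLeft (N := V) b).injective
  rw [map_zero]
  ext i
  have h2 := h (b.coord i)
  have h3 : ∀ w : A ⊗[k] V, TensorProduct.equivFinsuppOfBasisLeft (N := V) b w i =
      TensorProduct.lid k V (LinearMap.rTensor V (b.coord i) w) := by
    intro w
    induction w with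
    | zero => simp
    | add x y hx hy => simp only [map_add, Finsupp.add_apply, hx, hy]
    | tmul x y => simp
  rw [h3, h2]
  rfl

theorem mem_range_lTensor {U : Type*} [AddCommGroup U] [Module k U] (γ : U →ₗ[k] V)
    (w : A ⊗[k] V)
    (h : ∀ f : Module.Dual k A, TensorProduct.lid k V (LinearMap.rTensor V f w) ∈
      LinearMap.range γ) : ∃ t, LinearMap.lTensor A γ t = w := by
  have hex := lTensor_exact A (LinearMap.exact_map_mkQ_range γ) (Submodule.mkQ_surjective _)
  apply (hex w).1
  apply tensor_eq_zero_of_left_slices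
  intro f
  have h3 : ∀ w : A ⊗[k] V, TensorProduct.lid k _ (LinearMap.rTensor _ f
      (LinearMap.lTensor A (LinearMap.range γ).mkQ w)) = (LinearMap.range γ).mkQ
        (TensorProduct.lid k V (LinearMap.rTensor V f w)) := by
    intro w
    induction w with
    | zero => simp
    | add x y hx hy => simp only [map_add, hx, hy]
    | tmul x y => simp
  rw [h3, Submodule.mkQ_apply, Submodule.Quotient.mk_eq_zero]
  exact h f

theorem mem_range_rTensor {U : Type*} [AddCommGroup U] [Module k U] (γ : U →ₗ[k] A)
    (w : A ⊗[k] V)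
    (h : ∀ f : Module.Dual k V, TensorProduct.rid k A (LinearMap.lTensor A f w) ∈
      LinearMap.range γ) : ∃ t, LinearMap.rTensor V γ t = w := by
  have hex := rTensor_exact V (LinearMap.exact_map_mkQ_range γ) (Submodule.mkQ_surjective _)
  apply (hex w).1
  apply tensor_eq_zero_of_right_slices
  intro f
  have h3 : ∀ w : A ⊗[k] V, TensorProduct.rid k _ (LinearMap.lTensor _ f
      (LinearMap.rTensor V (LinearMap.range γ).mkQ w)) = (LinearMap.range γ).mkQ
        (TensorProduct.rid k A (LinearMap.lTensor A f w)) := by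
    intro w
    induction w with
    | zero => simp
    | add x y hx hy => simp only [map_add, hx, hy]
    | tmul x y => simp
  rw [h3, Submodule.mkQ_apply, Submodule.Quotient.mk_eq_zero]
  exact h f

theorem mem_range_map (C : Submodule k V) (w : V ⊗[k] V)
    (h1 : ∀ f : Module.Dual k V, TensorProduct.rid k V (LinearMap.lTensor V f w) ∈ C)
    (h2 : ∀ f : Module.Dual k V, TensorProduct.lid k V (LinearMap.rTensor V f w) ∈ C) :
    w ∈ LinearMap.range (TensorProduct.map C.subtype C.subtype) := by
  obtain ⟨t, rfl⟩ := mem_range_rTensor C.subtype w (by simpa using h1)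
  obtain ⟨t', rfl⟩ := mem_range_lTensor (A := C) (V := V) C.subtype t (by
    intro f
    obtain ⟨f', hf'⟩ := f.exists_extend
    have := h2 f'
    rw [Submodule.range_subtype]
    convert this using 2
    rw [← hf', LinearMap.rTensor_comp]
    rfl)
  exact ⟨t', by rw [← LinearMap.rTensor_comp_lTensor]; rfl⟩

end Slices

noncomputable section Operators

variable {k : Type u} [Field k] {H : Type u} [Ring H] [HopfAlgebra k H]

/-- The operator `h ↦ ∑ f(h₂) h₁`. -/
def rOp (k : Type u) [Field k] (H : Type u) [Ring H] [HopfAlgebra k H] :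
    Module.Dual k H →ₗ[k] Module.End k H where
  toFun f := (TensorProduct.rid k H).toLinearMap ∘ₗ LinearMap.lTensor H f ∘ₗ comul
  map_add' f g := by
    ext x; simp [LinearMap.lTensor_add]
  map_smul' c f := by
    ext x; simp [LinearMap.lTensor_smul]

/-- The operator `h ↦ ∑ f(h₁) h₂`. -/
def lOp (k : Type u) [Field k] (H : Type u) [Ring H] [HopfAlgebra k H] :
    Module.Dual k H →ₗ[k] Module.End k H where
  toFun f := (TensorProduct.lid k H).toLinearMap ∘ₗ LinearMap.rTensor H f ∘ₗ comul
  map_add' f g := by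
    ext x; simp [LinearMap.rTensor_add]
  map_smul' c f := by
    ext x; simp [LinearMap.rTensor_smul]

theorem rOp_eq (f : Module.Dual k H) (h : H) :
    rOp k H f h = TensorProduct.rid k H (LinearMap.lTensor H f (comul h)) := rfl

theorem lOp_eq (f : Module.Dual k H) (h : H) :
    lOp k H f h = TensorProduct.lid k H (LinearMap.rTensor H f (comul h)) := rfl

theorem rOp_apply (f : Module.Dual k H) (h : H) :
    rOp k H f h = sw k (fun x y => f y • x) h := by
  rw [rOp_eq]
  conv_lhs => rw [← (ℛ k h).eq]
  simp [sw]

theorem lOp_apply (f : Module.Dual k H) (h : H) :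
    lOp k H f h = sw k (fun x y => f x • y) h := by
  rw [lOp_eq]
  conv_lhs => rw [← (ℛ k h).eq]
  simp [sw]

theorem apply_lOp (f ξ : Module.Dual k H) (h : H) : f (lOp k H ξ h) = ξ (rOp k H f h) := by
  rw [lOp_apply, rOp_apply, map_sw, map_sw]
  exact sw_congr _ fun x y => by simp [mul_comm]

theorem rOp_counit : rOp k H counit = 1 := by
  ext h
  rw [rOp_apply]
  exact sw_counit_right LinearMap.id h

theorem lOp_counit : lOp k H counit = 1 := by
  ext h
  rw [lOp_apply]
  exact sw_counit_left LinearMap.id h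

theorem counit_lOp (ξ : Module.Dual k H) (h : H) : counit (R := k) (lOp k H ξ h) = ξ h := by
  rw [apply_lOp, rOp_counit]; rfl

/-- The convolution product of two functionals. -/
def convDual (f g : Module.Dual k H) : Module.Dual k H :=
  LinearMap.mul' k k ∘ₗ TensorProduct.map f g ∘ₗ comul

theorem convDual_apply (f g : Module.Dual k H) (h : H) :
    convDual f g h = sw k (fun x y => f x * g y) h := by
  simp only [convDual, LinearMap.comp_apply]
  conv_lhs => rw [← (ℛ k h).eq]
  simp [sw]

theorem dual_ext {V : Type*} [AddCommGroup V] [Module k V] {x y : V}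
    (h : ∀ f : Module.Dual k V, f x = f y) : x = y := by
  rw [← sub_eq_zero, ← Module.forall_dual_apply_eq_zero_iff k]
  intro f
  rw [map_sub, h, sub_self]

/-- Coassociativity, tested by a linear map on the triple tensor power. -/
theorem sw_coassoc' {W : Type*} [AddCommGroup W] [Module k W] (φ : H ⊗[k] (H ⊗[k] H) →ₗ[k] W)
    (a : H) : sw k (fun x y => sw k (fun x₁ x₂ => φ (x₁ ⊗ₜ (x₂ ⊗ₜ y))) x) a =
      sw k (fun x y => sw k (fun y₁ y₂ => φ (x ⊗ₜ (y₁ ⊗ₜ y₂))) y) a :=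
  by
  have h := congrArg φ (Coalgebra.sum_tmul_tmul_eq (ℛ k a) (fun i => ℛ k ((ℛ k a).left i))
    (fun i => ℛ k ((ℛ k a).right i)))
  simp only [map_sum] at h
  exact h

theorem rOp_mul (f g : Module.Dual k H) : rOp k H f * rOp k H g = rOp k H (convDual f g) := by
  ext h
  rw [Module.End.mul_apply, rOp_apply g, map_sw, rOp_apply]
  have := sw_coassoc' ((TensorProduct.rid k H).toLinearMap ∘ₗ
    LinearMap.lTensor H (LinearMap.mul' k k ∘ₗ TensorProduct.map f g)) h
  simp only [LinearMap.comp_apply, LinearMap.lTensor_tmul, TensorProduct.map_tmul,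
    LinearMap.mul'_apply, LinearEquiv.coe_coe, TensorProduct.rid_tmul] at this
  refine Eq.trans (sw_congr _ fun x y => ?_) (this.trans (sw_congr _ fun x y => ?_))
  · rw [map_smul, rOp_apply, smul_sw]
    exact sw_congr _ fun _ _ => by rw [smul_smul, mul_comm]
  · rw [convDual_apply]
    exact (Finset.sum_smul).symm

theorem rOp_lOp (f g : Module.Dual k H) (h : H) :
    rOp k H f (lOp k H g h) = lOp k H g (rOp k H f h) := by
  rw [rOp_apply f h, lOp_apply g h, map_sw, map_sw]
  have := sw_coassoc' ((TensorProduct.lid k H).toLinearMap ∘ₗ TensorProduct.map g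
    ((TensorProduct.rid k H).toLinearMap ∘ₗ LinearMap.lTensor H f)) h
  simp only [LinearMap.comp_apply, LinearMap.lTensor_tmul, TensorProduct.map_tmul,
    LinearEquiv.coe_coe, TensorProduct.rid_tmul, TensorProduct.lid_tmul] at this
  refine Eq.trans (sw_congr _ fun x y => ?_) (this.symm.trans (sw_congr _ fun x y => ?_))
  · rw [map_smul, rOp_apply, smul_sw]
  · rw [map_smul, lOp_apply, smul_sw]
    exact sw_congr _ fun _ _ => smul_comm _ _ _

/-- The algebra of operators `rOp f`. -/
def rAlg (k : Type u) [Field k] (H : Type u) [Ring H] [HopfAlgebra k H] :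
    Subalgebra k (Module.End k H) where
  carrier := Set.range (rOp k H)
  mul_mem' := by
    rintro _ _ ⟨f, rfl⟩ ⟨g, rfl⟩
    exact ⟨_, (rOp_mul f g).symm⟩
  add_mem' := by
    rintro _ _ ⟨f, rfl⟩ ⟨g, rfl⟩
    exact ⟨f + g, map_add _ _ _⟩
  algebraMap_mem' c := ⟨c • counit, by rw [map_smul, rOp_counit, Algebra.algebraMap_eq_smul_one]⟩

/-- The ring of operators `rOp f`. -/
def ROp (k : Type u) [Field k] (H : Type u) [Ring H] [HopfAlgebra k H] : Type u := rAlg k H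

instance : Ring (ROp k H) := inferInstanceAs (Ring (rAlg k H))

instance : Algebra k (ROp k H) := inferInstanceAs (Algebra k (rAlg k H))

instance : Module (ROp k H) H := inferInstanceAs (Module (rAlg k H) H)

instance : IsScalarTower k (ROp k H) H := inferInstanceAs (IsScalarTower k (rAlg k H) H)

/-- The operator `rOp f` as an element of `ROp`. -/
def ROp.mk (f : Module.Dual k H) : ROp k H := (⟨rOp k H f, f, rfl⟩ : rAlg k H)

theorem ROp.exists_mk (a : ROp k H) : ∃ f, a = ROp.mk f := by
  obtain ⟨f, hf⟩ := (a : rAlg k H).2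
  exact ⟨f, Subtype.ext hf.symm⟩

theorem ROp.mk_smul (f : Module.Dual k H) (h : H) : ROp.mk f • h = rOp k H f h := rfl

theorem rOp_smul_mem {N : Submodule (ROp k H) H} (f : Module.Dual k H) {h : H} (hh : h ∈ N) :
    rOp k H f h ∈ N :=
  N.smul_mem (ROp.mk f) hh

/-- A subspace stable under the operators `rOp`, as a module. -/
def rSub (C : Submodule k H) (hC : ∀ f, ∀ x ∈ C, rOp k H f x ∈ C) : Submodule (ROp k H) H where
  carrier := C
  zero_mem' := C.zero_mem
  add_mem' := C.add_mem
  smul_mem' := by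
    intro a x hx
    obtain ⟨f, rfl⟩ := a.exists_mk
    exact hC f x hx

theorem isSubcoalgebra_of_stable (C : Submodule k H) (h1 : ∀ f, ∀ x ∈ C, rOp k H f x ∈ C)
    (h2 : ∀ f, ∀ x ∈ C, lOp k H f x ∈ C) {x : H} (hx : x ∈ C) :
    comul (R := k) x ∈ LinearMap.range (TensorProduct.map C.subtype C.subtype) :=
  mem_range_map C _ (fun f => h1 f x hx) (fun f => h2 f x hx)

theorem stable_of_isSubcoalgebra (C : Submodule k H)
    (h : ∀ x ∈ C, comul (R := k) x ∈ LinearMap.range (TensorProduct.map C.subtype C.subtype))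
    (f : Module.Dual k H) {x : H} (hx : x ∈ C) : rOp k H f x ∈ C ∧ lOp k H f x ∈ C := by
  rw [rOp_eq, lOp_eq]
  obtain ⟨t, ht⟩ := h x hx
  rw [← ht]
  clear ht
  induction t with
  | zero => simp
  | add a b ha hb =>
    simp only [map_add]
    exact ⟨C.add_mem ha.1 hb.1, C.add_mem ha.2 hb.2⟩
  | tmul a b =>
    simp only [TensorProduct.map_tmul, LinearMap.lTensor_tmul, LinearMap.rTensor_tmul,
      TensorProduct.rid_tmul, TensorProduct.lid_tmul]
    exact ⟨C.smul_mem _ a.2, C.smul_mem _ b.2⟩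

theorem exists_finite_rOp (h : H) : ∃ W : Submodule k H, Module.Finite k W ∧
    ∀ f, rOp k H f h ∈ W := by
  classical
  refine ⟨Submodule.span k ((ℛ k h).index.image (ℛ k h).left : Finset H),
    Module.Finite.span_finset k _, fun f => ?_⟩
  rw [rOp_apply]
  refine Submodule.sum_mem _ fun i hi => Submodule.smul_mem _ _ (Submodule.subset_span ?_)
  exact Finset.mem_coe.2 (Finset.mem_image_of_mem _ hi)

end Operators

noncomputable section FlatStep

variable {k : Type u} [Field k] {H : Type u} [Ring H] [HopfAlgebra k H] {B : Type u} [Ring B]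
  [HopfAlgebra k B] (ι : B →ₐ[k] H)

/-- The equational criterion of flatness for vectors with entries in `N`. -/
def RelOn (N : Submodule k H) : Prop :=
  ∀ (r q : ℕ) (a : Fin r → Fin q → B) (h : Fin r → H), (∀ s, h s ∈ N) →
    (∀ y, ∑ s, h s * ι (a s y) = 0) →
    ∃ (T : Type u) (_ : Fintype T) (b : T → Fin r → B) (w : T → H),
      (∀ s, h s = ∑ j, w j * ι (b j s)) ∧ ∀ j y, ∑ s, b j s * a s y = 0

variable (N : Submodule k H) (hN : ∀ h ∈ N, ∀ b, h * ι b ∈ N)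

/-- Right multiplication by `B` on `H ⧸ N`. -/
def rAct : B →ₗ[k] (H ⧸ N) →ₗ[k] (H ⧸ N) where
  toFun b := N.mapQ N (LinearMap.mulRight k (ι b)) fun h hh => hN h hh b
  map_add' b b' := by
    ext x
    exact congrArg N.mkQ (by simp [mul_add])
  map_smul' c b := by
    ext x
    exact congrArg N.mkQ (by simp)

theorem rAct_mk (b : B) (h : H) : rAct ι N hN b (N.mkQ h) = N.mkQ (h * ι b) := rfl

theorem rAct_mul (b b' : B) (m : H ⧸ N) :
    rAct ι N hN (b * b') m = rAct ι N hN b' (rAct ι N hN b m) := by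
  obtain ⟨h, rfl⟩ := N.mkQ_surjective m
  simp only [rAct_mk, map_mul, mul_assoc]

theorem rAct_one (m : H ⧸ N) : rAct ι N hN 1 m = m := by
  obtain ⟨h, rfl⟩ := N.mkQ_surjective m
  simp only [rAct_mk, map_one, mul_one]

/-- Right multiplication by `Δ(a)` on `(H ⧸ N) ⊗ B`. -/
def comulAct (a : B) : (H ⧸ N) ⊗[k] B →ₗ[k] (H ⧸ N) ⊗[k] B :=
  sw k (fun x y => TensorProduct.map (rAct ι N hN x) (LinearMap.mulRight k y)) a

theorem comulAct_tmul (a : B) (m : H ⧸ N) (b : B) : comulAct ι N hN a (m ⊗ₜ b) =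
    sw k (fun x y => rAct ι N hN x m ⊗ₜ[k] (b * y)) a := by
  simp [comulAct, sw, LinearMap.sum_apply]

/-- The straightening map `m ⊗ b ↦ ∑ m S(b₁) ⊗ b₂`. -/
def straighten : (H ⧸ N) ⊗[k] B →ₗ[k] (H ⧸ N) ⊗[k] B :=
  lift (LinearMap.lcomp k _ comul ∘ₗ LinearMap.rTensorHom B ∘ₗ
    LinearMap.lcomp k _ (antipode k (A := B)) ∘ₗ (rAct ι N hN).flip)

theorem straighten_tmul (m : H ⧸ N) (b : B) : straighten ι N hN (m ⊗ₜ b) =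
    sw k (fun x y => rAct ι N hN (antipode k x) m ⊗ₜ[k] y) b := by
  change LinearMap.rTensor B ((rAct ι N hN).flip m ∘ₗ antipode k) (comul b) = _
  conv_lhs => rw [← (ℛ k b).eq]
  simp [sw]

/-- The action map `(H ⧸ N) ⊗ B → H ⧸ N`. -/
def actMap : (H ⧸ N) ⊗[k] B →ₗ[k] (H ⧸ N) := lift (rAct ι N hN).flip

theorem actMap_tmul (m : H ⧸ N) (b : B) : actMap ι N hN (m ⊗ₜ b) = rAct ι N hN b m := rfl

theorem actMap_straighten (t : (H ⧸ N) ⊗[k] B) : actMap ι N hN (straighten ι N hN t) =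
    TensorProduct.rid k _ (LinearMap.lTensor _ counit t) := by
  induction t with
  | zero => simp
  | add x y hx hy => simp only [map_add, hx, hy]
  | tmul m b =>
    rw [straighten_tmul, map_sw]
    simp only [actMap_tmul, ← rAct_mul]
    have := congrArg (fun z => rAct ι N hN z m) (sw_antipode_mul (k := k) b)
    simp only [map_smul, LinearMap.smul_apply, rAct_one] at this
    rw [LinearMap.lTensor_tmul, TensorProduct.rid_tmul, ← this]
    exact (map_sw (((rAct ι N hN).flip m)) _ _).symm

theorem straighten_comulAct (a : B) (t : (H ⧸ N) ⊗[k] B) :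
    straighten ι N hN (comulAct ι N hN a t) =
      LinearMap.lTensor _ (LinearMap.mulRight k a) (straighten ι N hN t) := by
  induction t with
  | zero => simp
  | add x y hx hy => simp only [map_add, hx, hy]
  | tmul m b =>
    rw [straighten_tmul, comulAct_tmul, map_sw, map_sw]
    simp only [straighten_tmul, LinearMap.lTensor_tmul, LinearMap.mulRight_apply, ← rAct_mul]
    have h1 : ∀ x y : B, sw k (fun p q => rAct ι N hN (x * antipode k p) m ⊗ₜ[k] q) (b * y) =
        sw k (fun b₁ b₂ => sw k (fun y₁ y₂ =>
          rAct ι N hN (x * antipode k y₁ * antipode k b₁) m ⊗ₜ[k] (b₂ * y₂)) y) b := by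
      intro x y
      let β : B →ₗ[k] B →ₗ[k] (H ⧸ N) ⊗[k] B := (TensorProduct.mk k (H ⧸ N) B) ∘ₗ
        (rAct ι N hN).flip m ∘ₗ LinearMap.mulLeft k x ∘ₗ antipode k
      have hβ : ∀ p q, β p q = rAct ι N hN (x * antipode k p) m ⊗ₜ[k] q := fun p q => rfl
      have := sw_mul β b y
      simp only [hβ, antipode_mul_antidistrib, ← mul_assoc] at this
      exact this
    simp only [h1]
    have h2 : ∀ b₁ b₂ : B, sw k (fun x y => sw k (fun y₁ y₂ =>
        rAct ι N hN (x * antipode k y₁ * antipode k b₁) m ⊗ₜ[k] (b₂ * y₂)) y) a =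
        rAct ι N hN (antipode k b₁) m ⊗ₜ[k] (b₂ * a) := by
      intro b₁ b₂
      let φ : B ⊗[k] B →ₗ[k] (H ⧸ N) ⊗[k] B := TensorProduct.map
        ((rAct ι N hN).flip m ∘ₗ LinearMap.mulRight k (antipode k b₁)) (LinearMap.mulLeft k b₂)
      have := sw_coassoc' (φ ∘ₗ LinearMap.rTensor B (LinearMap.mul' k B) ∘ₗ
        LinearMap.rTensor B (LinearMap.lTensor B (antipode k)) ∘ₗ
        (TensorProduct.assoc k B B B).symm.toLinearMap) a
      simp only [LinearMap.comp_apply, LinearEquiv.coe_coe, TensorProduct.assoc_symm_tmul,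
        LinearMap.rTensor_tmul, LinearMap.lTensor_tmul, LinearMap.mul'_apply] at this
      refine this.symm.trans ?_
      have h3 : ∀ x y : B, sw k (fun p q => φ ((p * antipode k q) ⊗ₜ y)) x =
          counit (R := k) x • φ (1 ⊗ₜ y) := by
        intro x y
        rw [← map_smul, smul_tmul', ← sw_mul_antipode]
        exact (map_sw (φ ∘ₗ (TensorProduct.mk k B B).flip y) _ _).symm
      simp only [h3]
      refine (sw_counit_left (φ ∘ₗ TensorProduct.mk k B B 1) a).trans ?_
      simp [φ]
    rw [show sw k (fun x y => sw k (fun b₁ b₂ => sw k (fun y₁ y₂ =>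
          rAct ι N hN (x * antipode k y₁ * antipode k b₁) m ⊗ₜ[k] (b₂ * y₂)) y) b) a =
        sw k (fun b₁ b₂ => sw k (fun x y => sw k (fun y₁ y₂ =>
          rAct ι N hN (x * antipode k y₁ * antipode k b₁) m ⊗ₜ[k] (b₂ * y₂)) y) a) b from
        Finset.sum_comm]
    exact sw_congr _ h2

variable (hcomul : ∀ b, comul (R := k) (ι b) =
  TensorProduct.map ι.toLinearMap ι.toLinearMap (comul (R := k) b))

include hcomul in
theorem lTensor_comulAct (g : H) (a : B) (t : (H ⧸ N) ⊗[k] B) (h : H)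
    (ht : LinearMap.lTensor _ (LinearMap.mulLeft k g ∘ₗ ι.toLinearMap) t =
      LinearMap.rTensor H N.mkQ (comul (R := k) h)) :
    LinearMap.lTensor _ (LinearMap.mulLeft k g ∘ₗ ι.toLinearMap) (comulAct ι N hN a t) =
      LinearMap.rTensor H N.mkQ (comul (R := k) (h * ι a)) := by
  let D : (H ⧸ N) ⊗[k] H →ₗ[k] (H ⧸ N) ⊗[k] H :=
    sw k (fun x y => TensorProduct.map (rAct ι N hN x) (LinearMap.mulRight k (ι y))) a
  have hD : ∀ m z, D (m ⊗ₜ z) = sw k (fun x y => rAct ι N hN x m ⊗ₜ[k] (z * ι y)) a := by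
    intro m z; simp [D, sw, LinearMap.sum_apply]
  have h1 : ∀ t, LinearMap.lTensor _ (LinearMap.mulLeft k g ∘ₗ ι.toLinearMap)
      (comulAct ι N hN a t) =
      D (LinearMap.lTensor _ (LinearMap.mulLeft k g ∘ₗ ι.toLinearMap) t) := by
    intro t
    induction t with
    | zero => simp
    | add x y hx hy => simp only [map_add, hx, hy]
    | tmul m b =>
      rw [comulAct_tmul, map_sw, LinearMap.lTensor_tmul, hD]
      exact sw_congr _ fun x y => by simp [mul_assoc]
  have h2 : ∀ z, D (LinearMap.rTensor H N.mkQ z) =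
      LinearMap.rTensor H N.mkQ (z * TensorProduct.map ι.toLinearMap ι.toLinearMap
        (comul (R := k) a)) := by
    intro z
    induction z with
    | zero => simp
    | add x y hx hy => simp only [map_add, hx, hy, add_mul]
    | tmul x y =>
      rw [LinearMap.rTensor_tmul, hD]
      conv_rhs => rw [← (ℛ k a).eq]
      simp only [map_sum, Finset.mul_sum, TensorProduct.map_tmul,
        Algebra.TensorProduct.tmul_mul_tmul, LinearMap.rTensor_tmul]
      rfl
  rw [h1, ht, h2, ← hcomul, ← Bialgebra.comul_mul]

include hN hcomul in
theorem RelOn.step (hcounit : ∀ b, counit (R := k) (ι b) = counit (R := k) b)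
    (hinj : Function.Injective ι) (g : H) (hg : ∀ x, g * x = 0 → x = 0)
    (hg1 : counit (R := k) g = 1) (hrel : RelOn ι N) (N' : Submodule k H)
    (hN' : ∀ h ∈ N', ∀ ξ : Module.Dual k H, (∀ x ∈ N, ξ x = 0) → ∃ b, lOp k H ξ h = g * ι b) :
    RelOn ι N' := by
  intro r q a h hmem hrel0
  let γ : B →ₗ[k] H := LinearMap.mulLeft k g ∘ₗ ι.toLinearMap
  have hγ : Function.Injective γ := by
    rw [injective_iff_map_eq_zero]
    intro b hb
    exact (injective_iff_map_eq_zero ι).1 hinj b (hg _ hb)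
  have hex : ∀ s, ∃ t, LinearMap.lTensor (H ⧸ N) γ t =
      LinearMap.rTensor H N.mkQ (comul (R := k) (h s)) := by
    intro s
    apply mem_range_lTensor
    intro f
    obtain ⟨b, hb⟩ := hN' _ (hmem s) (f ∘ₗ N.mkQ) (fun x hx => by
      rw [LinearMap.comp_apply, Submodule.mkQ_apply, (Submodule.Quotient.mk_eq_zero N).2 hx,
        map_zero])
    refine ⟨b, ?_⟩
    rw [lOp_eq, LinearMap.rTensor_comp] at hb
    exact hb.symm
  choose t ht using hex
  have h1 : ∀ y, ∑ s, comulAct ι N hN (a s y) (t s) = 0 := by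
    intro y
    apply Module.Flat.lTensor_preserves_injective_linearMap (M := H ⧸ N) γ hγ
    rw [map_zero, map_sum]
    simp only [γ, lTensor_comulAct ι N hN hcomul g _ _ _ (ht _)]
    rw [← map_sum, ← map_sum, hrel0, map_zero, map_zero]
  have h2 : ∀ y, ∑ s, LinearMap.lTensor _ (LinearMap.mulRight k (a s y))
      (straighten ι N hN (t s)) = 0 := by
    intro y
    simp only [← straighten_comulAct]
    rw [← map_sum, h1, map_zero]
  have h3 : ∀ s, N.mkQ (h s) = actMap ι N hN (straighten ι N hN (t s)) := by
    intro s
    rw [actMap_straighten]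
    have := congrArg (fun z => TensorProduct.rid k _ (LinearMap.lTensor (H ⧸ N) counit z)) (ht s)
    have e1 : LinearMap.lTensor (H ⧸ N) counit (LinearMap.lTensor (H ⧸ N) γ (t s)) =
        LinearMap.lTensor (H ⧸ N) (counit (R := k)) (t s) := by
      rw [← LinearMap.comp_apply, ← LinearMap.lTensor_comp]
      congr 2
      ext b
      simp [γ, hg1, hcounit]
    have e2 : ∀ z : H ⊗[k] H, TensorProduct.rid k _ (LinearMap.lTensor (H ⧸ N) counit
        (LinearMap.rTensor H N.mkQ z)) = N.mkQ (TensorProduct.rid k _ (LinearMap.lTensor H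
          counit z)) := by
      intro z
      induction z with
      | zero => simp
      | add x y hx hy => simp only [map_add, hx, hy]
      | tmul x y => simp
    simp only [e1, e2] at this
    rw [this, ← rOp_eq, rOp_counit]
    rfl
  classical
  let 𝓑 := Module.Basis.ofVectorSpace k (H ⧸ N)
  let e := TensorProduct.equivFinsuppOfBasisLeft (N := B) 𝓑
  let c := fun s => e (straighten ι N hN (t s))
  let F := Finset.univ.biUnion fun s => (c s).support
  have h4 : ∀ s, straighten ι N hN (t s) = ∑ j ∈ F, 𝓑 j ⊗ₜ[k] c s j := by
    intro s
    have : straighten ι N hN (t s) = e.symm (c s) := (e.symm_apply_apply _).symm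
    rw [this, TensorProduct.equivFinsuppOfBasisLeft_symm_apply]
    exact Finsupp.sum_of_support_subset _ (Finset.subset_biUnion_of_mem (fun s => (c s).support)
      (Finset.mem_univ s)) _ (by simp)
  have h5 : ∀ j y, ∑ s, c s j * a s y = 0 := by
    intro j y
    have := congrArg (fun z => e z j) (h2 y)
    simp only [map_sum, map_zero, Finsupp.coe_finsetSum, Finset.sum_apply] at this
    have h6 : ∀ (a : B) z, e (LinearMap.lTensor _ (LinearMap.mulRight k a) z) j = e z j * a := by
      intro a z
      induction z with
      | zero => simp
      | add x y hx hy => simp only [map_add, Finsupp.add_apply, hx, hy, add_mul]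
      | tmul x y => simp [e]
    simp only [h6] at this
    exact this
  choose n hn using fun j => N.mkQ_surjective (𝓑 j)
  have h7 : ∀ s, h s - ∑ j ∈ F, n j * ι (c s j) ∈ N := by
    intro s
    rw [← Submodule.Quotient.mk_eq_zero, ← Submodule.mkQ_apply, map_sub, h3, h4, map_sum, map_sum,
      ← Finset.sum_sub_distrib]
    refine Finset.sum_eq_zero fun j _ => ?_
    rw [actMap_tmul, ← hn, rAct_mk, sub_self]
  obtain ⟨T, _, b, w, hb1, hb2⟩ := hrel r q a (fun s => h s - ∑ j ∈ F, n j * ι (c s j)) h7 (by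
    intro y
    simp only [sub_mul, Finset.sum_sub_distrib, hrel0, zero_sub, Finset.sum_mul]
    rw [Finset.sum_comm]
    rw [neg_eq_zero]
    refine Finset.sum_eq_zero fun j _ => ?_
    simp only [mul_assoc, ← map_mul]
    rw [← Finset.mul_sum, ← map_sum, h5, map_zero, mul_zero])
  refine ⟨T ⊕ F, inferInstance, Sum.elim b fun j s => c s j, Sum.elim w fun j => n j, ?_, ?_⟩
  · intro s
    simp only [Fintype.sum_sum_type, Sum.elim_inl, Sum.elim_inr]
    rw [← hb1 s, Finset.sum_coe_sort F (fun j => n j * ι (c s j)), sub_add_cancel]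
  · rintro (j | j) y
    · exact hb2 j y
    · exact h5 j y

end FlatStep

noncomputable section FlatExists

variable {k : Type u} [Field k] {H : Type u} [Ring H] [HopfAlgebra k H]

/-- The functional on `H` induced by a functional on `H ⧸ N`. -/
def pullDual {N : Submodule (ROp k H) H} (ξ : Module.Dual k (H ⧸ N)) : Module.Dual k H :=
  ξ ∘ₗ N.mkQ.restrictScalars k

theorem pullDual_apply {N : Submodule (ROp k H) H} (ξ : Module.Dual k (H ⧸ N)) (h : H) :
    pullDual ξ h = ξ (N.mkQ h) := rfl

/-- The map `H ⧸ N → H` of right coideals induced by a functional. -/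
def rMap {N : Submodule (ROp k H) H} (ξ : Module.Dual k (H ⧸ N)) : (H ⧸ N) →ₗ[ROp k H] H :=
  N.liftQ
    { toFun := lOp k H (pullDual ξ)
      map_add' := map_add _
      map_smul' := by
        intro a x
        obtain ⟨f, rfl⟩ := a.exists_mk
        exact (rOp_lOp f _ x).symm }
    (by
      intro x hx
      refine dual_ext (k := k) fun f => ?_
      change f (lOp k H (pullDual ξ) x) = _
      rw [apply_lOp, pullDual_apply, Submodule.mkQ_apply, (Submodule.Quotient.mk_eq_zero N).2
        (rOp_smul_mem f hx), map_zero, map_zero])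

theorem rMap_mk {N : Submodule (ROp k H) H} (ξ : Module.Dual k (H ⧸ N)) (h : H) :
    rMap ξ (N.mkQ h) = lOp k H (pullDual ξ) h := rfl

theorem counit_rMap {N : Submodule (ROp k H) H} (ξ : Module.Dual k (H ⧸ N)) (m : H ⧸ N) :
    counit (R := k) (rMap ξ m) = ξ m := by
  obtain ⟨h, rfl⟩ := N.mkQ_surjective m
  rw [rMap_mk, counit_lOp, pullDual_apply]

theorem apply_rMap {N : Submodule (ROp k H) H} (ξ : Module.Dual k (H ⧸ N)) (f : Module.Dual k H)
    (m : H ⧸ N) : f (rMap ξ m) = ξ (ROp.mk f • m) := by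
  obtain ⟨h, rfl⟩ := N.mkQ_surjective m
  rw [rMap_mk, apply_lOp, pullDual_apply, ← ROp.mk_smul, map_smul]

theorem lOp_rMap {N : Submodule (ROp k H) H} (ξ : Module.Dual k (H ⧸ N)) (f : Module.Dual k H) :
    ∃ ξ' : Module.Dual k (H ⧸ N), ∀ m, lOp k H f (rMap ξ m) = rMap ξ' m := by
  refine ⟨f ∘ₗ (rMap ξ).restrictScalars k, fun m => dual_ext (k := k) fun g => ?_⟩
  rw [apply_lOp, apply_rMap, LinearMap.comp_apply, LinearMap.coe_restrictScalars, map_smul]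
  rfl

theorem exists_finite_rMap {N : Submodule (ROp k H) H} (m : H ⧸ N) :
    ∃ W : Submodule k H, Module.Finite k W ∧ ∀ ξ : Module.Dual k (H ⧸ N), rMap ξ m ∈ W := by
  classical
  obtain ⟨h, rfl⟩ := N.mkQ_surjective m
  refine ⟨Submodule.span k ((ℛ k h).index.image (ℛ k h).right : Finset H),
    Module.Finite.span_finset k _, fun f => ?_⟩
  rw [rMap_mk, lOp_apply]
  refine Submodule.sum_mem _ fun i hi => Submodule.smul_mem _ _ (Submodule.subset_span ?_)
  exact Finset.mem_coe.2 (Finset.mem_image_of_mem _ hi)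

theorem exists_simple_submodule {N : Submodule (ROp k H) H} (hN : N ≠ ⊤) :
    ∃ S : Submodule (ROp k H) (H ⧸ N), IsSimpleModule (ROp k H) S ∧ Module.Finite k S := by
  obtain ⟨h, hh⟩ : ∃ h, h ∉ N := by
    by_contra! hc
    exact hN (eq_top_iff.2 fun x _ => hc x)
  obtain ⟨W, hW, hW2⟩ := exists_finite_rOp (k := k) h
  have hm : N.mkQ h ≠ 0 := by rwa [Submodule.mkQ_apply, ne_eq, Submodule.Quotient.mk_eq_zero]
  have hX : Module.Finite k (Submodule.span (ROp k H) {N.mkQ h}) := by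
    have : Module.Finite k (W.map (N.mkQ.restrictScalars k)) := inferInstance
    refine Submodule.finiteDimensional_of_le (S₁ := (Submodule.span (ROp k H)
      {N.mkQ h}).restrictScalars k) (S₂ := W.map (N.mkQ.restrictScalars k)) ?_
    intro x hx
    obtain ⟨a, rfl⟩ := Submodule.mem_span_singleton.1 hx
    obtain ⟨f, rfl⟩ := a.exists_mk
    exact ⟨_, hW2 f, rfl⟩
  let s : Set (Submodule (ROp k H) (H ⧸ N)) := {S | S ≠ ⊥ ∧ Module.Finite k S}
  have hs : s.Nonempty := ⟨_, by rwa [ne_eq, Submodule.span_singleton_eq_bot], hX⟩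
  obtain ⟨S, ⟨hS0, hSf⟩, hmin⟩ := (measure fun S : Submodule (ROp k H) (H ⧸ N) =>
    Module.finrank k S).wf.has_min s hs
  refine ⟨S, ?_, hSf⟩
  rw [isSimpleModule_iff_isAtom]
  refine ⟨hS0, fun S' hS' => ?_⟩
  by_contra h0
  have hle : S'.restrictScalars k ≤ S.restrictScalars k := hS'.le
  have hfin : FiniteDimensional k (S.restrictScalars k) := hSf
  have hf' : Module.Finite k S' := Submodule.finiteDimensional_of_le hle
  refine hmin S' ⟨h0, hf'⟩ ?_
  exact Submodule.finrank_lt_finrank_of_lt (s := S'.restrictScalars k) (t := S.restrictScalars k)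
    (lt_of_le_of_ne hle fun he => hS'.ne (Submodule.restrictScalars_injective k _ _ he))

theorem exists_minimal_subcoalgebra (D : Submodule k H) [FiniteDimensional k D] (hD0 : D ≠ ⊥)
    (h1 : ∀ f, ∀ x ∈ D, rOp k H f x ∈ D) (h2 : ∀ f, ∀ x ∈ D, lOp k H f x ∈ D) :
    ∃ C ≤ D, (∀ f, ∀ x ∈ C, rOp k H f x ∈ C) ∧ (∀ f, ∀ x ∈ C, lOp k H f x ∈ C) ∧ C ≠ ⊥ ∧
      ∀ C' ≤ C, (∀ f, ∀ x ∈ C', rOp k H f x ∈ C') → (∀ f, ∀ x ∈ C', lOp k H f x ∈ C') →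
        C' = ⊥ ∨ C' = C := by
  let s : Set (Submodule k H) := {C | C ≤ D ∧ (∀ f, ∀ x ∈ C, rOp k H f x ∈ C) ∧
    (∀ f, ∀ x ∈ C, lOp k H f x ∈ C) ∧ C ≠ ⊥}
  have hs : s.Nonempty := ⟨D, le_rfl, h1, h2, hD0⟩
  obtain ⟨C, ⟨hCD, hC1, hC2, hC0⟩, hmin⟩ := (measure fun S : Submodule k H =>
    Module.finrank k S).wf.has_min s hs
  refine ⟨C, hCD, hC1, hC2, hC0, fun C' hC' h1' h2' => ?_⟩
  by_contra! hc
  have : FiniteDimensional k C := Submodule.finiteDimensional_of_le hCD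
  exact hmin C' ⟨hC'.trans hCD, h1', h2', hc.1⟩
    (Submodule.finrank_lt_finrank_of_lt (lt_of_le_of_ne hC' hc.2))

theorem exists_flat_step (N : Submodule (ROp k H) H) (hN : N ≠ ⊤) :
    ∃ C : Submodule k H, (∀ f, ∀ x ∈ C, rOp k H f x ∈ C) ∧ (∀ f, ∀ x ∈ C, lOp k H f x ∈ C) ∧
      C ≠ ⊥ ∧ (∀ C' ≤ C, (∀ f, ∀ x ∈ C', rOp k H f x ∈ C') →
        (∀ f, ∀ x ∈ C', lOp k H f x ∈ C') → C' = ⊥ ∨ C' = C) ∧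
      ∃ h ∉ N, ∀ ξ : Module.Dual k H, (∀ x ∈ N, ξ x = 0) → lOp k H ξ h ∈ C := by
  obtain ⟨S, hS, hSf⟩ := exists_simple_submodule hN
  let ρ := fun ξ : Module.Dual k (H ⧸ N) => rMap ξ ∘ₗ S.subtype
  let D : Submodule (ROp k H) H := ⨆ ξ, LinearMap.range (ρ ξ)
  have hDmem : ∀ ξ, ∀ m : S, rMap ξ m ∈ D := fun ξ m =>
    Submodule.mem_iSup_of_mem (p := fun ξ => LinearMap.range (ρ ξ)) ξ ⟨m, rfl⟩
  have hss : IsSemisimpleModule (ROp k H) D := by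
    have := isSemisimpleModule_biSup_of_isSemisimpleModule_submodule (R := ROp k H)
      (s := Set.univ) (p := fun ξ => LinearMap.range (ρ ξ)) fun ξ _ => IsSemisimpleModule.range _
    have e : (⨆ ξ ∈ (Set.univ : Set (Module.Dual k (H ⧸ N))), LinearMap.range (ρ ξ)) = D := by
      simp only [Set.mem_univ, iSup_true, D]
    rwa [e] at this
  have hDind : ∀ {p : H → Prop}, (∀ (ξ : Module.Dual k (H ⧸ N)) (m : S), p (rMap ξ m)) → p 0 →
      (∀ x y, p x → p y → p (x + y)) → ∀ x ∈ D, p x := by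
    intro p h1 h0 ha x hx
    exact Submodule.iSup_induction (fun ξ => LinearMap.range (ρ ξ)) (motive := p) hx
      (by rintro ξ _ ⟨m, rfl⟩; exact h1 ξ m) h0 ha
  have hDfin : FiniteDimensional k (D.restrictScalars k) := by
    obtain ⟨F, hF⟩ := hSf.fg_top
    choose W hW hW2 using fun m : H ⧸ N => exists_finite_rMap m
    have : FiniteDimensional k (⨆ m : F, W m : Submodule k H) :=
      Submodule.finiteDimensional_iSup _
    refine Submodule.finiteDimensional_of_le (S₂ := ⨆ m : F, W m) fun x hx => ?_
    refine hDind (p := fun x => x ∈ ⨆ m : F, W m) ?_ (zero_mem _)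
      (fun _ _ => add_mem) x hx
    intro ξ m
    have hm : m ∈ Submodule.span k (F : Set S) := by rw [hF]; trivial
    induction hm using Submodule.span_induction with
    | mem x hx => exact Submodule.mem_iSup_of_mem (p := fun m : F => W m) ⟨x, hx⟩ (hW2 _ ξ)
    | zero => simp
    | add x y _ _ hx hy => 
      rw [Submodule.coe_add, map_add]
      exact add_mem hx hy
    | smul c x _ hx =>
      have : rMap ξ ((c • x : S) : H ⧸ N) = c • rMap ξ x :=
        ((rMap ξ).restrictScalars k).map_smul c _
      rw [this]
      exact Submodule.smul_mem _ _ hx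
  have hSnt : Nontrivial S := IsSimpleModule.nontrivial (ROp k H) S
  obtain ⟨m₀, hm₀⟩ := exists_ne (0 : S)
  have hD0 : D.restrictScalars k ≠ ⊥ := by
    intro h0
    obtain ⟨ξ, hξ⟩ : ∃ ξ : Module.Dual k (H ⧸ N), ξ m₀ ≠ 0 := by
      by_contra! hc
      exact hm₀ (Subtype.ext ((Module.forall_dual_apply_eq_zero_iff k _).1 hc))
    have : rMap ξ m₀ ∈ D.restrictScalars k := hDmem ξ m₀
    rw [h0, Submodule.mem_bot] at this
    rw [← counit_rMap, this, map_zero] at hξ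
    exact hξ rfl
  obtain ⟨C, hCD, hC1, hC2, hC0, hCmin⟩ := exists_minimal_subcoalgebra (D.restrictScalars k) hD0
    (fun f x hx => rOp_smul_mem f hx) (fun f => hDind (p := fun x => lOp k H f x ∈ D)
      (fun ξ m => by
        obtain ⟨ξ', hξ'⟩ := lOp_rMap ξ f
        rw [hξ']
        exact hDmem ξ' m) (by rw [map_zero]; exact zero_mem _)
      (fun x y hx hy => by rw [map_add]; exact add_mem hx hy))
  refine ⟨C, hC1, hC2, hC0, hCmin, ?_⟩
  let C' : Submodule (ROp k H) H := rSub C hC1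
  have hCD' : C' ≤ D := hCD
  obtain ⟨P, hP⟩ := IsSemisimpleModule.extension_property (Submodule.inclusion hCD')
    (Submodule.inclusion_injective _) (LinearMap.id : C' →ₗ[ROp k H] C')
  let ρ' := fun ξ : Module.Dual k (H ⧸ N) => C'.subtype ∘ₗ P ∘ₗ (ρ ξ).codRestrict D (hDmem ξ)
  obtain ⟨ξ₀, hξ₀⟩ : ∃ ξ, ρ' ξ ≠ 0 := by
    by_contra! hc
    obtain ⟨x, hx, hx0⟩ := Submodule.exists_mem_ne_zero_of_ne_bot hC0
    have hz : ∀ x ∈ D, ∃ hx : x ∈ D, P ⟨x, hx⟩ = 0 := by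
      refine hDind (p := fun x => ∃ hx : x ∈ D, P ⟨x, hx⟩ = 0) ?_ ?_ ?_
      · intro ξ m
        exact ⟨hDmem ξ m, Subtype.ext (LinearMap.congr_fun (hc ξ) m)⟩
      · exact ⟨zero_mem _, map_zero P⟩
      · rintro x y ⟨hx, hx'⟩ ⟨hy, hy'⟩
        refine ⟨add_mem hx hy, ?_⟩
        have : (⟨x + y, add_mem hx hy⟩ : D) = ⟨x, hx⟩ + ⟨y, hy⟩ := rfl
        rw [this, map_add, hx', hy', add_zero]
    have h1 := LinearMap.congr_fun hP ⟨x, hx⟩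
    obtain ⟨_, h2⟩ := hz x (hCD' hx)
    exact hx0 (congrArg Subtype.val (h1.symm.trans h2))
  have hinj := (LinearMap.injective_or_eq_zero (ρ' ξ₀)).resolve_right hξ₀
  obtain ⟨σ, hσ⟩ := LinearMap.exists_leftInverse_of_injective ((ρ' ξ₀).restrictScalars k)
    (LinearMap.ker_eq_bot.2 hinj)
  obtain ⟨h, hh⟩ := N.mkQ_surjective (m₀ : H ⧸ N)
  refine ⟨h, fun hmem => hm₀ (Subtype.ext ?_), fun ξ hξ => ?_⟩
  · rw [← hh, Submodule.mkQ_apply, (Submodule.Quotient.mk_eq_zero N).2 hmem]; rfl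
  obtain ⟨ξ', hξ'⟩ := exists_factor (f := N.mkQ.restrictScalars k) N.mkQ_surjective ξ
    (fun x hx => hξ x ((Submodule.Quotient.mk_eq_zero N).1 hx))
  have hpull : pullDual ξ' = ξ := LinearMap.ext hξ'
  have key : lOp k H ξ h = lOp k H (ξ' ∘ₗ (S.subtype.restrictScalars k) ∘ₗ σ) (ρ' ξ₀ m₀) := by
    rw [← hpull, ← rMap_mk, hh]
    refine dual_ext (k := k) fun f => ?_
    rw [apply_lOp, apply_rMap, ← ROp.mk_smul, ← map_smul]
    have := LinearMap.congr_fun hσ (ROp.mk f • m₀)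
    simp only [LinearMap.comp_apply, LinearMap.coe_restrictScalars, LinearMap.id_apply] at this ⊢
    rw [this]; rfl
  rw [key]
  exact hC2 _ _ (P _).2

end FlatExists

noncomputable section Flat

variable {k : Type u} [Field k] {H : Type u} [Ring H] [HopfAlgebra k H] {B : Type u} [Ring B]
  [HopfAlgebra k B] (ι : B →ₐ[k] H)

theorem rOp_mul_map (hcomul : ∀ b, comul (R := k) (ι b) =
    TensorProduct.map ι.toLinearMap ι.toLinearMap (comul (R := k) b)) {g : H}
    (hg : IsGroupLikeElem k g) (f : Module.Dual k H) (b : B) :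
    ∃ b', rOp k H f (g * ι b) = g * ι b' := by
  refine ⟨sw k (fun x y => f (g * ι y) • x) b, ?_⟩
  rw [rOp_eq, Bialgebra.comul_mul, hcomul, hg.comul_eq_tmul_self]
  conv_lhs => rw [← (ℛ k b).eq]
  simp [sw, Finset.mul_sum]

theorem lOp_mul_map (hcomul : ∀ b, comul (R := k) (ι b) =
    TensorProduct.map ι.toLinearMap ι.toLinearMap (comul (R := k) b))
    (ξ : Module.Dual k H) (h : H) (b : B) :
    lOp k H ξ (h * ι b) =
      sw k (fun x y => lOp k H (ξ ∘ₗ LinearMap.mulRight k (ι x)) h * ι y) b := by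
  rw [lOp_eq, Bialgebra.comul_mul, hcomul]
  conv_lhs => rw [← (ℛ k b).eq]
  simp only [map_sum, Finset.mul_sum, sw, TensorProduct.map_tmul]
  refine Finset.sum_congr rfl fun i _ => ?_
  rw [lOp_eq]
  generalize comul (R := k) h = z
  induction z with
  | zero => simp
  | add x y hx hy => simp only [map_add, add_mul, hx, hy]
  | tmul x y => simp

/-- The subspaces stable under the right coideal structure and right multiplication by `B` over
which the equational criterion holds. -/
def FlatSub : Set (Submodule (ROp k H) H) :=
  {N | (∀ h ∈ N, ∀ b, h * ι b ∈ N) ∧ RelOn ι (N.restrictScalars k)}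

theorem FlatSub.sSup_mem (c : Set (Submodule (ROp k H) H)) (hc : c ⊆ FlatSub ι)
    (hchain : IsChain (· ≤ ·) c) (hne : c.Nonempty) : sSup c ∈ FlatSub ι := by
  have hmem : ∀ x, x ∈ sSup c ↔ ∃ N ∈ c, x ∈ N :=
    fun x => Submodule.mem_sSup_of_directed hne hchain.directedOn
  refine ⟨fun h hh b => ?_, fun r q a h hh hrel => ?_⟩
  · obtain ⟨N, hN, hx⟩ := (hmem h).1 hh
    exact (hmem _).2 ⟨N, hN, (hc hN).1 h hx b⟩
  · choose N hN hx using fun s => (hmem _).1 (hh s)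
    obtain ⟨N₀, hN₀⟩ := hne
    have : Nonempty c := ⟨⟨N₀, hN₀⟩⟩
    have hdir : Directed (· ≤ ·) (fun x : c => (x : Submodule (ROp k H) H)) :=
      directedOn_iff_directed.1 hchain.directedOn
    obtain ⟨⟨P, hP⟩, hle⟩ := hdir.finset_le (Finset.univ.image fun s => (⟨N s, hN s⟩ : c))
    exact (hc hP).2 r q a h (fun s => hle ⟨N s, hN s⟩ (Finset.mem_image_of_mem _
      (Finset.mem_univ s)) (hx s)) hrel

theorem eqFlatR_of_minimal (hcomul : ∀ b, comul (R := k) (ι b) =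
      TensorProduct.map ι.toLinearMap ι.toLinearMap (comul (R := k) b))
    (hcounit : ∀ b, counit (R := k) (ι b) = counit (R := k) b) (hinj : Function.Injective ι)
    (hsimp : ∀ C : Submodule k H, IsSimpleSubcoalgebra k H C →
      ∃ g, IsGroupLikeElem k g ∧ ∀ x ∈ C, ∃ b, x = g * ι b) : EqFlatR (ι : B →+* H) := by
  have hbot : (⊥ : Submodule (ROp k H) H) ∈ FlatSub ι := by
    refine ⟨fun h hh b => ?_, fun r q a h hh hrel => ⟨PEmpty, inferInstance, fun j => j.elim,
      fun j => j.elim, fun s => ?_, fun j => j.elim⟩⟩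
    · rw [Submodule.mem_bot] at hh ⊢
      rw [hh, zero_mul]
    · simpa using hh s
  obtain ⟨N, hN⟩ := zorn_le₀ (FlatSub ι) (fun c hc hchain => by
    rcases c.eq_empty_or_nonempty with rfl | hne
    · exact ⟨⊥, hbot, fun _ h => h.elim⟩
    · exact ⟨sSup c, FlatSub.sSup_mem ι c hc hchain hne, fun N hN => le_sSup hN⟩)
  have htop : N = ⊤ := by
    by_contra hne
    obtain ⟨C, hC1, hC2, hC0, hCmin, h₀, hh₀, hlOp⟩ := exists_flat_step N hne
    obtain ⟨g, hg, hgC⟩ := hsimp C ⟨fun x hx => isSubcoalgebra_of_stable C hC1 hC2 hx, hC0,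
      fun D hD hsub => hCmin D hD (fun f x hx => (stable_of_isSubcoalgebra D hsub f hx).1)
        (fun f x hx => (stable_of_isSubcoalgebra D hsub f hx).2)⟩
    let N' : Submodule (ROp k H) H :=
      { carrier := {h | ∀ ξ : Module.Dual k H, (∀ x ∈ N, ξ x = 0) → ∃ b, lOp k H ξ h = g * ι b}
        zero_mem' := fun ξ _ => ⟨0, by simp⟩
        add_mem' := by
          intro x y hx hy ξ hξ
          obtain ⟨b, hb⟩ := hx ξ hξ
          obtain ⟨b', hb'⟩ := hy ξ hξ
          exact ⟨b + b', by rw [map_add, hb, hb', map_add, mul_add]⟩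
        smul_mem' := by
          intro a x hx ξ hξ
          obtain ⟨f, rfl⟩ := a.exists_mk
          obtain ⟨b, hb⟩ := hx ξ hξ
          obtain ⟨b', hb'⟩ := rOp_mul_map ι hcomul hg f b
          exact ⟨b', by rw [ROp.mk_smul, ← rOp_lOp, hb, hb']⟩ }
    have hN' : N' ∈ FlatSub ι := by
      refine ⟨fun h hh b ξ hξ => ?_, RelOn.step ι (N.restrictScalars k) hN.prop.1 hcomul hcounit
        hinj g (fun x hx => (hg.isUnit.mul_right_eq_zero).1 hx) hg.counit_eq_one hN.prop.2 _
        fun h hh => hh⟩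
      have hex : ∀ x : B, ∃ b', lOp k H (ξ ∘ₗ LinearMap.mulRight k (ι x)) h = g * ι b' :=
        fun x => hh _ fun z hz => hξ _ (hN.prop.1 z hz x)
      choose b' hb' using hex
      refine ⟨sw k (fun x y => b' x * y) b, ?_⟩
      rw [lOp_mul_map ι hcomul, map_sw, ← smul_eq_mul, smul_sw]
      exact sw_congr _ fun x y => by rw [hb', map_mul, smul_eq_mul, mul_assoc]
    have hle : N ≤ N' := by
      intro x hx ξ hξ
      refine ⟨0, ?_⟩
      rw [map_zero, mul_zero]
      refine dual_ext (k := k) fun f => ?_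
      rw [apply_lOp, hξ _ (rOp_smul_mem f hx), map_zero]
    exact hh₀ (hN.le_of_ge hN' hle fun ξ hξ => hgC _ (hlOp ξ hξ))
  intro r q a h hrel
  obtain ⟨T, _, b, w, h1, h2⟩ := hN.prop.2 r q a h (fun s => by rw [htop]; trivial) hrel
  refine ⟨Fintype.card T, fun j => b ((Fintype.equivFin T).symm j),
    fun j => w ((Fintype.equivFin T).symm j), fun s => ?_, fun j => h2 _⟩
  rw [h1]
  exact ((Fintype.equivFin T).symm.sum_comp fun j => w j * ι (b j s)).symm

theorem exists_groupLike_of_finrank_one (C : Submodule k H) (hC : IsSimpleSubcoalgebra k H C)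
    (h1 : Module.finrank k C = 1) : ∃ g : H, IsGroupLikeElem k g ∧ ∀ x ∈ C, ∃ c : k, x = c • g := by
  obtain ⟨⟨v, hv⟩, hv0, hspan⟩ := finrank_eq_one_iff'.1 h1
  have hspan' : ∀ x : C, ∃ c : k, c • v = (x : H) := fun x => by
    obtain ⟨c, hc⟩ := hspan x
    exact ⟨c, congrArg Subtype.val hc⟩
  have hv0' : v ≠ 0 := fun h => hv0 (Subtype.ext h)
  obtain ⟨l, hl⟩ : ∃ l : k, comul (R := k) v = l • (v ⊗ₜ[k] v) := by
    obtain ⟨t, ht⟩ := hC.1 v hv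
    rw [← ht]
    clear ht
    induction t with
    | zero => exact ⟨0, by simp⟩
    | add x y hx hy =>
      obtain ⟨a, ha⟩ := hx
      obtain ⟨b, hb⟩ := hy
      exact ⟨a + b, by rw [map_add, ha, hb, add_smul]⟩
    | tmul x y =>
      obtain ⟨a, ha⟩ := hspan' x
      obtain ⟨b, hb⟩ := hspan' y
      refine ⟨a * b, ?_⟩
      rw [TensorProduct.map_tmul, Submodule.subtype_apply, Submodule.subtype_apply, ← ha, ← hb,
        TensorProduct.smul_tmul_smul]
  have hε : l * counit (R := k) v = 1 := by
    have := congrArg (TensorProduct.lid k H ∘ LinearMap.rTensor H counit) hl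
    simp only [Function.comp_apply, rTensor_counit_comul, map_smul, LinearMap.rTensor_tmul,
      TensorProduct.lid_tmul, one_smul, smul_smul] at this
    by_contra hne
    apply hv0'
    have h2 : (l * counit (R := k) v - 1) • v = 0 := by rw [sub_smul, ← this, one_smul, sub_self]
    exact (smul_eq_zero.1 h2).resolve_left (sub_ne_zero.2 hne)
  have hl0 : l ≠ 0 := left_ne_zero_of_mul_eq_one hε
  refine ⟨l • v, ⟨by rw [map_smul, smul_eq_mul, hε], ?_⟩, fun x hx => ?_⟩
  · rw [map_smul, hl, TensorProduct.smul_tmul_smul, smul_smul]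
  · obtain ⟨c, hc⟩ := hspan' ⟨x, hx⟩
    refine ⟨c * l⁻¹, ?_⟩
    rw [smul_smul, mul_assoc, inv_mul_cancel₀ hl0, mul_one]
    exact hc.symm

/-- `H` is flat as a right module over a Hopf subalgebra `B` if `H` is pointed or `B` contains the
coradical. -/
theorem eqFlatR_of_pointed_or_coradical (hcomul : ∀ b, comul (R := k) (ι b) =
      TensorProduct.map ι.toLinearMap ι.toLinearMap (comul (R := k) b))
    (hcounit : ∀ b, counit (R := k) (ι b) = counit (R := k) b) (hinj : Function.Injective ι)
    (hH : IsPointedCoalgebra k H ∨ coradical k H ≤ LinearMap.range ι.toLinearMap) :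
    EqFlatR (ι : B →+* H) := by
  refine eqFlatR_of_minimal ι hcomul hcounit hinj fun C hC => ?_
  rcases hH with hH | hH
  · obtain ⟨g, hg, hgC⟩ := exists_groupLike_of_finrank_one C hC (hH C hC)
    refine ⟨g, hg, fun x hx => ?_⟩
    obtain ⟨c, rfl⟩ := hgC x hx
    exact ⟨c • 1, by rw [map_smul, map_one, mul_smul_comm, mul_one]⟩
  · refine ⟨1, .one, fun x hx => ?_⟩
    obtain ⟨b, hb⟩ := hH (le_sSup (a := C) hC hx)
    exact ⟨b, by rw [one_mul]; exact hb.symm⟩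

end Flat

noncomputable section SubHopf

variable {k : Type u} [Field k] {H : Type u} [Ring H] [HopfAlgebra k H] {A : Type u} [Ring A]
  [Algebra k A] (ι : A →ₐ[k] H) (hι : Function.Injective ι)

include hι in
theorem tensor_map_injective :
    Function.Injective (Algebra.TensorProduct.map ι ι : A ⊗[k] A →ₐ[k] H ⊗[k] H) := by
  have h : ⇑(Algebra.TensorProduct.map ι ι : A ⊗[k] A →ₐ[k] H ⊗[k] H) =
      ⇑(TensorProduct.map ι.toLinearMap ι.toLinearMap) := rfl
  rw [h, ← LinearMap.rTensor_comp_lTensor, LinearMap.coe_comp]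
  exact (Module.Flat.rTensor_preserves_injective_linearMap (M := H) ι.toLinearMap hι).comp
    (Module.Flat.lTensor_preserves_injective_linearMap (M := A) ι.toLinearMap hι)

include hι in
theorem tensor_map₃_injective : Function.Injective
    (Algebra.TensorProduct.map ι (Algebra.TensorProduct.map ι ι) :
      A ⊗[k] (A ⊗[k] A) →ₐ[k] H ⊗[k] (H ⊗[k] H)) := by
  let j : A ⊗[k] A →ₐ[k] H ⊗[k] H := Algebra.TensorProduct.map ι ι
  have h : ⇑(Algebra.TensorProduct.map ι j : A ⊗[k] (A ⊗[k] A) →ₐ[k] H ⊗[k] (H ⊗[k] H)) =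
      ⇑(TensorProduct.map ι.toLinearMap j.toLinearMap) := rfl
  change Function.Injective
    ⇑(Algebra.TensorProduct.map ι j : A ⊗[k] (A ⊗[k] A) →ₐ[k] H ⊗[k] (H ⊗[k] H))
  rw [h, ← LinearMap.rTensor_comp_lTensor, LinearMap.coe_comp]
  exact (Module.Flat.rTensor_preserves_injective_linearMap (M := H ⊗[k] H) ι.toLinearMap hι).comp
    (Module.Flat.lTensor_preserves_injective_linearMap (M := A) j.toLinearMap
      (tensor_map_injective ι hι))

variable (hΔ : ∀ a, ∃ t, Algebra.TensorProduct.map ι ι t = comul (R := k) (ι a))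

/-- The comultiplication of a Hopf subalgebra. -/
def subComul : A →ₐ[k] A ⊗[k] A :=
  ((AlgEquiv.ofInjective _ (tensor_map_injective ι hι)).symm : _ →ₐ[k] A ⊗[k] A).comp
    (((Bialgebra.comulAlgHom k H).comp ι).codRestrict (Algebra.TensorProduct.map ι ι).range hΔ)

theorem map_subComul (a : A) :
    Algebra.TensorProduct.map ι ι (subComul ι hι hΔ a) = comul (R := k) (ι a) :=
  congrArg Subtype.val ((AlgEquiv.ofInjective _ (tensor_map_injective ι hι)).apply_symm_apply
    ((((Bialgebra.comulAlgHom k H).comp ι).codRestrict (Algebra.TensorProduct.map ι ι).range hΔ) a))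

/-- The bialgebra structure of a Hopf subalgebra. -/
@[reducible] def subBialgebra : Bialgebra k A :=
  Bialgebra.ofAlgHom (subComul ι hι hΔ) ((Bialgebra.counitAlgHom k H).comp ι)
    (by
      ext a
      apply tensor_map₃_injective ι hι
      have h1 : ∀ z : A ⊗[k] A, Algebra.TensorProduct.map ι (Algebra.TensorProduct.map ι ι)
          (Algebra.TensorProduct.assoc k k k A A A
            (Algebra.TensorProduct.map (subComul ι hι hΔ) (.id k A) z)) =
          TensorProduct.assoc k H H H (LinearMap.rTensor H comul
            (Algebra.TensorProduct.map ι ι z)) := by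
        intro z
        induction z with
        | zero => simp only [map_zero]
        | add x y hx hy => simp only [map_add, hx, hy]
        | tmul x y =>
          simp only [Algebra.TensorProduct.map_tmul, LinearMap.rTensor_tmul, AlgHom.id_apply]
          rw [← map_subComul ι hι hΔ]
          generalize subComul ι hι hΔ x = w
          induction w with
          | zero => simp
          | add p q hp hq => simp only [map_add, add_tmul, hp, hq]
          | tmul p q => simp
      have h2 : ∀ z : A ⊗[k] A, Algebra.TensorProduct.map ι (Algebra.TensorProduct.map ι ι)
            (Algebra.TensorProduct.map (.id k A) (subComul ι hι hΔ) z) =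
          LinearMap.lTensor H comul (Algebra.TensorProduct.map ι ι z) := by
        intro z
        induction z with
        | zero => simp only [map_zero]
        | add x y hx hy => simp only [map_add, hx, hy]
        | tmul x y =>
          simp only [Algebra.TensorProduct.map_tmul, LinearMap.lTensor_tmul, AlgHom.id_apply,
            map_subComul]
      refine (h1 (subComul ι hι hΔ a)).trans (Eq.trans ?_ (h2 (subComul ι hι hΔ a)).symm)
      rw [map_subComul]
      exact Coalgebra.coassoc_apply (R := k) (ι a))
    (by
      ext a
      have h1 : ∀ z : A ⊗[k] A, ι (TensorProduct.lid k A (Algebra.TensorProduct.map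
          ((Bialgebra.counitAlgHom k H).comp ι) (.id k A) z)) =
          TensorProduct.lid k H (LinearMap.rTensor H counit (Algebra.TensorProduct.map ι ι z)) := by
        intro z
        induction z with
        | zero => simp only [map_zero]
        | add x y hx hy => simp only [map_add, hx, hy]
        | tmul x y => simp
      apply (TensorProduct.lid k A).injective
      apply hι
      refine (h1 (subComul ι hι hΔ a)).trans ?_
      rw [map_subComul]
      simp [Algebra.TensorProduct.lid_symm_apply])
    (by
      ext a
      have h1 : ∀ z : A ⊗[k] A, ι (TensorProduct.rid k A (Algebra.TensorProduct.map (.id k A)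
          ((Bialgebra.counitAlgHom k H).comp ι) z)) =
          TensorProduct.rid k H (LinearMap.lTensor H counit (Algebra.TensorProduct.map ι ι z)) := by
        intro z
        induction z with
        | zero => simp only [map_zero]
        | add x y hx hy => simp only [map_add, hx, hy]
        | tmul x y => simp
      apply (TensorProduct.rid k A).injective
      apply hι
      refine (h1 (subComul ι hι hΔ a)).trans ?_
      rw [map_subComul]
      simp [Algebra.TensorProduct.rid_symm_apply])

/-- The Hopf algebra structure of a Hopf subalgebra with antipode `s`. -/
@[reducible] def subHopf (s : A →ₗ[k] A) (hs : ∀ a, ι (s a) = antipode k (ι a)) : HopfAlgebra k A :=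
  { subBialgebra ι hι hΔ with
    antipode := s
    mul_antipode_rTensor_comul := by
      refine LinearMap.ext fun a => hι ?_
      have h1 : ∀ z : A ⊗[k] A, ι (LinearMap.mul' k A (s.rTensor A z)) =
          LinearMap.mul' k H ((antipode k).rTensor H (Algebra.TensorProduct.map ι ι z)) := by
        intro z
        induction z with
        | zero => simp only [map_zero]
        | add x y hx hy => simp only [map_add, hx, hy]
        | tmul x y => simp [hs]
      refine (h1 (subComul ι hι hΔ a)).trans ?_
      rw [map_subComul, HopfAlgebra.mul_antipode_rTensor_comul_apply]
      exact (ι.commutes _).symm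
    mul_antipode_lTensor_comul := by
      refine LinearMap.ext fun a => hι ?_
      have h1 : ∀ z : A ⊗[k] A, ι (LinearMap.mul' k A (s.lTensor A z)) =
          LinearMap.mul' k H ((antipode k).lTensor H (Algebra.TensorProduct.map ι ι z)) := by
        intro z
        induction z with
        | zero => simp only [map_zero]
        | add x y hx hy => simp only [map_add, hx, hy]
        | tmul x y => simp [hs]
      refine (h1 (subComul ι hι hΔ a)).trans ?_
      rw [map_subComul, HopfAlgebra.mul_antipode_lTensor_comul_apply]
      exact (ι.commutes _).symm }

theorem exists_hopf_sub (V : Submodule k H) (h1 : (1 : H) ∈ V)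
    (hmul : ∀ x ∈ V, ∀ y ∈ V, x * y ∈ V) (hS : ∀ x ∈ V, antipode k x ∈ V)
    (hr : ∀ f, ∀ x ∈ V, rOp k H f x ∈ V) (hl : ∀ f, ∀ x ∈ V, lOp k H f x ∈ V) :
    ∃ (B : Type u) (_ : Ring B) (_ : HopfAlgebra k B) (ι : B →ₐ[k] H), Function.Injective ι ∧
      (∀ b, comul (R := k) (ι b) =
        TensorProduct.map ι.toLinearMap ι.toLinearMap (comul (R := k) b)) ∧
      (∀ b, counit (R := k) (ι b) = counit (R := k) b) ∧
      (∀ b, ι (antipode k b) = antipode k (ι b)) ∧ LinearMap.range ι.toLinearMap = V := by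
  let A : Subalgebra k H := V.toSubalgebra h1 fun x y hx hy => hmul x hx y hy
  have hinj : Function.Injective A.val := Subtype.val_injective
  have hΔ : ∀ a, ∃ t, Algebra.TensorProduct.map A.val A.val t = comul (R := k) (A.val a) :=
    fun a => by
      obtain ⟨t, ht⟩ := isSubcoalgebra_of_stable V hr hl a.2
      exact ⟨t, ht⟩
  let s : A →ₗ[k] A := ((antipode k).comp A.val.toLinearMap).codRestrict V fun a => hS _ a.2
  refine ⟨A, inferInstance, subHopf A.val hinj hΔ s fun _ => rfl, A.val, hinj,
    fun b => (map_subComul A.val hinj hΔ b).symm, fun b => rfl, fun b => rfl, ?_⟩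
  ext x
  exact ⟨by rintro ⟨a, rfl⟩; exact a.2, fun hx => ⟨⟨x, hx⟩, rfl⟩⟩

end SubHopf

noncomputable section LeftFlat

theorem colSmul_sum_single {B : Type u} [Ring B] {M : Type u} [AddCommGroup M] [Module B M]
    {r : ℕ} (y : Fin r → ℕ) (β : Fin r → B) (m : M) :
    colSmul (∑ s, Finsupp.single (y s) (β s)) m = ∑ s, Finsupp.single (y s) (β s • m) := by
  classical
  refine Finsupp.ext fun i => ?_
  rw [colSmul_apply, Finsupp.finsetSum_apply, Finsupp.finsetSum_apply, Finset.sum_smul]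
  refine Finset.sum_congr rfl fun s _ => ?_
  rw [Finsupp.single_apply, Finsupp.single_apply, ite_smul, zero_smul]

theorem eqFlat_tw_of_eqFlatR {B H : Type u} [Ring B] [Ring H] {ι : B →+* H} (hι : EqFlatR ι)
    (τ : H ≃+* Hᵐᵒᵖ) (σ : B ≃+* Bᵐᵒᵖ) (hσ : ∀ b, τ (ι b) = MulOpposite.op (ι (σ b).unop)) :
    EqFlat B (Tw ι τ) := by
  classical
  intro c x hx
  have hσ' : ∀ b, ι (σ.symm (MulOpposite.op b)) = τ.symm (MulOpposite.op (ι b)) := fun b => by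
    rw [RingEquiv.eq_symm_apply, hσ, RingEquiv.apply_symm_apply, MulOpposite.unop_op]
  let e := x.support.equivFin
  let y : Fin x.support.card → ℕ := fun s => e.symm s
  let h : Fin x.support.card → H := fun s => (toTw ι τ).symm (x (y s))
  have hsum : ∀ {N : Type u} [AddCommMonoid N] (g : ℕ → N), ∑ s, g (y s) = ∑ n ∈ x.support, g n :=
    fun g => by
      rw [← Finset.sum_coe_sort x.support g]
      exact Equiv.sum_comp e.symm fun n => g n
  have hxi : ∀ i, ∑ s, ι (c (y s) i) * h s = 0 := fun i => by
    have h1 : (∑ n ∈ x.support, c n i • x n) = 0 := by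
      have := DFunLike.congr_fun hx i
      rwa [colMap_apply] at this
    rw [← hsum fun n => c n i • x n] at h1
    apply (toTw ι τ).injective
    rw [map_sum, map_zero, ← h1]
    refine Finset.sum_congr rfl fun s _ => ?_
    rw [← base_smul_toTw, AddEquiv.apply_symm_apply]
  obtain ⟨t, b, w, h1, h2⟩ := hι.finset (x.support.biUnion fun n => (c n).support)
    (fun s i => (σ (c (y s) i)).unop) (fun s => (τ (h s)).unop) fun i _ => by
      have := congrArg (fun a => (τ a).unop) (hxi i)
      simp only [map_sum, map_zero, map_mul, MulOpposite.unop_zero, hσ, Finset.unop_sum,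
        MulOpposite.unop_mul, MulOpposite.unop_op] at this
      exact this
  have h2' : ∀ j i, ∑ s, c (y s) i * σ.symm (MulOpposite.op (b j s)) = 0 := fun j i => by
    have h3 : ∑ s, b j s * (σ (c (y s) i)).unop = 0 := by
      by_cases hi : i ∈ x.support.biUnion fun n => (c n).support
      · exact h2 j i hi
      · refine Finset.sum_eq_zero fun s _ => ?_
        have : c (y s) i = 0 := by
          by_contra hne
          exact hi (Finset.mem_biUnion.2 ⟨y s, (e.symm s).2, Finsupp.mem_support_iff.2 hne⟩)
        rw [this]; simp
    have h4 := congrArg (fun a => σ.symm (MulOpposite.op a)) h3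
    simpa [Finset.op_sum, map_sum] using h4
  have h1' : ∀ s, h s = ∑ j, ι (σ.symm (MulOpposite.op (b j s))) * τ.symm (MulOpposite.op (w j)) :=
    fun s => by
      have h4 := congrArg (fun a => τ.symm (MulOpposite.op a)) (h1 s)
      simp only [MulOpposite.op_unop, RingEquiv.symm_apply_apply] at h4
      rw [h4]
      simp [Finset.op_sum, map_sum, hσ']
  let c' : ℕ → ℕ →₀ B := fun j => if hj : j < t then
    ∑ s, Finsupp.single (y s) (σ.symm (MulOpposite.op (b ⟨j, hj⟩ s))) else 0
  have hc' : ∀ j : Fin t, c' j = ∑ s, Finsupp.single (y s) (σ.symm (MulOpposite.op (b j s))) :=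
    fun j => dif_pos j.2
  refine ⟨c', fun j => ?_, ∑ j : Fin t, Finsupp.single (j : ℕ)
    (toTw ι τ (τ.symm (MulOpposite.op (w j)))), ?_⟩
  · by_cases hj : j < t
    · have := hc' ⟨j, hj⟩
      simp only at this
      rw [this, map_sum]
      refine Finsupp.ext fun i => ?_
      simp only [colMap_single, Finsupp.finsetSum_apply, colSmul_apply, smul_eq_mul]
      exact h2' _ i
    · have : c' j = 0 := dif_neg hj
      rw [this, map_zero]
  · rw [map_sum]
    simp only [colMap_single, hc', colSmul_sum_single]
    rw [Finset.sum_comm]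
    have : ∀ s, ∑ j, Finsupp.single (y s) (σ.symm (MulOpposite.op (b j s)) •
        toTw ι τ (τ.symm (MulOpposite.op (w j)))) = Finsupp.single (y s) (x (y s)) := fun s => by
      rw [← Finsupp.single_finsetSum]
      congr 1
      simp only [base_smul_toTw]
      rw [← map_sum, ← h1' s]
      exact AddEquiv.apply_symm_apply _ _
    simp only [this]
    exact (hsum fun n => Finsupp.single n (x n)).trans x.sum_single

/-- A bijective antipode as a ring isomorphism to the opposite ring. -/
def antipodeEquiv (k : Type u) [Field k] (H : Type u) [Ring H] [HopfAlgebra k H]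
    (hS : Function.Bijective (antipode k (A := H))) : H ≃+* Hᵐᵒᵖ :=
  { (Equiv.ofBijective _ hS).trans MulOpposite.opEquiv with
    map_mul' := fun a b => congrArg MulOpposite.op (antipode_mul_antidistrib a b)
    map_add' := fun a b => congrArg MulOpposite.op (map_add (antipode k (A := H)) a b) }

theorem antipodeEquiv_apply (k : Type u) [Field k] (H : Type u) [Ring H] [HopfAlgebra k H]
    (hS : Function.Bijective (antipode k (A := H))) (h : H) :
    antipodeEquiv k H hS h = MulOpposite.op (antipode k h) := rfl

end LeftFlat

noncomputable section Generation

variable (k : Type u) [Field k] {H : Type u} [Ring H] [HopfAlgebra k H] (T : H → H)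

/-- The elements generated from `X` by products, the antipode, the operation `T`, and the factors
of chosen representations of the comultiplication. -/
inductive Gen (X : Set H) : H → Prop
  | base {x : H} (hx : x ∈ X) : Gen X x
  | one : Gen X 1
  | mul {x y : H} (hx : Gen X x) (hy : Gen X y) : Gen X (x * y)
  | antipode {x : H} (hx : Gen X x) : Gen X (antipode k x)
  | inv {x : H} (hx : Gen X x) : Gen X (T x)
  | left {x : H} (hx : Gen X x) {i} (hi : i ∈ (ℛ k x).index) : Gen X ((ℛ k x).left i)
  | right {x : H} (hx : Gen X x) {i} (hi : i ∈ (ℛ k x).index) : Gen X ((ℛ k x).right i)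

variable {k T}

theorem Gen.mono {X Y : Set H} (h : X ⊆ Y) {x : H} (hx : Gen k T X x) : Gen k T Y x := by
  induction hx with
  | base hx => exact .base (h hx)
  | one => exact .one
  | mul _ _ h1 h2 => exact .mul h1 h2
  | antipode _ h1 => exact .antipode h1
  | inv _ h1 => exact .inv h1
  | left _ hi h1 => exact .left h1 hi
  | right _ hi h1 => exact .right h1 hi

theorem Gen.exists_of_chain {S : Set H} {c : Set (Set H)} (hc : IsChain (· ⊆ ·) c)
    (hne : c.Nonempty) {x : H} (hx : Gen k T (S ∪ ⋃₀ c) x) : ∃ s ∈ c, Gen k T (S ∪ s) x := by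
  induction hx with
  | base hx =>
    rcases hx with hx | ⟨s, hs, hx⟩
    · obtain ⟨s, hs⟩ := hne
      exact ⟨s, hs, .base (.inl hx)⟩
    · exact ⟨s, hs, .base (.inr hx)⟩
  | one =>
    obtain ⟨s, hs⟩ := hne
    exact ⟨s, hs, .one⟩
  | mul _ _ h1 h2 =>
    obtain ⟨s, hs, h1⟩ := h1
    obtain ⟨t, ht, h2⟩ := h2
    rcases hc.total hs ht with h | h
    · exact ⟨t, ht, .mul (h1.mono (Set.union_subset_union_right S h)) h2⟩
    · exact ⟨s, hs, .mul h1 (h2.mono (Set.union_subset_union_right S h))⟩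
  | antipode _ h1 => obtain ⟨s, hs, h1⟩ := h1; exact ⟨s, hs, .antipode h1⟩
  | inv _ h1 => obtain ⟨s, hs, h1⟩ := h1; exact ⟨s, hs, .inv h1⟩
  | left _ hi h1 => obtain ⟨s, hs, h1⟩ := h1; exact ⟨s, hs, .left h1 hi⟩
  | right _ hi h1 => obtain ⟨s, hs, h1⟩ := h1; exact ⟨s, hs, .right h1 hi⟩

variable (k T)

/-- One step of the generation process. -/
def genStep (E : Set H) : Set H :=
  E ∪ Set.image2 (· * ·) E E ∪ antipode k '' E ∪ T '' E ∪
    ((⋃ x ∈ E, (ℛ k x).left '' (ℛ k x).index) ∪ ⋃ x ∈ E, (ℛ k x).right '' (ℛ k x).index)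

variable {k T}

theorem countable_gen {X : Set H} (hX : X.Countable) : {x | Gen k T X x}.Countable := by
  let E : ℕ → Set H := fun n => (genStep k T)^[n] (insert 1 X)
  have hstep : ∀ n, E (n + 1) = genStep k T (E n) := fun n =>
    Function.iterate_succ_apply' (genStep k T) n _
  have hE : ∀ n, (E n).Countable := by
    intro n
    induction n with
    | zero => exact hX.insert 1
    | succ n ih =>
      rw [hstep]
      exact (((ih.union (ih.image2 ih _)).union (ih.image _)).union (ih.image _)).union
        ((ih.biUnion fun x _ => ((ℛ k x).index.countable_toSet.image _)).union
          (ih.biUnion fun x _ => ((ℛ k x).index.countable_toSet.image _)))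
  have hmono : Monotone E := monotone_nat_of_le_succ fun n => by
    rw [hstep]
    exact fun x hx => .inl (.inl (.inl (.inl hx)))
  refine (Set.countable_iUnion hE).mono fun x hx => ?_
  rw [Set.mem_iUnion]
  induction hx with
  | base hx => exact ⟨0, .inr hx⟩
  | one => exact ⟨0, .inl rfl⟩
  | mul _ _ h1 h2 =>
    obtain ⟨m, h1⟩ := h1
    obtain ⟨n, h2⟩ := h2
    refine ⟨max m n + 1, ?_⟩
    rw [hstep]
    exact .inl (.inl (.inl (.inr ⟨_, hmono (le_max_left m n) h1, _, hmono (le_max_right m n) h2, rfl⟩)))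
  | antipode _ h1 =>
    obtain ⟨m, h1⟩ := h1
    refine ⟨m + 1, ?_⟩
    rw [hstep]
    exact .inl (.inl (.inr ⟨_, h1, rfl⟩))
  | inv _ h1 =>
    obtain ⟨m, h1⟩ := h1
    refine ⟨m + 1, ?_⟩
    rw [hstep]
    exact .inl (.inr ⟨_, h1, rfl⟩)
  | left _ hi h1 =>
    obtain ⟨m, h1⟩ := h1
    refine ⟨m + 1, ?_⟩
    rw [hstep]
    exact .inr (.inl (Set.mem_biUnion h1 ⟨_, hi, rfl⟩))
  | right _ hi h1 =>
    obtain ⟨m, h1⟩ := h1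
    refine ⟨m + 1, ?_⟩
    rw [hstep]
    exact .inr (.inr (Set.mem_biUnion h1 ⟨_, hi, rfl⟩))

variable (k)

/-- The subspace spanned by the elements generated from `S ∪ X`. -/
def genSpan (T : H →ₗ[k] H) (S X : Set H) : Submodule k H :=
  Submodule.span k {x | Gen k T (S ∪ X) x}

variable {k} {T : H →ₗ[k] H} {S X Y : Set H}

theorem genSpan_mono (h : X ⊆ Y) : genSpan k T S X ≤ genSpan k T S Y :=
  Submodule.span_mono fun _ hx => hx.mono (Set.union_subset_union_right S h)

theorem subset_genSpan : S ∪ X ⊆ genSpan k T S X :=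
  fun _ hx => Submodule.subset_span (.base hx)

theorem countSpan_genSpan (hS : S.Countable) (hX : X.Countable) : CountSpan k (genSpan k T S X) :=
  ⟨_, countable_gen (hS.union hX), rfl⟩

theorem exists_of_chain_genSpan {c : Set (Set H)} (hc : IsChain (· ⊆ ·) c) (hne : c.Nonempty)
    {x : H} (hx : x ∈ genSpan k T S (⋃₀ c)) : ∃ s ∈ c, x ∈ genSpan k T S s := by
  induction hx using Submodule.span_induction with
  | mem x hx =>
    obtain ⟨s, hs, h⟩ := Gen.exists_of_chain hc hne hx
    exact ⟨s, hs, Submodule.subset_span h⟩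
  | zero =>
    obtain ⟨s, hs⟩ := hne
    exact ⟨s, hs, zero_mem _⟩
  | add x y _ _ h1 h2 =>
    obtain ⟨s, hs, h1⟩ := h1
    obtain ⟨t, ht, h2⟩ := h2
    rcases hc.total hs ht with h | h
    · exact ⟨t, ht, add_mem (genSpan_mono h h1) h2⟩
    · exact ⟨s, hs, add_mem h1 (genSpan_mono h h2)⟩
  | smul a x _ h1 =>
    obtain ⟨s, hs, h1⟩ := h1
    exact ⟨s, hs, Submodule.smul_mem _ a h1⟩

theorem genSpan_stable (f : H →ₗ[k] H)
    (h : ∀ x, Gen k T (S ∪ X) x → f x ∈ genSpan k T S X) :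
    ∀ x ∈ genSpan k T S X, f x ∈ genSpan k T S X := by
  have : genSpan k T S X ≤ (genSpan k T S X).comap f := Submodule.span_le.2 h
  exact this

theorem one_mem_genSpan : (1 : H) ∈ genSpan k T S X := Submodule.subset_span .one

theorem mul_mem_genSpan : ∀ x ∈ genSpan k T S X, ∀ y ∈ genSpan k T S X,
    x * y ∈ genSpan k T S X := by
  intro x hx y hy
  exact genSpan_stable (LinearMap.mulRight k y) (fun x hx =>
    genSpan_stable (LinearMap.mulLeft k x) (fun y hy => Submodule.subset_span (.mul hx hy)) y hy)
    x hx

theorem antipode_mem_genSpan : ∀ x ∈ genSpan k T S X, antipode k x ∈ genSpan k T S X :=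
  genSpan_stable _ fun _ hx => Submodule.subset_span (.antipode hx)

theorem inv_mem_genSpan : ∀ x ∈ genSpan k T S X, T x ∈ genSpan k T S X :=
  genSpan_stable _ fun _ hx => Submodule.subset_span (.inv hx)

theorem rOp_mem_genSpan (f : Module.Dual k H) :
    ∀ x ∈ genSpan k T S X, rOp k H f x ∈ genSpan k T S X :=
  genSpan_stable _ fun x hx => by
    rw [rOp_apply]
    exact Submodule.sum_mem _ fun i hi =>
      Submodule.smul_mem _ _ (Submodule.subset_span (.left hx hi))

theorem lOp_mem_genSpan (f : Module.Dual k H) :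
    ∀ x ∈ genSpan k T S X, lOp k H f x ∈ genSpan k T S X :=
  genSpan_stable _ fun x hx => by
    rw [lOp_apply]
    exact Submodule.sum_mem _ fun i hi =>
      Submodule.smul_mem _ _ (Submodule.subset_span (.right hx hi))

end Generation

noncomputable section CardinalInduction

variable {R : Type u} [Ring R] {G : Type u} [AddCommGroup G] [Module R G]

theorem pd_subQuot {n : ℕ} {L L' : Submodule R G} (h : L ≤ L') (h1 : PD R n (G ⧸ L))
    (h2 : PD R n (G ⧸ L')) : PD R n (subQuot L L') := by
  refine PD.sub (subQuot L L').injective_subtype (g := (subQuot L L').mkQ)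
    (LinearMap.exact_subtype_mkQ _) (Submodule.mkQ_surjective _) h1 ?_
  exact (PD.of_equiv (Submodule.quotientQuotientEquivQuotient L L' h).symm h2).mono n.le_succ

theorem pd_quotient_of_countable {α : Type u} (n : ℕ)
    (hred : ∀ (M : Type u) [AddCommGroup M] [Module R M], PD R (n + 1) M → PD R n M)
    (hG : Module.Projective R G) (Lf : Set α → Submodule R G)
    (hmono : ∀ s t, s ⊆ t → Lf s ≤ Lf t)
    (hcont : ∀ c : Set (Set α), IsChain (· ⊆ ·) c → c.Nonempty →
      ∀ x ∈ Lf (⋃₀ c), ∃ s ∈ c, x ∈ Lf s)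
    (hcount : ∀ s : Set α, s.Countable → PD R n (G ⧸ Lf s)) (X : Set α) :
    PD R n (G ⧸ Lf X) := by
  suffices h : ∀ (c : Cardinal.{u}) (X : Set α), Cardinal.mk X = c → PD R n (G ⧸ Lf X) from
    h _ X rfl
  intro c
  induction c using WellFoundedLT.induction with
  | ind c ih =>
  intro X hX
  rcases le_or_gt c Cardinal.aleph0 with hc | hc
  · exact hcount X (Cardinal.le_aleph0_iff_set_countable.1 (hX.trans_le hc))
  have hκ : Cardinal.mk c.ord.ToType = Cardinal.mk X := by rw [Cardinal.mk_ord_toType, hX]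
  obtain ⟨e⟩ := Cardinal.eq.1 hκ
  let φ : c.ord.ToType → α := fun i => e i
  have hφ : φ '' Set.univ = X := by
    ext x
    exact ⟨by rintro ⟨i, -, rfl⟩; exact (e i).2, fun hx => ⟨e.symm ⟨x, hx⟩, trivial, by simp [φ]⟩⟩
  have hpd : PD R n (Lf (φ '' Set.univ)) := by
    refine pd_filtration n (fun s => Lf (φ '' s)) (fun s t h => hmono _ _ (Set.image_mono h))
      (fun d hd hne x hx => ?_) ?_ fun x => ?_
    · have h1 : φ '' ⋃₀ d = ⋃₀ ((φ '' ·) '' d) := by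
        rw [Set.sUnion_eq_biUnion, Set.image_iUnion₂, Set.sUnion_image]
      have h2 : IsChain (· ⊆ ·) ((φ '' ·) '' d) := by
        rintro _ ⟨s, hs, rfl⟩ _ ⟨t, ht, rfl⟩ -
        rcases hd.total hs ht with h | h
        · exact .inl (Set.image_mono h)
        · exact .inr (Set.image_mono h)
      rw [h1] at hx
      obtain ⟨_, ⟨s, hs, rfl⟩, hxs⟩ := hcont _ h2 (hne.image _) x hx
      exact ⟨s, hs, hxs⟩
    · rw [Set.image_empty]
      exact PD.sub (Lf ∅).injective_subtype (g := (Lf ∅).mkQ) (LinearMap.exact_subtype_mkQ _)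
        (Submodule.mkQ_surjective _) (.of_projective hG _)
        ((hcount ∅ Set.countable_empty).mono n.le_succ)
    · have h1 : Cardinal.mk (Set.Iio x) < c := by simpa using Cardinal.mk_Iio_lt x
      have h2 : Cardinal.mk (Set.Iic x) < c := by
        rw [← Set.Iio_insert]
        refine Cardinal.mk_insert_le.trans_lt ?_
        exact Cardinal.add_lt_of_lt hc.le h1 (Cardinal.one_lt_aleph0.trans hc)
      exact pd_subQuot (hmono _ _ (Set.image_mono Set.Iio_subset_Iic_self))
        (ih _ (Cardinal.mk_image_le.trans_lt h1) _ rfl)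
        (ih _ (Cardinal.mk_image_le.trans_lt h2) _ rfl)
  rw [hφ] at hpd
  exact hred _ (PD.quot (Lf X).injective_subtype (g := (Lf X).mkQ) (LinearMap.exact_subtype_mkQ _)
    (Submodule.mkQ_surjective _) hpd (.of_projective hG _))

end CardinalInduction

noncomputable section Relations

variable {k : Type u} [Field k] {H : Type u} [Ring H] [HopfAlgebra k H] {I : Type u}
  [AddCommGroup I] [Module k I] [Module H I] [IsScalarTower k H I]

variable (I) in
/-- The relations making the tensor product `H ⊗ I` balanced over `V`. -/
def relSub (V : Submodule k H) : Submodule H (H ⊗[k] I) :=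
  Submodule.span H {z | ∃ a ∈ V, ∃ x : I, z = a ⊗ₜ[k] x - 1 ⊗ₜ[k] (a • x)}

theorem relSub_mono {V W : Submodule k H} (h : V ≤ W) : relSub I V ≤ relSub I W :=
  Submodule.span_mono fun _ ⟨a, ha, x, hz⟩ => ⟨a, h ha, x, hz⟩

theorem exists_of_chain_relSub {T : H →ₗ[k] H} {S : Set H} {c : Set (Set H)}
    (hc : IsChain (· ⊆ ·) c) (hne : c.Nonempty) {z : H ⊗[k] I}
    (hz : z ∈ relSub I (genSpan k T S (⋃₀ c))) : ∃ s ∈ c, z ∈ relSub I (genSpan k T S s) := by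
  induction hz using Submodule.span_induction with
  | mem z hz =>
    obtain ⟨a, ha, x, rfl⟩ := hz
    obtain ⟨s, hs, h⟩ := exists_of_chain_genSpan hc hne ha
    exact ⟨s, hs, Submodule.subset_span ⟨a, h, x, rfl⟩⟩
  | zero =>
    obtain ⟨s, hs⟩ := hne
    exact ⟨s, hs, zero_mem _⟩
  | add x y _ _ h1 h2 =>
    obtain ⟨s, hs, h1⟩ := h1
    obtain ⟨t, ht, h2⟩ := h2
    rcases hc.total hs ht with h | h
    · exact ⟨t, ht, add_mem (relSub_mono (genSpan_mono h) h1) h2⟩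
    · exact ⟨s, hs, add_mem h1 (relSub_mono (genSpan_mono h) h2)⟩
  | smul a x _ h1 =>
    obtain ⟨s, hs, h1⟩ := h1
    exact ⟨s, hs, Submodule.smul_mem _ a h1⟩

theorem pd_quotient_relSub_top {n : ℕ} (h : PD H n ((H ⊗[k] I) ⧸ relSub I (⊤ : Submodule k H))) :
    PD H n I := by
  let μ : H ⊗[k] I →ₗ[H] I := TensorProduct.AlgebraTensorModule.lift
    { toFun := fun a => (LinearMap.toSpanSingleton H (I →ₗ[k] I) LinearMap.id) a
      map_add' := fun a b => map_add _ a b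
      map_smul' := fun a b => map_smul _ a b }
  have hμ : ∀ a x, μ (a ⊗ₜ x) = a • x := fun a x => rfl
  have hle : relSub I (⊤ : Submodule k H) ≤ LinearMap.ker μ := Submodule.span_le.2 (by
    rintro _ ⟨a, -, x, rfl⟩
    change μ _ = 0
    rw [map_sub, hμ, hμ, one_smul, sub_self])
  let i : I →ₗ[H] (H ⊗[k] I) ⧸ relSub I (⊤ : Submodule k H) :=
    { toFun := fun x => (relSub I (⊤ : Submodule k H)).mkQ (1 ⊗ₜ x)
      map_add' := fun x y => by rw [TensorProduct.tmul_add, map_add]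
      map_smul' := fun a x => by
        rw [RingHom.id_apply, ← map_smul, TensorProduct.smul_tmul', smul_eq_mul, mul_one]
        have h1 : a ⊗ₜ[k] x - 1 ⊗ₜ[k] (a • x) ∈ relSub I (⊤ : Submodule k H) :=
          Submodule.subset_span ⟨a, trivial, x, rfl⟩
        exact ((Submodule.Quotient.eq _).2 h1).symm }
  refine PD.of_retract i ((relSub I (⊤ : Submodule k H)).liftQ μ hle) (fun x => ?_) h
  change μ (1 ⊗ₜ x) = x
  rw [hμ, one_smul]

end Relations

noncomputable section CountableCase

variable {k : Type u} [Field k] {H : Type u} [Ring H] [HopfAlgebra k H]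

theorem bijective_antipode_sub {B : Type u} [Ring B] [HopfAlgebra k B] {ι : B →ₐ[k] H}
    (hι : Function.Injective ι) (hanti : ∀ b, ι (antipode k b) = antipode k (ι b)) {T : H →ₗ[k] H}
    (hT : ∀ h, T (antipode k h) = h) (hT' : ∀ h, antipode k (T h) = h)
    (hTB : ∀ b, ∃ b', ι b' = T (ι b)) : Function.Bijective (antipode k (A := B)) := by
  refine ⟨fun a b hab => hι ?_, fun b => ?_⟩
  · rw [← hT (ι a), ← hT (ι b), ← hanti, ← hanti, hab]
  · obtain ⟨b', hb'⟩ := hTB b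
    exact ⟨b', hι (by rw [hanti, hb', hT'])⟩

theorem pd_ind_of_countable {B : Type u} [Ring B] [HopfAlgebra k B] (ι : B →ₐ[k] H)
    (hflat : EqFlatR (ι : B →+* H)) (hB : CountSpan k (⊤ : Submodule k B))
    (hcounit : ∀ b, counit (R := k) (ι b) = counit (R := k) b)
    (hanti : ∀ b, ι (antipode k b) = antipode k (ι b))
    (hS : Function.Bijective (antipode k (A := H))) (hSB : Function.Bijective (antipode k (A := B)))
    {n : ℕ} (hsilp : ∀ (P : Type u) [AddCommGroup P] [Module H P], Module.Projective H P → ID H n P)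
    {I : Type u} [AddCommGroup I] [Module k I] [Module H I] [IsScalarTower k H I] [Module B I]
    [IsScalarTower k B I] (hact : ∀ (b : B) (x : I), b • x = ι b • x)
    (hI : Module.Injective H I) : PD H n (Ind ι I) := by
  classical
  obtain ⟨J, _, _, _, _, lam, hJ, h0, hlam⟩ := exists_trivial_injective k H
  letI : Module B J := Module.compHom J (ι : B →+* H)
  have hactJ : ∀ (b : B) (x : J), b • x = ι b • x := fun _ _ => rfl
  haveI : IsScalarTower k B J := IsScalarTower.of_algebraMap_smul fun r x => by
    rw [hactJ, ι.commutes, algebraMap_smul]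
  let τ := antipodeEquiv k H hS
  have hTw := eqFlat_tw_of_eqFlatR hflat τ (antipodeEquiv k B hSB) fun b => by
    rw [antipodeEquiv_apply, antipodeEquiv_apply]
    exact congrArg MulOpposite.op (hanti b).symm
  have hproj := Tw.projective (ι : B →+* H) τ
  have htv : TV B n J := tv_of_injective (ι := (ι : B →+* H)) (τ := τ) hactJ hJ hTw
    (hsilp _ hproj) (hsilp _ (Module.Projective.of_equiv
      (finsuppLequivDFinsupp (ι := ℕ) (M := Tw (ι : B →+* H) τ) H).symm))
  have hIB := pd_injective_of_tv hB htv lam h0 (fun b => by rw [hactJ, hlam, hcounit])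
    (injective_restrict ι hflat hact hI)
  have := Ind.pd ι hflat (2 * n + 1) I hIB
  rw [two_mul, add_assoc] at this
  exact this.le_of_silp hsilp

theorem pd_quotient_relSub (hS : Function.Bijective (antipode k (A := H))) {V : Submodule k H}
    (hV : CountSpan k V) (h1 : (1 : H) ∈ V)
    (hmul : ∀ x ∈ V, ∀ y ∈ V, x * y ∈ V) (hSV : ∀ x ∈ V, antipode k x ∈ V)
    {T : H →ₗ[k] H} (hT : ∀ h, T (antipode k h) = h) (hT' : ∀ h, antipode k (T h) = h)
    (hTV : ∀ x ∈ V, T x ∈ V)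
    (hr : ∀ f, ∀ x ∈ V, rOp k H f x ∈ V) (hl : ∀ f, ∀ x ∈ V, lOp k H f x ∈ V)
    (hH : IsPointedCoalgebra k H ∨ coradical k H ≤ V)
    {n : ℕ} (hsilp : ∀ (P : Type u) [AddCommGroup P] [Module H P], Module.Projective H P → ID H n P)
    {I : Type u} [AddCommGroup I] [Module k I] [Module H I] [IsScalarTower k H I]
    (hI : Module.Injective H I) : PD H n ((H ⊗[k] I) ⧸ relSub I V) := by
  obtain ⟨B, _, _, ι, hι, hcomul, hcounit, hanti, rfl⟩ := exists_hopf_sub V h1 hmul hSV hr hl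
  letI : Module B I := Module.compHom I (ι : B →+* H)
  have hact : ∀ (b : B) (x : I), b • x = ι b • x := fun _ _ => rfl
  haveI : IsScalarTower k B I := IsScalarTower.of_algebraMap_smul fun r x => by
    rw [hact, ι.commutes, algebraMap_smul]
  have hB : CountSpan k (⊤ : Submodule k B) := by
    obtain ⟨g, hg⟩ := ι.toLinearMap.exists_leftInverse_of_injective (LinearMap.ker_eq_bot.2 hι)
    have := hV.map g
    rwa [← LinearMap.range_comp, hg, LinearMap.range_id] at this
  have := pd_ind_of_countable ι (eqFlatR_of_pointed_or_coradical ι hcomul hcounit hι hH) hB hcounit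
    hanti hS (bijective_antipode_sub hι hanti hT hT' fun b => hTV _ ⟨b, rfl⟩) hsilp hact hI
  have hrel : relSub I (LinearMap.range ι.toLinearMap) = indRel ι I := by
    refine congrArg (Submodule.span H) (Set.ext fun z => ⟨?_, ?_⟩)
    · rintro ⟨_, ⟨b, rfl⟩, x, rfl⟩
      exact ⟨b, x, rfl⟩
    · rintro ⟨b, x, rfl⟩
      exact ⟨ι b, ⟨b, rfl⟩, x, rfl⟩
  rw [hrel]
  exact this

/-- Over a Hopf algebra as in the theorem, `l.silp ≤ n` bounds the projective dimension of
injective modules. -/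
theorem spli_le_of_silp_le (hS : Function.Bijective (antipode k (A := H)))
    (hpt : IsPointedCoalgebra k H ∨
      ∃ s : Set H, s.Countable ∧ Submodule.span k s = coradical k H) (n : ℕ)
    (hsilp : ∀ (P : Type u) [AddCommGroup P] [Module H P], Module.Projective H P → ID H n P)
    (I : Type u) [AddCommGroup I] [Module H I] (hI : Module.Injective H I) : PD H n I := by
  letI : Module k I := Module.compHom I (algebraMap k H)
  haveI : IsScalarTower k H I := IsScalarTower.of_algebraMap_smul fun _ _ => rfl
  obtain ⟨T, hT, hT'⟩ := exists_inv_antipode hS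
  obtain ⟨S, hSc, hcor⟩ : ∃ S : Set H, S.Countable ∧
      (IsPointedCoalgebra k H ∨ coradical k H ≤ Submodule.span k S) := by
    rcases hpt with h | ⟨s, hs, h⟩
    · exact ⟨∅, Set.countable_empty, .inl h⟩
    · exact ⟨s, hs, .inr h.ge⟩
  have key := pd_quotient_of_countable (R := H) (G := H ⊗[k] I) n
    (fun M _ _ hM => hM.le_of_silp hsilp) inferInstance
    (fun X => relSub I (genSpan k T S X))
    (fun s t h => relSub_mono (genSpan_mono h)) (fun c hc hne z hz => exists_of_chain_relSub hc hne hz)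
    (fun X hX => pd_quotient_relSub hS (countSpan_genSpan hSc hX) one_mem_genSpan mul_mem_genSpan
      antipode_mem_genSpan hT hT' inv_mem_genSpan rOp_mem_genSpan lOp_mem_genSpan
      (hcor.imp_right fun h => h.trans
        (Submodule.span_le.2 (Set.subset_union_left.trans subset_genSpan))) hsilp hI)
    Set.univ
  have htop : genSpan k T S Set.univ = ⊤ :=
    top_unique fun x _ => subset_genSpan (.inr (Set.mem_univ x))
  rw [htop] at key
  exact pd_quotient_relSub_top key

end CountableCase

end SilpSpli

/-- Let `H` be a Hopf algebra over a field `k` with bijective antipode.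
If `H` is pointed, or more generally if the coradical of `H` is countably dimensional over
`k`, then `l.silp(H) = l.spli(H)`. -/
theorem silp_eq_spli_of_pointed_or_countable_coradical (k : Type u) [Field k]
    (H : Type u) [Ring H] [HopfAlgebra k H]
    (hS : Function.Bijective (HopfAlgebra.antipode (R := k) (A := H)))
    (hpt : IsPointedCoalgebra k H ∨
      ∃ s : Set H, s.Countable ∧ Submodule.span k s = coradical k H) :
    silp H = spli H := by
  refine SilpSpli.eq_of_forall_nat_le fun n => ?_
  rw [SilpSpli.silp_le_iff, SilpSpli.spli_le_iff]
  exact ⟨SilpSpli.spli_le_of_silp_le hS hpt n, SilpSpli.silp_le_of_spli_le hS n⟩
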